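/- arXiv:2410.20985 — 2 statements merged into one kernel-verified Lean document; each statement's English description precedes it below -/
import Mathlib

section
/- Let n ≥ 2, let φ be a rational inner function on the polydisc 𝔻ⁿ, let α ∈ 𝕋, and let μ_α be a Clark measure of φ at α. Assume that the closure of φ₁⁻¹(α) := {ζ ∈ 𝕋ⁿ : lim_{ρ→1⁻} φ(ρζ) = α} does not contain any set of the form pr_j⁻¹(V), where j ∈ {1,…,n}, pr_j : 𝕋ⁿ → 𝕋^{n−1} deletes the j-th coordinate, and V ⊆ 𝕋^{n−1} is the intersection of 𝕋^{n−1} with the common zero set of a finite family of real polynomials in the real and imaginary parts of the coordinates of ℂ^{n−1}, with Hausdorff dimension n − 2. Then, for every j ∈ {1,…,n}, the function 𝕋ⁿ ∋ ζ ↦ conj(ζ_j) (the complex conjugate of the j-th coordinate) belongs to H²(μ_α). -/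
open MeasureTheory Filter Set
open scoped ENNReal

noncomputable section

/-- We endow finite-dimensional complex Euclidean spaces with their Borel σ-algebra. -/
instance {ι : Type*} [Fintype ι] : MeasurableSpace (EuclideanSpace ℂ ι) := borel _
instance {ι : Type*} [Fintype ι] : BorelSpace (EuclideanSpace ℂ ι) := ⟨rfl⟩

/-- Evaluation of a polynomial in the variables `ι` at a point of `ℂ^ι`. -/
def pEval {ι : Type*} (p : MvPolynomial ι ℂ) (z : EuclideanSpace ℂ ι) : ℂ :=
  MvPolynomial.eval (fun i => z i) p

/-- The open unit polydisc `𝔻ⁿ` in `ℂⁿ`. -/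
def polydisc (n : ℕ) : Set (EuclideanSpace ℂ (Fin n)) := {z | ∀ j, ‖z j‖ < 1}

/-- The unit torus `𝕋^ι` in `ℂ^ι`. -/
def torus (ι : Type*) : Set (EuclideanSpace ℂ ι) := {ζ | ∀ j, ‖ζ j‖ = 1}

/-- `φ` has radial limit `α` at `ζ`: `φ(ρζ) → α` as `ρ → 1⁻`. -/
def HasRadialLimit {n : ℕ} (φ : EuclideanSpace ℂ (Fin n) → ℂ)
    (ζ : EuclideanSpace ℂ (Fin n)) (α : ℂ) : Prop :=
  Tendsto (fun ρ : ℝ => φ ((ρ : ℂ) • ζ)) (nhdsWithin 1 (Set.Iio 1)) (nhds α)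

/-- `φ` is the rational inner function `p/q` on the polydisc `𝔻ⁿ`: `p, q` have no common
nonconstant factor, `q` is zero-free on `𝔻ⁿ`, `|φ| < 1` on `𝔻ⁿ`, and for a.e. `ζ ∈ 𝕋ⁿ`
(w.r.t. the Haar measure of `𝕋ⁿ`, i.e. up to an `ℋⁿ`-null set) the radial limit of `φ` at `ζ`
exists and is unimodular. -/
structure IsRationalInner (n : ℕ) (p q : MvPolynomial (Fin n) ℂ)
    (φ : EuclideanSpace ℂ (Fin n) → ℂ) : Prop where
  coprime : ∀ d : MvPolynomial (Fin n) ℂ, d ∣ p → d ∣ q → IsUnit d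
  q_ne_zero : ∀ z ∈ polydisc n, pEval q z ≠ 0
  phi_eq : ∀ z ∈ polydisc n, φ z = pEval p z / pEval q z
  abs_lt_one : ∀ z ∈ polydisc n, ‖φ z‖ < 1
  inner : ∃ E ⊆ torus (Fin n), μH[(n : ℝ)] E = 0 ∧
    ∀ ζ ∈ torus (Fin n) \ E, ∃ β : ℂ, ‖β‖ = 1 ∧ HasRadialLimit φ ζ β

/-- `μ` is a Clark measure of `φ` at `α`: a finite positive Borel measure on `𝕋ⁿ` whose
Poisson–Szegő integral is `(1-|φ|²)/|α-φ|²`. -/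
def IsClarkMeasure (n : ℕ) (φ : EuclideanSpace ℂ (Fin n) → ℂ) (α : ℂ)
    (μ : Measure (EuclideanSpace ℂ (Fin n))) : Prop :=
  IsFiniteMeasure μ ∧ μ (torus (Fin n))ᶜ = 0 ∧
    ∀ z ∈ polydisc n,
      ∫⁻ ζ, ENNReal.ofReal (∏ j, (1 - ‖z j‖ ^ 2) / ‖ζ j - z j‖ ^ 2) ∂μ
        = ENNReal.ofReal ((1 - ‖φ z‖ ^ 2) / ‖α - φ z‖ ^ 2)

/-- The subset of `L²(μ)` consisting of (classes of) holomorphic polynomial functions;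
`H²(μ)` is its closure in `L²(μ)`. -/
def polyLp (n : ℕ) (μ : Measure (EuclideanSpace ℂ (Fin n))) : Set (Lp ℂ 2 μ) :=
  {f | ∃ p : MvPolynomial (Fin n) ℂ, ⇑f =ᵐ[μ] pEval p}

/-- `φ₁⁻¹(α)`: the set of `ζ ∈ 𝕋ⁿ` where the radial limit of `φ` exists and equals `α`. -/
def radialFiber {n : ℕ} (φ : EuclideanSpace ℂ (Fin n) → ℂ) (α : ℂ) :
    Set (EuclideanSpace ℂ (Fin n)) :=
  {ζ | ζ ∈ torus (Fin n) ∧ HasRadialLimit φ ζ α}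

/-- The common zero set in `ℂ^ι` of a finite family of real polynomials in the real and
imaginary parts of the coordinates. -/
def realZeroSet {ι : Type*} (s : Finset (MvPolynomial (ι × Bool) ℝ)) :
    Set (EuclideanSpace ℂ ι) :=
  {w | ∀ P ∈ s, MvPolynomial.eval (fun ib => if ib.2 then (w ib.1).re else (w ib.1).im) P = 0}

/-- The projection `ℂⁿ → ℂ^{n-1}` deleting the `j`-th coordinate. -/
def deleteCoord {n : ℕ} (j : Fin n) (ζ : EuclideanSpace ℂ (Fin n)) :
    EuclideanSpace ℂ {i : Fin n // i ≠ j} :=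
  (WithLp.equiv 2 _).symm fun i => ζ i.1

open scoped Topology

/-- A complex polynomial without zeros in a disc grows at most by the factor `2 ^ deg` between
the centre and any point of the closed disc. -/
lemma Polynomial.norm_eval_le_of_ne_zero_on_ball (f : Polynomial ℂ) {a z : ℂ} {δ : ℝ}
    (h : ∀ w, ‖w - a‖ < δ → f.eval w ≠ 0) (hz : ‖z - a‖ ≤ δ) :
    ‖f.eval z‖ ≤ 2 ^ f.natDegree * ‖f.eval a‖ := by
  have hs := IsAlgClosed.splits f
  have hcard : f.roots.card = f.natDegree := (Polynomial.splits_iff_card_roots.1 hs)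
  have key : ∀ s : Multiset ℂ, (∀ w ∈ s, δ ≤ ‖w - a‖) →
      (s.map fun w => ‖z - w‖).prod ≤ 2 ^ s.card * (s.map fun w => ‖a - w‖).prod := by
    intro s
    induction s using Multiset.induction_on with
    | empty => simp
    | cons w s ih =>
      intro hw
      have h1 := ih fun v hv => hw v (Multiset.mem_cons_of_mem hv)
      have h2 := hw w (Multiset.mem_cons_self w s)
      have h3 : ‖z - w‖ ≤ 2 * ‖a - w‖ := by
        have : z - w = (z - a) + (a - w) := by ring
        rw [this]
        have h4 := norm_add_le (z - a) (a - w)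
        rw [norm_sub_rev] at h2
        linarith
      simp only [Multiset.map_cons, Multiset.prod_cons, Multiset.card_cons, pow_succ]
      have h0 : 0 ≤ (s.map fun w => ‖z - w‖).prod :=
        Multiset.prod_nonneg (by simp)
      calc _ ≤ (2 * ‖a - w‖) * (2 ^ s.card * (s.map fun w => ‖a - w‖).prod) := by gcongr
        _ = _ := by ring
  have hev : ∀ x, ‖f.eval x‖ = ‖f.leadingCoeff‖ * (f.roots.map fun w => ‖x - w‖).prod := by
    intro x
    have h1 := hs.eval_eq_prod_roots x
    rw [h1, norm_mul]
    congr 1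
    have := map_multiset_prod (normHom : ℂ →*₀ ℝ) (f.roots.map fun w => x - w)
    simpa [Multiset.map_map, Function.comp_def] using this
  rw [hev, hev, ← hcard]
  have := key f.roots (by
    intro w hw
    by_contra! hlt
    exact h w hlt ((Polynomial.mem_roots'.1 hw).2))
  calc _ ≤ ‖f.leadingCoeff‖ * (2 ^ f.roots.card * (f.roots.map fun w => ‖a - w‖).prod) := by
        gcongr
    _ = _ := by ring

namespace MvPolynomial

variable {σ : Type*}

/-- The restriction of a multivariate polynomial to the line `X ↦ x + X • y`. -/
def line (P : MvPolynomial σ ℂ) (x y : σ → ℂ) : Polynomial ℂ :=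
  aeval (fun i => Polynomial.C (x i) + Polynomial.C (y i) * Polynomial.X) P

lemma eval_line (P : MvPolynomial σ ℂ) (x y : σ → ℂ) (t : ℂ) :
    (P.line x y).eval t = eval (x + t • y) P := by
  unfold line
  induction P using MvPolynomial.induction_on with
  | C a => simp
  | add p q hp hq => rw [map_add, Polynomial.eval_add, hp, hq, map_add]
  | mul_X p i hp =>
    rw [map_mul, Polynomial.eval_mul, hp, map_mul]
    simp [mul_comm t]

lemma natDegree_line_le (P : MvPolynomial σ ℂ) (x y : σ → ℂ) :
    (P.line x y).natDegree ≤ P.totalDegree := by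
  have := aeval_natDegree_le (n := 1) P le_rfl
    (fun i => Polynomial.C (x i) + Polynomial.C (y i) * Polynomial.X) (fun i => by
      rw [add_comm]; exact Polynomial.natDegree_linear_le)
  simpa [line] using this

/-- Along a line on which `P` has no zeros in a disc, `‖P‖` is at most `2 ^ deg` times its value
at the centre. -/
lemma norm_eval_line_le (P : MvPolynomial σ ℂ) (x y : σ → ℂ) {a z : ℂ} {δ : ℝ}
    (h : ∀ w, ‖w - a‖ < δ → eval (x + w • y) P ≠ 0) (hz : ‖z - a‖ ≤ δ) :
    ‖eval (x + z • y) P‖ ≤ 2 ^ P.totalDegree * ‖eval (x + a • y) P‖ := by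
  have h1 := (P.line x y).norm_eval_le_of_ne_zero_on_ball (a := a) (z := z) (δ := δ)
    (by simpa [eval_line] using h) hz
  simp only [eval_line] at h1
  refine h1.trans ?_
  gcongr
  · norm_num
  · exact natDegree_line_le P x y

lemma continuous_eval_complex (P : MvPolynomial σ ℂ) : Continuous fun z : σ → ℂ => eval z P :=
  MvPolynomial.continuous_eval P

variable [DecidableEq σ]

lemma update_eq_line (z : σ → ℂ) (j : σ) (w : ℂ) :
    Function.update z j w = Function.update z j 0 + w • Pi.single j 1 := by
  ext i
  by_cases h : i = j
  · subst h; simp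
  · simp [h]

lemma norm_eval_update_le (P : MvPolynomial σ ℂ) (z : σ → ℂ) (j : σ) {a w : ℂ} {δ : ℝ}
    (h : ∀ v, ‖v - a‖ < δ → eval (Function.update z j v) P ≠ 0) (hw : ‖w - a‖ ≤ δ) :
    ‖eval (Function.update z j w) P‖ ≤
      2 ^ P.totalDegree * ‖eval (Function.update z j a) P‖ := by
  have := P.norm_eval_line_le (Function.update z j 0) (Pi.single j 1) (a := a) (z := w) (δ := δ)
    (fun v hv => by rw [← update_eq_line]; exact h v hv) hw
  rwa [← update_eq_line, ← update_eq_line] at this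

/-- A polynomial vanishing at `update z j v` for infinitely many `v` vanishes for all `v`. -/
lemma eval_update_eq_zero_of_infinite (P : MvPolynomial σ ℂ) (z : σ → ℂ) (j : σ) {s : Set ℂ}
    (hs : s.Infinite) (h : ∀ v ∈ s, eval (Function.update z j v) P = 0) (w : ℂ) :
    eval (Function.update z j w) P = 0 := by
  have h0 : P.line (Function.update z j 0) (Pi.single j 1) = 0 := by
    refine Polynomial.eq_zero_of_infinite_isRoot _ (hs.mono fun v hv => ?_)
    change Polynomial.eval v _ = 0
    rw [eval_line, ← update_eq_line]
    exact h v hv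
  rw [update_eq_line, ← eval_line, h0, Polynomial.eval_zero]

lemma infinite_ball (a : ℂ) {δ : ℝ} (hδ : 0 < δ) : {v : ℂ | ‖v - a‖ < δ}.Infinite := by
  have : {v : ℂ | ‖v - a‖ < δ} = Metric.ball a δ := by ext; simp [dist_eq_norm]
  rw [this]
  exact infinite_of_mem_nhds a (Metric.ball_mem_nhds a hδ)

/-- Hurwitz's theorem for restrictions of polynomials to coordinate lines. -/
lemma eval_update_eq_zero_of_tendsto {ι : Type*} {l : Filter ι} [l.NeBot]
    (P : MvPolynomial σ ℂ) (j : σ) {x : ι → σ → ℂ} {z : σ → ℂ} (hx : Tendsto x l (𝓝 z)) {a : ℂ}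
    {δ : ℝ} (hδ : 0 < δ)
    (h : ∀ᶠ m in l, ∀ v, ‖v - a‖ < δ → eval (Function.update (x m) j v) P ≠ 0)
    (ha : eval (Function.update z j a) P = 0) (w : ℂ) :
    eval (Function.update z j w) P = 0 := by
  refine P.eval_update_eq_zero_of_infinite z j (infinite_ball a hδ) (fun v hv => ?_) w
  have hlim : ∀ u, Tendsto (fun m => ‖eval (Function.update (x m) j u) P‖) l
      (𝓝 ‖eval (Function.update z j u) P‖) := fun u =>
    ((P.continuous_eval_complex.tendsto _).comp (hx.update j tendsto_const_nhds)).norm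
  have := le_of_tendsto_of_tendsto (hlim v) ((hlim a).const_mul (2 ^ P.totalDegree))
    (h.mono fun m hm => P.norm_eval_update_le (x m) j hm (le_of_lt hv))
  rw [ha] at this
  simpa using this

end MvPolynomial

lemma Complex.infinite_circle_ball {a : ℂ} (ha : ‖a‖ = 1) {δ : ℝ} (hδ : 0 < δ) :
    {w : ℂ | ‖w‖ = 1 ∧ ‖w - a‖ < δ}.Infinite := by
  have ha0 : a ≠ 0 := by rintro rfl; simp at ha
  have hlt : 0 < min 1 δ := lt_min one_pos hδ
  have hio : (Ioo (0 : ℝ) (min 1 δ)).Infinite := Ioo_infinite hlt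
  refine (hio.image (f := fun t : ℝ => a * Complex.exp (Complex.I * t)) ?_).mono ?_
  · intro s hs t ht hst
    have := congrArg Complex.arg (mul_left_cancel₀ ha0 hst)
    have hp := Real.pi_gt_three
    have h1 := min_le_left 1 δ
    rw [mul_comm Complex.I, mul_comm Complex.I, Complex.arg_exp_mul_I, Complex.arg_exp_mul_I,
      (toIocMod_eq_self _).2, (toIocMod_eq_self _).2] at this
    · exact this
    · constructor <;> linarith [ht.1, ht.2]
    · constructor <;> linarith [hs.1, hs.2]
  · rintro _ ⟨t, ht, rfl⟩
    refine ⟨by simp [ha, mul_comm Complex.I, Complex.norm_exp_ofReal_mul_I], ?_⟩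
    have h1 := Real.norm_exp_I_mul_ofReal_sub_one_le (x := t)
    have : a * Complex.exp (Complex.I * t) - a = a * (Complex.exp (Complex.I * t) - 1) := by ring
    simp only [this, norm_mul, ha, one_mul]
    refine h1.trans_lt ?_
    rw [Real.norm_eq_abs, abs_of_pos ht.1]
    exact ht.2.trans_le (min_le_right _ _)

namespace Polynomial

/-- If two polynomials have the same modulus on the unit circle, then the rational functions
`f(z) conj(f(1/conj z))` and `g(z) conj(g(1/conj z))` agree. -/
lemma eval_mul_conj_eval_inv_conj_eq {f g : Polynomial ℂ}
    (h : ∀ w : ℂ, ‖w‖ = 1 → ‖f.eval w‖ = ‖g.eval w‖) {w : ℂ} (hw : w ≠ 0) :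
    f.eval w * (starRingEnd ℂ) (f.eval ((starRingEnd ℂ) w)⁻¹) =
      g.eval w * (starRingEnd ℂ) (g.eval ((starRingEnd ℂ) w)⁻¹) := by
  set N := max f.natDegree g.natDegree
  have key : ∀ k : Polynomial ℂ, k.natDegree ≤ N → ∀ v : ℂ, v ≠ 0 →
      (k * (k.map (starRingEnd ℂ)).reflect N).eval v =
        v ^ N * (k.eval v * (starRingEnd ℂ) (k.eval ((starRingEnd ℂ) v)⁻¹)) := by
    intro k hk v hv
    have hmap : (starRingEnd ℂ) (k.eval ((starRingEnd ℂ) v)⁻¹) =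
        (k.map (starRingEnd ℂ)).eval v⁻¹ := by
      simpa using (eval_map_apply (starRingEnd ℂ) (p := k) (x := ((starRingEnd ℂ) v)⁻¹)).symm
    let _ : Invertible v⁻¹ := invertibleOfNonzero (inv_ne_zero hv)
    have h1 := eval₂_reflect_mul_pow (RingHom.id ℂ) v⁻¹ N (k.map (starRingEnd ℂ))
      (by simpa using hk)
    rw [invOf_eq_inv, inv_inv] at h1
    rw [hmap, eval_mul]
    change eval v (reflect N (map (starRingEnd ℂ) k)) * v⁻¹ ^ N =
      eval v⁻¹ (map (starRingEnd ℂ) k) at h1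
    have h2 : v ^ N * v⁻¹ ^ N = 1 := by rw [← mul_pow, mul_inv_cancel₀ hv, one_pow]
    rw [← h1]
    linear_combination (-eval v k * eval v (reflect N (map (starRingEnd ℂ) k))) * h2
  have heq : f * (f.map (starRingEnd ℂ)).reflect N = g * (g.map (starRingEnd ℂ)).reflect N := by
    refine eq_of_infinite_eval_eq _ _
      ((Complex.infinite_circle_ball (a := 1) (by simp) one_pos).mono fun v hv => ?_)
    have hv1 : ‖v‖ = 1 := hv.1
    have hv0 : v ≠ 0 := by rintro rfl; simp at hv1
    have hinv : ((starRingEnd ℂ) v)⁻¹ = v := by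
      rw [← Complex.inv_eq_conj hv1, inv_inv]
    change eval v _ = eval v _
    rw [key f (le_max_left _ _) v hv0, key g (le_max_right _ _) v hv0, hinv, Complex.mul_conj,
      Complex.mul_conj, Complex.normSq_eq_norm_sq, Complex.normSq_eq_norm_sq, h v hv1]
  have := key f (le_max_left _ _) w hw
  rw [heq, key g (le_max_right _ _) w hw] at this
  exact (mul_left_cancel₀ (pow_ne_zero N hw) this).symm

end Polynomial

namespace MvPolynomial

section
variable {R : Type*} [CommRing R] [IsDomain R] [UniqueFactorizationMonoid R]

/-- Relatively prime polynomials over a factorial ring are coprime over its fraction field. -/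
lemma isCoprime_map_of_isRelPrime (K : Type*) [Field K] [Algebra R K] [IsFractionRing R K]
    {f g : Polynomial R} (hfg : ∀ d, d ∣ f → d ∣ g → IsUnit d) :
    IsCoprime (f.map (algebraMap R K)) (g.map (algebraMap R K)) := by
  have : Nonempty (NormalizedGCDMonoid R) := inferInstance
  have hinj : Function.Injective (algebraMap R K) := IsFractionRing.injective R K
  induction f using WfDvdMonoid.induction_on_irreducible with
  | zero =>
    have := hfg g (dvd_zero g) dvd_rfl
    rw [Polynomial.map_zero, isCoprime_zero_left]
    exact this.map (Polynomial.mapRingHom (algebraMap R K))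
  | unit u hu =>
    obtain ⟨w, hw⟩ := (hu.map (Polynomial.mapRingHom (algebraMap R K))).exists_left_inv
    exact ⟨w, 0, by simpa using hw⟩
  | mul a i ha hi ih =>
    rw [Polynomial.map_mul]
    refine IsCoprime.mul_left ?_ (ih fun d hd => hfg d (hd.mul_left i))
    by_cases hdeg : i.natDegree = 0
    · rw [Polynomial.eq_C_of_natDegree_eq_zero hdeg, Polynomial.map_C]
      have h0 : algebraMap R K (i.coeff 0) ≠ 0 := by
        rw [Ne, map_eq_zero_iff _ hinj]
        intro h0
        refine hi.ne_zero ?_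
        rw [Polynomial.eq_C_of_natDegree_eq_zero hdeg, h0, Polynomial.C_0]
      exact ⟨Polynomial.C (algebraMap R K (i.coeff 0))⁻¹, 0, by
        rw [zero_mul, add_zero, ← Polynomial.C_mul, inv_mul_cancel₀ h0, Polynomial.C_1]⟩
    · have hprim := hi.isPrimitive hdeg
      have hirr := (hprim.irreducible_iff_irreducible_map_fraction_map (K := K)).1 hi
      rw [hirr.coprime_iff_not_dvd]
      intro hdvd
      exact hi.not_isUnit (hfg i (dvd_mul_right i a)
        (hprim.dvd_of_fraction_map_dvd_fraction_map hdvd))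

/-- Elimination: relatively prime polynomials over a factorial ring admit a Bézout relation with
nonzero constant right-hand side. -/
lemma exists_mul_add_mul_eq_C {f g : Polynomial R} (hfg : ∀ d, d ∣ f → d ∣ g → IsUnit d) :
    ∃ (a b : Polynomial R) (r : R), r ≠ 0 ∧ a * f + b * g = Polynomial.C r := by
  obtain ⟨u, v, huv⟩ := isCoprime_map_of_isRelPrime (FractionRing R) hfg
  obtain ⟨b, hb, hu⟩ := IsLocalization.integerNormalization_spec (nonZeroDivisors R) u
  obtain ⟨c, hc, hv⟩ := IsLocalization.integerNormalization_spec (nonZeroDivisors R) v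
  refine ⟨Polynomial.C c * IsLocalization.integerNormalization (nonZeroDivisors R) u,
    Polynomial.C b * IsLocalization.integerNormalization (nonZeroDivisors R) v, b * c,
    mul_ne_zero (nonZeroDivisors.ne_zero hb) (nonZeroDivisors.ne_zero hc), ?_⟩
  apply Polynomial.map_injective _ (IsFractionRing.injective R (FractionRing R))
  simp only [Polynomial.map_add, Polynomial.map_mul, hu, hv, Polynomial.map_C, map_mul,
    Algebra.smul_def, Polynomial.algebraMap_apply]
  linear_combination (Polynomial.C (algebraMap R (FractionRing R) b) *
    Polynomial.C (algebraMap R (FractionRing R) c)) * huv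

end

variable {σ : Type*}

/-- Eliminating one variable from two relatively prime multivariate polynomials. -/
lemma exists_eliminant [DecidableEq σ] (p q : MvPolynomial σ ℂ)
    (hpq : ∀ d, d ∣ p → d ∣ q → IsUnit d) (j : σ) :
    ∃ a b r : MvPolynomial σ ℂ, r ≠ 0 ∧ a * p + b * q = r ∧
      ∀ z w, eval (Function.update z j w) r = eval z r := by
  let e : MvPolynomial σ ℂ ≃ₐ[ℂ] Polynomial (MvPolynomial {i // i ≠ j} ℂ) :=
    (renameEquiv ℂ (Equiv.optionSubtypeNe j).symm).trans (optionEquivLeft ℂ _)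
  obtain ⟨a, b, r, hr, hab⟩ := exists_mul_add_mul_eq_C (f := e p) (g := e q) (by
    intro d hp hq
    have := hpq (e.symm d) ((map_dvd e.symm hp).trans (by simp))
      ((map_dvd e.symm hq).trans (by simp))
    simpa using this.map e)
  have hrr : ∀ r, e (rename (↑) r) = Polynomial.C r := by
    intro r
    simp only [e, AlgEquiv.trans_apply, renameEquiv_apply, rename_rename, optionEquivLeft_apply]
    induction r using MvPolynomial.induction_on with
    | C a => rw [rename_C, aeval_C]; rfl
    | add r s hr hs => simp only [map_add, hr, hs]
    | mul_X r i hr => simp [hr, i.2]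
  refine ⟨e.symm a, e.symm b, rename (↑) r, ?_, ?_, ?_⟩
  · intro h
    have h1 := hrr r
    rw [h, map_zero] at h1
    exact hr (Polynomial.C_eq_zero.1 h1.symm)
  · apply e.injective
    rw [hrr, ← hab]
    simp
  · intro z w
    simp only [eval_rename]
    congr 2
    ext i
    simp [i.2]

/-- A nonzero polynomial does not vanish identically on any open piece of the torus. -/
lemma exists_torus_eval_ne_zero [Fintype σ] {r : MvPolynomial σ ℂ} (hr : r ≠ 0) {z : σ → ℂ}
    (hz : ∀ i, ‖z i‖ = 1) {δ : ℝ} (hδ : 0 < δ) :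
    ∃ w : σ → ℂ, (∀ i, ‖w i‖ = 1) ∧ dist w z < δ ∧ eval w r ≠ 0 := by
  by_contra! h
  refine hr (funext_set (fun i => {w : ℂ | ‖w‖ = 1 ∧ ‖w - z i‖ < δ})
    (fun i => Complex.infinite_circle_ball (hz i) hδ) fun x hx => ?_)
  rw [map_zero]
  refine h x (fun i => (hx i (mem_univ i)).1) ((dist_pi_lt_iff hδ).2 fun i => ?_)
  rw [dist_eq_norm]
  exact (hx i (mem_univ i)).2

end MvPolynomial

namespace MvPolynomial

variable {σ : Type*} [DecidableEq σ]

/-- If `P` has no zeros in the polydisc, a zero in the closed polydisc whose `j`-th coordinate is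
in the open disc propagates along the `j`-th coordinate line. -/
lemma eval_update_eq_zero_of_norm_lt_one {P : MvPolynomial σ ℂ}
    (hP : ∀ z : σ → ℂ, (∀ i, ‖z i‖ < 1) → eval z P ≠ 0) {z : σ → ℂ} (hz : ∀ i, ‖z i‖ ≤ 1)
    {j : σ} {a : ℂ} (ha : ‖a‖ < 1) (h : eval (Function.update z j a) P = 0) (w : ℂ) :
    eval (Function.update z j w) P = 0 := by
  have hlim : Tendsto (fun r : ℝ => (r : ℂ) • z) (𝓝[<] 1) (𝓝 z) := by
    have : Tendsto (fun r : ℝ => (r : ℂ) • z) (𝓝 1) (𝓝 (((1 : ℝ) : ℂ) • z)) :=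
      Continuous.tendsto (by fun_prop) 1
    rw [Complex.ofReal_one, one_smul] at this
    exact this.mono_left nhdsWithin_le_nhds
  refine P.eval_update_eq_zero_of_tendsto j hlim (δ := 1 - ‖a‖) (by linarith) ?_ h w
  filter_upwards [Ioo_mem_nhdsLT (zero_lt_one' ℝ)] with r hr v hv
  refine hP _ fun i => ?_
  by_cases hi : i = j
  · subst hi
    have := norm_add_le (v - a) a
    rw [sub_add_cancel] at this
    rw [Function.update_self]
    linarith
  · rw [Function.update_of_ne hi, Pi.smul_apply, norm_smul, Complex.norm_real, Real.norm_eq_abs,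
      abs_of_pos hr.1]
    have := hz i
    nlinarith [hr.1, hr.2, norm_nonneg (z i)]

variable {p q : MvPolynomial σ ℂ} {α : ℂ}

/-- Reflection in the `j`-th variable of solutions of `p = α q` for polynomials of equal modulus
on the torus. -/
lemma eval_update_inv_conj_eq_zero (hα : ‖α‖ = 1)
    (hpq : ∀ z : σ → ℂ, (∀ i, ‖z i‖ = 1) → ‖eval z p‖ = ‖eval z q‖) {z : σ → ℂ}
    (hz : ∀ i, ‖z i‖ = 1) {j : σ} {a : ℂ} (ha : a ≠ 0)
    (h : eval (Function.update z j a) (p - C α * q) = 0)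
    (hq : eval (Function.update z j a) q ≠ 0) :
    eval (Function.update z j ((starRingEnd ℂ) a)⁻¹) (p - C α * q) = 0 := by
  have h1 := Polynomial.eval_mul_conj_eval_inv_conj_eq
    (f := p.line (Function.update z j 0) (Pi.single j 1))
    (g := q.line (Function.update z j 0) (Pi.single j 1)) (fun w hw => by
      simp only [eval_line, ← update_eq_line]
      refine hpq _ fun i => ?_
      by_cases hi : i = j
      · subst hi; simpa
      · simpa [hi] using hz i) ha
  simp only [eval_line, ← update_eq_line] at h1
  simp only [map_sub, map_mul, eval_C, sub_eq_zero] at h ⊢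
  rw [h] at h1
  have h2 : α * (starRingEnd ℂ) (eval (Function.update z j ((starRingEnd ℂ) a)⁻¹) p) =
      (starRingEnd ℂ) (eval (Function.update z j ((starRingEnd ℂ) a)⁻¹) q) := by
    refine mul_left_cancel₀ hq ?_
    rw [← h1]; ring
  have h3 := congrArg (starRingEnd ℂ) h2
  rw [map_mul, Complex.conj_conj, Complex.conj_conj] at h3
  rw [← h3, ← mul_assoc, Complex.mul_conj, Complex.normSq_eq_norm_sq, hα]
  simp

variable [Fintype σ]

lemma exists_regular_zero_of_update (hα : ‖α‖ = 1) (hcop : ∀ d, d ∣ p → d ∣ q → IsUnit d)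
    (hP : ∀ z : σ → ℂ, (∀ i, ‖z i‖ < 1) → eval z (p - C α * q) ≠ 0)
    (hpq : ∀ z : σ → ℂ, (∀ i, ‖z i‖ = 1) → ‖eval z p‖ = ‖eval z q‖) {z : σ → ℂ}
    (hz : ∀ i, ‖z i‖ = 1) (h0 : eval z (p - C α * q) = 0) {j : σ} {w : ℂ}
    (hw : eval (Function.update z j w) (p - C α * q) ≠ 0) {δ : ℝ} (hδ : 0 < δ) :
    ∃ x : σ → ℂ, (∀ i, ‖x i‖ = 1) ∧ dist x z < δ ∧ eval x (p - C α * q) = 0 ∧ eval x q ≠ 0 := by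
  by_contra! hcon
  obtain ⟨a, b, r, hr, hab, hrj⟩ := exists_eliminant p q hcop j
  choose x hx1 hx2 hx3 using fun m : ℕ =>
    exists_torus_eval_ne_zero hr hz (δ := min δ (1 / ((m : ℝ) + 1))) (by positivity)
  have hlim : Tendsto x atTop (𝓝 z) := by
    rw [tendsto_iff_dist_tendsto_zero]
    exact squeeze_zero (fun _ => dist_nonneg)
      (fun m => ((hx2 m).trans_le (min_le_right _ _)).le) tendsto_one_div_add_atTop_nhds_zero_nat
  refine hw ((p - C α * q).eval_update_eq_zero_of_tendsto j hlim (a := z j) hδ ?_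
    (by rwa [Function.update_eq_self]) w)
  refine Eventually.of_forall fun m v hv hzero => ?_
  have hqne : ∀ v, eval (Function.update (x m) j v) (p - C α * q) = 0 →
      eval (Function.update (x m) j v) q ≠ 0 := by
    intro v hv hq
    have hp : eval (Function.update (x m) j v) p = 0 := by simpa [hq] using hv
    apply hx3 m
    rw [← hrj (x m) v, ← hab]
    simp [hp, hq]
  have hcirc : ∀ v, ‖v‖ = 1 → ‖v - z j‖ < δ →
      eval (Function.update (x m) j v) (p - C α * q) ≠ 0 := by
    intro v hv1 hvd hv0
    refine hqne v hv0 (hcon _ (fun i => ?_) ?_ hv0)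
    · by_cases hi : i = j
      · subst hi; simpa
      · simpa [hi] using hx1 m i
    · rw [dist_pi_lt_iff hδ]
      intro i
      by_cases hi : i = j
      · subst hi; simpa [dist_eq_norm]
      · simpa [hi] using
          (dist_le_pi_dist (x m) z i).trans_lt ((hx2 m).trans_le (min_le_left _ _))
  have hin : ∀ v, ‖v‖ < 1 → eval (Function.update (x m) j v) (p - C α * q) ≠ 0 := by
    intro v hv1 hv0
    exact hcirc (z j) (hz j) (by simpa) (eval_update_eq_zero_of_norm_lt_one hP
      (fun i => (hx1 m i).le) hv1 hv0 _)
  rcases lt_trichotomy ‖v‖ 1 with h | h | h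
  · exact hin v h hzero
  · exact hcirc v h hv hzero
  · have hv0 : v ≠ 0 := by rintro rfl; simp at h; linarith
    refine hin _ ?_ (eval_update_inv_conj_eq_zero hα hpq (hx1 m) hv0 hzero (hqne v hzero))
    rw [norm_inv, RCLike.norm_conj]
    exact inv_lt_one_of_one_lt₀ h

/-- Zeros of `p - α q` on the torus are limits of such zeros at which `q` does not vanish. -/
lemma exists_regular_zero (hα : ‖α‖ = 1) (hcop : ∀ d, d ∣ p → d ∣ q → IsUnit d)
    (hP : ∀ z : σ → ℂ, (∀ i, ‖z i‖ < 1) → eval z (p - C α * q) ≠ 0)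
    (hpq : ∀ z : σ → ℂ, (∀ i, ‖z i‖ = 1) → ‖eval z p‖ = ‖eval z q‖) {z : σ → ℂ}
    (hz : ∀ i, ‖z i‖ = 1) (h0 : eval z (p - C α * q) = 0) {δ : ℝ} (hδ : 0 < δ) :
    ∃ x : σ → ℂ, (∀ i, ‖x i‖ = 1) ∧ dist x z < δ ∧ eval x (p - C α * q) = 0 ∧ eval x q ≠ 0 := by
  by_contra! hcon
  have hne : p - C α * q ≠ 0 := by
    intro h
    exact hP 0 (by simp) (by rw [h, map_zero])
  have key : ∀ s : Finset σ, ∀ x : σ → ℂ, (∀ i, ‖x i‖ = 1) → dist x z < δ →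
      (∀ i ∉ s, x i = z i) → eval x (p - C α * q) = 0 := by
    intro s
    induction s using Finset.induction_on with
    | empty =>
      intro x _ _ hxs
      have hxz : x = z := _root_.funext fun i => hxs i (Finset.notMem_empty i)
      rwa [hxz]
    | insert k s hk ih =>
      intro x hx hxd hxs
      have hyd : dist (Function.update x k (z k)) z < δ := by
        rw [dist_pi_lt_iff hδ]
        intro i
        by_cases hi : i = k
        · subst hi; simpa
        · simpa [hi] using (dist_le_pi_dist x z i).trans_lt hxd
      have hy : ∀ i, ‖Function.update x k (z k) i‖ = 1 := by
        intro i
        by_cases hi : i = k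
        · subst hi; simpa using hz i
        · simpa [hi] using hx i
      have hy0 := ih _ hy hyd (fun i hi => by
        by_cases hik : i = k
        · subst hik; simp
        · simpa [hik] using hxs i (by simp [hik, hi]))
      by_contra hx0
      obtain ⟨y, hy1, hy2, hy3, hy4⟩ := exists_regular_zero_of_update hα hcop hP hpq hy hy0
        (j := k) (w := x k) (by simpa using hx0) (δ := δ - dist (Function.update x k (z k)) z)
        (by linarith)
      refine hy4 (hcon y hy1 ?_ hy3)
      linarith [dist_triangle y (Function.update x k (z k)) z]
  obtain ⟨x, hx1, hx2, hx3⟩ := exists_torus_eval_ne_zero hne hz hδ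
  exact hx3 (key Finset.univ x hx1 hx2 (by simp))

end MvPolynomial

open Module in
lemma HasStrictFDerivAt.exists_dimH_zero_inter_le {E F : Type*} [NormedAddCommGroup E]
    [NormedSpace ℝ E] [FiniteDimensional ℝ E] [NormedAddCommGroup F] [NormedSpace ℝ F]
    {g : E → F} {g' : E →L[ℝ] F} {x : E} (hg : HasStrictFDerivAt g g' x) (h0 : g' ≠ 0) :
    ∃ U ∈ 𝓝 x, dimH ({y | g y = 0} ∩ U) ≤ (finrank ℝ E - 1 : ℕ) := by
  obtain ⟨π, hπ⟩ : (LinearMap.ker (g' : E →ₗ[ℝ] F)).ClosedComplemented :=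
    Submodule.ClosedComplemented.of_finiteDimensional _
  have hinj : LinearMap.ker (g'.prod π).toLinearMap = ⊥ := by
    rw [LinearMap.ker_eq_bot']
    intro v hv
    have h1 : g' v = 0 := congrArg Prod.fst hv
    have h2 : π v = 0 := congrArg Prod.snd hv
    simpa [h2] using (congrArg Subtype.val (hπ ⟨v, h1⟩)).symm
  obtain ⟨K, hK, hanti⟩ := LinearMap.exists_antilipschitzWith _ hinj
  have hbd : ∀ v : E, ‖v‖ ≤ K * max ‖g' v‖ ‖π v‖ := fun v => by
    simpa using hanti.le_mul_norm_sub v 0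
  have hKpos : (0 : ℝ) < K := hK
  have hev := hg.isLittleO.def (c := 1 / (2 * K)) (by positivity)
  rw [nhds_prod_eq, eventually_prod_self_iff'] at hev
  obtain ⟨U, hU, hUS⟩ := hev
  refine ⟨U, hU, ?_⟩
  set S : Set E := {y | g y = 0} ∩ U with hS
  have hA : AntilipschitzWith K (fun y : S => π (y : E)) := by
    refine AntilipschitzWith.of_le_mul_dist fun y z => ?_
    have h1 := hUS y.1 y.2.2 z.1 z.2.2
    simp only [show g y.1 = 0 from y.2.1, show g z.1 = 0 from z.2.1, sub_self, zero_sub,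
      norm_neg] at h1
    have h2 := hbd ((y : E) - z)
    rw [Subtype.dist_eq, dist_eq_norm, dist_eq_norm, ← map_sub]
    rcases max_cases ‖g' ((y : E) - z)‖ ‖π ((y : E) - z)‖ with h | h
    · rw [h.1] at h2
      have h3 : (K : ℝ) * ‖g' ((y : E) - z)‖ ≤ K * (1 / (2 * K) * ‖(y : E) - z‖) := by gcongr
      have h4 : (K : ℝ) * (1 / (2 * K) * ‖(y : E) - z‖) = ‖(y : E) - z‖ / 2 := by
        field_simp
      have h5 : ‖(y : E) - z‖ ≤ 0 := by linarith
      exact h5.trans (by positivity)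
    · rwa [h.1] at h2
  have hlt : finrank ℝ (LinearMap.ker (g' : E →ₗ[ℝ] F)) ≤ finrank ℝ E - 1 := by
    have : finrank ℝ (LinearMap.ker (g' : E →ₗ[ℝ] F)) < finrank ℝ E := by
      refine Submodule.finrank_lt fun h => h0 ?_
      ext v
      have : v ∈ LinearMap.ker (g' : E →ₗ[ℝ] F) := h ▸ Submodule.mem_top
      exact this
    omega
  calc dimH S = dimH (univ : Set S) := by
        rw [← (isometry_subtype_coe (s := S)).dimH_image, image_univ, Subtype.range_coe]
    _ ≤ dimH ((fun y : S => π (y : E)) '' univ) := hA.le_dimH_image _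
    _ ≤ dimH (univ : Set (LinearMap.ker (g' : E →ₗ[ℝ] F))) := dimH_mono (subset_univ _)
    _ = finrank ℝ (LinearMap.ker (g' : E →ₗ[ℝ] F)) := Real.dimH_univ_eq_finrank _
    _ ≤ _ := by exact_mod_cast hlt

open Module in
lemma dimH_zero_le_of_hasStrictFDerivAt {E F : Type*} [NormedAddCommGroup E]
    [NormedSpace ℝ E] [FiniteDimensional ℝ E] [NormedAddCommGroup F] [NormedSpace ℝ F]
    {g : E → F} {g' : E → E →L[ℝ] F} (hg : ∀ x, HasStrictFDerivAt g (g' x) x) :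
    dimH {x | g x = 0 ∧ g' x ≠ 0} ≤ (finrank ℝ E - 1 : ℕ) := by
  by_contra! h
  obtain ⟨x, hx, hlt⟩ := exists_mem_nhdsWithin_lt_dimH_of_lt_dimH h
  obtain ⟨U, hU, hle⟩ := (hg x).exists_dimH_zero_inter_le hx.2
  refine (hlt ({x | g x = 0 ∧ g' x ≠ 0} ∩ U)
    (inter_mem self_mem_nhdsWithin (mem_nhdsWithin_of_mem_nhds hU))).not_ge ?_
  exact (dimH_mono (inter_subset_inter_left _ fun y hy => hy.1)).trans hle

section TorusParam

variable {ι : Type*}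

/-- The parametrisation of the torus by angles. -/
def torusParam (θ : ι → ℝ) : EuclideanSpace ℂ ι :=
  WithLp.toLp 2 fun k => Complex.exp (θ k * Complex.I)

lemma torus_eq_image_torusParam :
    torus ι = torusParam '' {θ | ∀ k, θ k ∈ Icc (-Real.pi) Real.pi} := by
  ext ζ
  constructor
  · intro h
    refine ⟨fun k => (ζ k).arg, fun k => ⟨(Complex.neg_pi_lt_arg _).le, Complex.arg_le_pi _⟩, ?_⟩
    ext k
    have := Complex.norm_mul_exp_arg_mul_I (ζ k)
    rw [h k] at this
    simpa [torusParam] using this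
  · rintro ⟨θ, -, rfl⟩ k
    exact Complex.norm_exp_ofReal_mul_I _

lemma totalDegree_pderiv_lt {Q : MvPolynomial ι ℂ} {i : ι} (h : MvPolynomial.pderiv i Q ≠ 0) :
    (MvPolynomial.pderiv i Q).totalDegree < Q.totalDegree := by
  have key : ∀ m ∈ (MvPolynomial.pderiv i Q).support,
      (m.sum fun _ e => e) < Q.totalDegree := by
    intro m hm
    rw [MvPolynomial.mem_support_iff, MvPolynomial.coeff_pderiv] at hm
    have := MvPolynomial.le_totalDegree (MvPolynomial.mem_support_iff.2 (left_ne_zero_of_mul hm))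
    rw [Finsupp.sum_add_index' (fun _ => rfl) (fun _ _ _ => rfl), Finsupp.sum_single_index rfl]
      at this
    omega
  obtain ⟨m, hm⟩ := MvPolynomial.support_nonempty.2 h
  exact (Finset.sup_lt_iff ((Nat.zero_le _).trans_lt (key m hm))).2 key

lemma eq_C_of_pderiv_eq_zero {Q : MvPolynomial ι ℂ} (h : ∀ i, MvPolynomial.pderiv i Q = 0) :
    Q = MvPolynomial.C (MvPolynomial.coeff 0 Q) := by
  classical
  ext m
  rw [MvPolynomial.coeff_C]
  split_ifs with hm
  · rw [hm]
  · obtain ⟨i, hi⟩ : ∃ i, m i ≠ 0 := by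
      by_contra! hcon
      exact hm (Finsupp.ext fun i => (hcon i).symm)
    have h1 : MvPolynomial.coeff (m - Finsupp.single i 1) (MvPolynomial.pderiv i Q) = 0 := by
      rw [h i, MvPolynomial.coeff_zero]
    rw [MvPolynomial.coeff_pderiv, tsub_add_cancel_of_le
      (Finsupp.single_le_iff.2 (Nat.one_le_iff_ne_zero.2 hi))] at h1
    exact (mul_eq_zero.1 h1).resolve_right (Nat.cast_add_one_ne_zero _)

variable [Fintype ι]

lemma contDiff_torusParam {m : WithTop ℕ∞} : ContDiff ℝ m (torusParam : (ι → ℝ) → _) := by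
  unfold torusParam
  refine PiLp.contDiff_toLp.comp (contDiff_pi.2 fun k => ?_)
  have : ContDiff ℝ m (fun θ : ι → ℝ => (θ k : ℂ)) :=
    Complex.ofRealCLM.contDiff.comp (contDiff_apply ℝ ℝ k)
  exact (this.mul contDiff_const).cexp

lemma exists_hasStrictFDerivAt_pEval_torusParam [DecidableEq ι] (Q : MvPolynomial ι ℂ) (θ : ι → ℝ) :
    ∃ g' : (ι → ℝ) →L[ℝ] ℂ, HasStrictFDerivAt (fun θ => pEval Q (torusParam θ)) g' θ ∧
      ∀ i, g' (Pi.single i 1) = pEval (MvPolynomial.pderiv i Q) (torusParam θ) *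
        (torusParam θ i * Complex.I) := by
  induction Q using MvPolynomial.induction_on with
  | C a =>
    refine ⟨0, ?_, fun i => by simp [pEval]⟩
    simpa [pEval] using hasStrictFDerivAt_const a θ
  | add p q hp hq =>
    obtain ⟨a, ha, ha'⟩ := hp
    obtain ⟨b, hb, hb'⟩ := hq
    have heq : (fun θ : ι → ℝ => pEval (p + q) (torusParam θ)) =
        (fun θ => pEval p (torusParam θ)) + fun θ => pEval q (torusParam θ) :=
      _root_.funext fun θ => map_add _ p q
    refine ⟨a + b, heq ▸ ha.add hb, fun i => ?_⟩
    rw [add_apply, ha', hb', map_add]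
    simp only [pEval, map_add]
    ring
  | mul_X p k hp =>
    obtain ⟨a, ha, ha'⟩ := hp
    have h1 : HasStrictFDerivAt (fun θ : ι → ℝ => (θ k : ℂ))
        (Complex.ofRealCLM.comp (ContinuousLinearMap.proj k)) θ :=
      (Complex.ofRealCLM.comp (ContinuousLinearMap.proj (R := ℝ)
        (φ := fun _ : ι => ℝ) k)).hasStrictFDerivAt
    have h2 := (h1.mul_const Complex.I).cexp
    have h3 := ha.mul h2
    have heq : (fun θ : ι → ℝ => pEval (p * MvPolynomial.X k) (torusParam θ)) =
        (fun θ => pEval p (torusParam θ)) * fun θ => Complex.exp (θ k * Complex.I) :=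
      _root_.funext fun θ => by simp [pEval, torusParam]
    refine ⟨_, heq ▸ h3, fun i => ?_⟩
    simp only [add_apply, smul_apply, ha', pEval, torusParam, Derivation.leibniz, map_add,
      MvPolynomial.pderiv_X, smul_eq_mul, map_mul, MvPolynomial.eval_X,
      ContinuousLinearMap.comp_apply, ContinuousLinearMap.proj_apply]
    rcases eq_or_ne i k with rfl | h
    · simp
      ring
    · simp [Pi.single_eq_of_ne h.symm]
      ring

lemma dimH_torus_inter_zero_le {Q : MvPolynomial ι ℂ} (hQ : Q ≠ 0) :
    dimH (torus ι ∩ {w | pEval Q w = 0}) ≤ (Fintype.card ι - 1 : ℕ) := by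
  classical
  obtain ⟨m, hm⟩ : ∃ m, Q.totalDegree = m := ⟨_, rfl⟩
  induction m using Nat.strong_induction_on generalizing Q with
  | _ m ih =>
  by_cases hc : ∃ i, MvPolynomial.pderiv i Q ≠ 0
  · obtain ⟨i, hi⟩ := hc
    have hlt : (MvPolynomial.pderiv i Q).totalDegree < m := hm ▸ totalDegree_pderiv_lt hi
    have h1 := ih _ hlt hi rfl
    set g : (ι → ℝ) → ℂ := fun θ => pEval Q (torusParam θ) with hg
    have hd : ∀ θ, ∃ g' : (ι → ℝ) →L[ℝ] ℂ, HasStrictFDerivAt g g' θ ∧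
        (pEval (MvPolynomial.pderiv i Q) (torusParam θ) ≠ 0 → g' ≠ 0) := fun θ => by
      obtain ⟨g', h1, h2⟩ := exists_hasStrictFDerivAt_pEval_torusParam Q θ
      refine ⟨g', h1, fun h h3 => ?_⟩
      have h4 := h2 i
      rw [h3, zero_apply] at h4
      exact mul_ne_zero h (mul_ne_zero (Complex.exp_ne_zero _) Complex.I_ne_zero) h4.symm
    choose g' hg' hne using hd
    have h2 : torus ι ∩ {w | pEval Q w = 0} ⊆
        (torus ι ∩ {w | pEval (MvPolynomial.pderiv i Q) w = 0}) ∪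
          torusParam '' {θ | g θ = 0 ∧ g' θ ≠ 0} := by
      rintro w ⟨hw, hw0⟩
      by_cases h : pEval (MvPolynomial.pderiv i Q) w = 0
      · exact Or.inl ⟨hw, h⟩
      · rw [torus_eq_image_torusParam] at hw
        obtain ⟨θ, -, rfl⟩ := hw
        exact Or.inr ⟨θ, ⟨hw0, hne θ h⟩, rfl⟩
    refine (dimH_mono h2).trans ?_
    rw [dimH_union]
    refine max_le h1 ?_
    refine (ContDiffOn.dimH_image_le contDiff_torusParam.contDiffOn convex_univ
      (subset_univ _)).trans ?_
    simpa using dimH_zero_le_of_hasStrictFDerivAt hg'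
  · push Not at hc
    have : Q = MvPolynomial.C (MvPolynomial.coeff 0 Q) := eq_C_of_pderiv_eq_zero hc
    have hne : MvPolynomial.coeff 0 Q ≠ 0 := fun h => hQ (by rw [this, h, map_zero])
    have hempty : torus ι ∩ {w | pEval Q w = 0} = ∅ := by
      ext w
      rw [this]
      simp [pEval, hne]
    rw [hempty, dimH_empty]
    exact bot_le

end TorusParam

open scoped NNReal in
lemma MeasureTheory.measure_le_hausdorffMeasure_of_closedBall_le {X : Type*} [MetricSpace X]
    [MeasurableSpace X] [BorelSpace X] {ν : Measure X} {K : Set X} (hK : IsClosed K) {C : ℝ≥0}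
    (hC : C ≠ 0) {d : ℝ} (hd : 0 ≤ d) {ε₀ : ℝ} (hε₀ : 0 < ε₀)
    (h : ∀ x ∈ K, ∀ ε, 0 < ε → ε < ε₀ →
      ν (Metric.closedBall x ε) ≤ C * ENNReal.ofReal (ε ^ d)) :
    ν K ≤ C * μH[d] K := by
  have hC' : (C : ℝ≥0∞) ≠ 0 := by exact_mod_cast hC
  have key : (C : ℝ≥0∞)⁻¹ • ν.restrict K ≤ μH[d] := by
    refine Measure.le_hausdorffMeasure d _ (ENNReal.ofReal (ε₀ / 2)) (by positivity) fun s hs => ?_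
    rw [Measure.smul_apply, Measure.restrict_apply' hK.measurableSet, smul_eq_mul]
    rcases (s ∩ K).eq_empty_or_nonempty with he | ⟨x, hxs, hxK⟩
    · simp [he]
    have hfin : Metric.ediam s ≠ ∞ := ne_top_of_le_ne_top ENNReal.ofReal_ne_top hs
    set D : ℝ := (Metric.ediam s).toReal with hD
    have hD0 : 0 ≤ D := ENNReal.toReal_nonneg
    have hDlt : D < ε₀ := by
      have := ENNReal.toReal_le_of_le_ofReal (by positivity) hs
      linarith
    have hsub : ∀ ε, D ≤ ε → s ∩ K ⊆ Metric.closedBall x ε := fun ε hε y hy => by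
      rw [Metric.mem_closedBall, dist_edist]
      exact (ENNReal.toReal_mono hfin (Metric.edist_le_ediam_of_mem hy.1 hxs)).trans hε
    have hlim : Tendsto (fun ε : ℝ => C * ENNReal.ofReal (ε ^ d)) (𝓝[>] D)
        (𝓝 (C * ENNReal.ofReal (D ^ d))) := by
      refine ENNReal.Tendsto.const_mul ?_ (Or.inr ENNReal.coe_ne_top)
      exact ((ENNReal.continuous_ofReal.comp
        (Real.continuous_rpow_const hd)).tendsto D).mono_left nhdsWithin_le_nhds
    have hle : ν (s ∩ K) ≤ C * ENNReal.ofReal (D ^ d) := by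
      refine ge_of_tendsto hlim ?_
      filter_upwards [Ioo_mem_nhdsGT hDlt] with ε hε
      exact (measure_mono (hsub ε hε.1.le)).trans (h x hxK ε (hD0.trans_lt hε.1) hε.2)
    rw [← ENNReal.ofReal_rpow_of_nonneg hD0 hd, hD, ENNReal.ofReal_toReal hfin] at hle
    calc (C : ℝ≥0∞)⁻¹ * ν (s ∩ K) ≤ (C : ℝ≥0∞)⁻¹ * (C * Metric.ediam s ^ d) := by gcongr
      _ = Metric.ediam s ^ d := by
        rw [← mul_assoc, ENNReal.inv_mul_cancel hC' ENNReal.coe_ne_top, one_mul]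
  have h1 := key K
  rw [Measure.smul_apply, Measure.restrict_apply_self, smul_eq_mul] at h1
  calc ν K = C * ((C : ℝ≥0∞)⁻¹ * ν K) := by
        rw [← mul_assoc, ENNReal.mul_inv_cancel hC' ENNReal.coe_ne_top, one_mul]
    _ ≤ _ := by gcongr

section TorusMeasure

variable {ι : Type*} [Fintype ι]

lemma hausdorffMeasure_torus_lt_top : μH[Fintype.card ι] (torus ι) < ∞ := by
  have hcpt : IsCompact {θ : ι → ℝ | ∀ k, θ k ∈ Icc (-Real.pi) Real.pi} := by
    have := isCompact_univ_pi (X := fun _ : ι => ℝ) (s := fun _ => Icc (-Real.pi) Real.pi)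
      fun _ => isCompact_Icc
    simpa [Set.pi] using this
  have hloc : LocallyLipschitz (torusParam : (ι → ℝ) → _) :=
    (contDiff_torusParam (m := 1)).locallyLipschitz
  obtain ⟨K, hK⟩ := hloc.locallyLipschitzOn.exists_lipschitzOnWith_of_compact hcpt
  rw [torus_eq_image_torusParam]
  refine (hK.hausdorffMeasure_image_le (by positivity)).trans_lt ?_
  rw [hausdorffMeasure_pi_real]
  exact ENNReal.mul_lt_top (ENNReal.rpow_lt_top_of_nonneg (by positivity) ENNReal.coe_ne_top)
    hcpt.measure_lt_top

lemma exists_mem_torus_diff_dist_lt {E : Set (EuclideanSpace ℂ ι)}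
    (hE : μH[Fintype.card ι] E = 0) {ζ₀ : EuclideanSpace ℂ ι} (hζ₀ : ζ₀ ∈ torus ι) {δ : ℝ}
    (hδ : 0 < δ) : ∃ ζ ∈ torus ι \ E, dist ζ ζ₀ < δ := by
  by_contra! hcon
  set F : EuclideanSpace ℂ ι → ι → ℝ := fun ζ k => (ζ k * (starRingEnd ℂ) (ζ₀ k)).im with hF
  have hlip : LipschitzWith 1 F := by
    refine LipschitzWith.of_dist_le_mul fun x y => ?_
    rw [NNReal.coe_one, one_mul, dist_pi_le_iff dist_nonneg]
    intro k
    rw [Real.dist_eq, ← Complex.sub_im, ← sub_mul]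
    refine (Complex.abs_im_le_norm _).trans ?_
    rw [norm_mul, RCLike.norm_conj, hζ₀ k, mul_one, dist_eq_norm]
    exact PiLp.norm_apply_le (x - y) k
  set G : (ι → ℝ) → EuclideanSpace ℂ ι := fun x =>
    WithLp.toLp 2 fun k => ((√(1 - x k ^ 2) : ℂ) + x k * Complex.I) * ζ₀ k with hG
  have hG0 : G 0 = ζ₀ := by
    ext k
    simp [hG]
  have hGc : Continuous G := by
    refine (PiLp.continuous_toLp 2 _).comp (continuous_pi fun k => ?_)
    fun_prop
  have hmem : ∀ᶠ x in 𝓝 (0 : ι → ℝ), dist (G x) ζ₀ < δ ∧ ∀ k, |x k| < 1 := by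
    refine Filter.Eventually.and ?_ ?_
    · have := hGc.tendsto 0
      rw [hG0] at this
      exact this (Metric.ball_mem_nhds ζ₀ hδ)
    · refine eventually_all.2 fun k => ?_
      have : Tendsto (fun x : ι → ℝ => |x k|) (𝓝 0) (𝓝 |(0 : ι → ℝ) k|) :=
        Continuous.tendsto (by fun_prop) 0
      exact this (gt_mem_nhds (by simp))
  have hsub : {x : ι → ℝ | dist (G x) ζ₀ < δ ∧ ∀ k, |x k| < 1} ⊆ F '' E := by
    rintro x ⟨hx, hx1⟩
    have hGt : ∀ k, ‖G x k‖ = 1 := fun k => by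
      have h1 : 0 ≤ 1 - x k ^ 2 := by
        have := (sq_lt_one_iff_abs_lt_one (x k)).2 (hx1 k)
        linarith
      have h2 : ‖(√(1 - x k ^ 2) : ℂ) + x k * Complex.I‖ = 1 := by
        rw [Complex.norm_add_mul_I, Real.sq_sqrt h1]
        simp
      simp [hG, h2, hζ₀ k]
    refine ⟨G x, ?_, ?_⟩
    · by_contra hE'
      exact (hcon (G x) ⟨hGt, hE'⟩).not_gt hx
    · ext k
      have h1 : ζ₀ k * (starRingEnd ℂ) (ζ₀ k) = 1 := by
        rw [Complex.mul_conj', hζ₀ k]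
        simp
      simp only [hF, hG]
      rw [mul_assoc, h1, mul_one]
      simp
  have hpos := Measure.measure_pos_of_mem_nhds (volume : Measure (ι → ℝ)) hmem
  refine hpos.ne' (measure_mono_null hsub ?_)
  rw [← hausdorffMeasure_pi_real]
  have := hlip.hausdorffMeasure_image_le (d := Fintype.card ι) (by positivity) E
  rw [hE, mul_zero] at this
  exact le_antisymm this bot_le

end TorusMeasure

section PEval

variable {ι : Type*}

lemma continuous_pEval (P : MvPolynomial ι ℂ) : Continuous (pEval P) :=
  P.continuous_eval_complex.comp (PiLp.continuous_ofLp 2 _)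

lemma isClosed_torus : IsClosed (torus ι) := by
  simp only [torus, Set.ofPred_forall]
  exact isClosed_iInter fun j => isClosed_eq (by fun_prop) continuous_const

lemma isCompact_torus [Fintype ι] : IsCompact (torus ι) := by
  have : torus ι = WithLp.toLp 2 '' univ.pi fun _ => Metric.sphere (0 : ℂ) 1 := by
    ext ζ
    constructor
    · exact fun h => ⟨ζ.ofLp, fun j _ => by simpa using h j, rfl⟩
    · rintro ⟨z, hz, rfl⟩ j
      simpa using hz j (mem_univ j)
  rw [this]
  exact (isCompact_univ_pi fun _ => isCompact_sphere 0 1).image (PiLp.continuous_toLp 2 _)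

lemma tendsto_pEval_radial [Fintype ι] (P : MvPolynomial ι ℂ) (ζ : EuclideanSpace ℂ ι) :
    Tendsto (fun ρ : ℝ => pEval P ((ρ : ℂ) • ζ)) (𝓝[<] 1) (𝓝 (pEval P ζ)) := by
  have h : Tendsto (fun ρ : ℝ => pEval P ((ρ : ℂ) • ζ)) (𝓝 1)
      (𝓝 (pEval P (((1 : ℝ) : ℂ) • ζ))) :=
    Continuous.tendsto ((continuous_pEval P).comp
      (Complex.continuous_ofReal.smul continuous_const)) 1
  rw [Complex.ofReal_one, one_smul] at h
  exact h.mono_left nhdsWithin_le_nhds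

lemma norm_smul_apply_of_mem_torus {ζ : EuclideanSpace ℂ ι} (hζ : ζ ∈ torus ι) {ρ : ℝ}
    (hρ : 0 ≤ ρ) (k : ι) : ‖((ρ : ℂ) • ζ) k‖ = ρ := by
  simp [hζ k, abs_of_nonneg hρ]

lemma eventually_smul_mem_polydisc {n : ℕ} {ζ : EuclideanSpace ℂ (Fin n)}
    (hζ : ζ ∈ torus (Fin n)) : ∀ᶠ ρ : ℝ in 𝓝[<] 1, (ρ : ℂ) • ζ ∈ polydisc n := by
  filter_upwards [Ioo_mem_nhdsLT (zero_lt_one' ℝ)] with ρ hρ k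
  rw [norm_smul_apply_of_mem_torus hζ hρ.1.le]
  exact hρ.2

end PEval

namespace IsRationalInner

variable {n : ℕ} {p q : MvPolynomial (Fin n) ℂ} {φ : EuclideanSpace ℂ (Fin n) → ℂ} {α : ℂ}

lemma pEval_eq_mul (h : IsRationalInner n p q φ) {z : EuclideanSpace ℂ (Fin n)}
    (hz : z ∈ polydisc n) : pEval p z = φ z * pEval q z := by
  rw [h.phi_eq z hz, div_mul_cancel₀ _ (h.q_ne_zero z hz)]

lemma norm_pEval_eq (h : IsRationalInner n p q φ) {ζ : EuclideanSpace ℂ (Fin n)}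
    (hζ : ζ ∈ torus (Fin n)) : ‖pEval p ζ‖ = ‖pEval q ζ‖ := by
  obtain ⟨E, -, hE0, hE⟩ := h.inner
  have hcl : IsClosed {ζ | ‖pEval p ζ‖ = ‖pEval q ζ‖} :=
    isClosed_eq (continuous_pEval p).norm (continuous_pEval q).norm
  have hsub : torus (Fin n) \ E ⊆ {ζ | ‖pEval p ζ‖ = ‖pEval q ζ‖} := by
    intro ξ hξ
    obtain ⟨β, hβ, hlim⟩ := hE ξ hξ
    have h1 : Tendsto (fun ρ : ℝ => pEval p ((ρ : ℂ) • ξ)) (𝓝[<] 1) (𝓝 (β * pEval q ξ)) := by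
      refine (hlim.mul (tendsto_pEval_radial q ξ)).congr' ?_
      filter_upwards [eventually_smul_mem_polydisc hξ.1] with ρ hρ
      rw [h.pEval_eq_mul hρ]
    have h2 := tendsto_nhds_unique (tendsto_pEval_radial p ξ) h1
    change ‖_‖ = ‖_‖
    rw [h2, norm_mul, hβ, one_mul]
  have hmem : ζ ∈ closure (torus (Fin n) \ E) := by
    rw [Metric.mem_closure_iff]
    intro δ hδ
    obtain ⟨ξ, h1, h2⟩ := exists_mem_torus_diff_dist_lt (by rwa [Fintype.card_fin]) hζ hδ
    exact ⟨ξ, h1, by rwa [dist_comm]⟩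
  exact closure_minimal hsub hcl hmem

lemma sub_C_mul_ne_zero (h : IsRationalInner n p q φ) (hα : ‖α‖ = 1)
    {z : EuclideanSpace ℂ (Fin n)} (hz : z ∈ polydisc n) :
    pEval (p - MvPolynomial.C α * q) z ≠ 0 := by
  intro h0
  have h1 : pEval p z = α * pEval q z := by
    simpa [pEval, sub_eq_zero] using h0
  rw [h.pEval_eq_mul hz] at h1
  have := mul_right_cancel₀ (h.q_ne_zero z hz) h1
  have := h.abs_lt_one z hz
  simp_all

lemma mem_radialFiber (h : IsRationalInner n p q φ) {ζ : EuclideanSpace ℂ (Fin n)}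
    (hζ : ζ ∈ torus (Fin n)) (h0 : pEval (p - MvPolynomial.C α * q) ζ = 0)
    (hq : pEval q ζ ≠ 0) : ζ ∈ radialFiber φ α := by
  refine ⟨hζ, ?_⟩
  have h1 : pEval p ζ = α * pEval q ζ := by
    simpa [pEval, sub_eq_zero] using h0
  have h2 := (tendsto_pEval_radial p ζ).div (tendsto_pEval_radial q ζ) hq
  rw [h1, mul_div_cancel_right₀ _ hq] at h2
  refine h2.congr' ?_
  filter_upwards [eventually_smul_mem_polydisc hζ] with ρ hρ
  rw [h.phi_eq _ hρ]
  rfl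

lemma mem_closure_radialFiber (h : IsRationalInner n p q φ) (hα : ‖α‖ = 1)
    {ζ : EuclideanSpace ℂ (Fin n)} (hζ : ζ ∈ torus (Fin n))
    (h0 : pEval (p - MvPolynomial.C α * q) ζ = 0) : ζ ∈ closure (radialFiber φ α) := by
  set A : Set (Fin n → ℂ) := {x | (∀ i, ‖x i‖ = 1) ∧
    MvPolynomial.eval x (p - MvPolynomial.C α * q) = 0 ∧ MvPolynomial.eval x q ≠ 0}
  have h1 : ζ.ofLp ∈ closure A := by
    rw [Metric.mem_closure_iff]
    intro δ hδ
    obtain ⟨x, hx, hd, hx0, hxq⟩ := MvPolynomial.exists_regular_zero hα h.coprime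
      (fun z hz => h.sub_C_mul_ne_zero hα (z := WithLp.toLp 2 z) hz)
      (fun z hz => h.norm_pEval_eq (ζ := WithLp.toLp 2 z) hz) hζ h0 hδ
    exact ⟨x, ⟨hx, hx0, hxq⟩, by rwa [dist_comm]⟩
  refine closure_mono ?_
    (image_closure_subset_closure_image (PiLp.continuous_toLp 2 _) ⟨_, h1, rfl⟩)
  rintro _ ⟨x, ⟨hx, hx0, hxq⟩, rfl⟩
  exact h.mem_radialFiber (ζ := WithLp.toLp 2 x) hx hx0 hxq

end IsRationalInner

lemma Complex.one_sub_sq_le_of_mapsTo_ball {f : ℂ → ℂ}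
    (hd : DifferentiableOn ℂ f (Metric.ball 0 1))
    (hmaps : ∀ z, ‖z‖ < 1 → ‖f z‖ < 1) {z : ℂ} (hz : ‖z‖ < 1) :
    (1 - ‖z‖ ^ 2) * (1 - ‖f 0‖) ^ 2 ≤ (1 - ‖f 0‖ ^ 2) * (1 - ‖f z‖ ^ 2) := by
  set a := f 0 with ha
  have ha1 : ‖a‖ < 1 := hmaps 0 (by simp)
  have hden : ∀ w, ‖w‖ < 1 → 1 - ‖a‖ ≤ ‖1 - (starRingEnd ℂ) a * f w‖ := fun w hw => by
    have h1 : ‖(starRingEnd ℂ) a * f w‖ ≤ ‖a‖ := by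
      rw [norm_mul, RCLike.norm_conj]
      exact mul_le_of_le_one_right (norm_nonneg _) (hmaps w hw).le
    have h2 := norm_sub_norm_le (1 : ℂ) ((starRingEnd ℂ) a * f w)
    rw [norm_one] at h2
    linarith
  have hden0 : ∀ w, ‖w‖ < 1 → 1 - (starRingEnd ℂ) a * f w ≠ 0 := fun w hw h => by
    have := hden w hw
    rw [h, norm_zero] at this
    linarith
  have hid : ∀ w, ‖1 - (starRingEnd ℂ) a * f w‖ ^ 2 - ‖f w - a‖ ^ 2 =
      (1 - ‖a‖ ^ 2) * (1 - ‖f w‖ ^ 2) := fun w => by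
    simp only [← Complex.normSq_eq_norm_sq, Complex.normSq_apply, Complex.sub_re, Complex.sub_im,
      Complex.mul_re, Complex.mul_im, Complex.conj_re, Complex.conj_im, Complex.one_re,
      Complex.one_im]
    ring
  set g : ℂ → ℂ := fun w => (f w - a) / (1 - (starRingEnd ℂ) a * f w) with hg
  have hgd : DifferentiableOn ℂ g (Metric.ball 0 1) := by
    refine (hd.sub_const a).div ((hd.const_mul _).const_sub 1) fun w hw => ?_
    exact hden0 w (by simpa using hw)
  have hgm : MapsTo g (Metric.ball 0 1) (Metric.closedBall 0 1) := fun w hw => by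
    have hw1 : ‖w‖ < 1 := by simpa using hw
    rw [mem_closedBall_zero_iff, hg, norm_div, div_le_one (norm_pos_iff.2 (hden0 w hw1))]
    refine le_of_sq_le_sq ?_ (norm_nonneg _)
    have h1 := hid w
    have h2 : ‖a‖ ^ 2 ≤ 1 := by nlinarith [norm_nonneg a]
    have h3 : ‖f w‖ ^ 2 ≤ 1 := by nlinarith [norm_nonneg (f w), hmaps w hw1]
    nlinarith [mul_nonneg (sub_nonneg.2 h2) (sub_nonneg.2 h3)]
  have hS := Complex.norm_le_norm_of_mapsTo_ball hgd hgm (by simp [hg, ha]) hz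
  rw [hg, norm_div, div_le_iff₀ (norm_pos_iff.2 (hden0 z hz))] at hS
  have h1 := hid z
  have h2 := hden z hz
  have h3 : ‖f z - a‖ ^ 2 ≤ ‖z‖ ^ 2 * ‖1 - (starRingEnd ℂ) a * f z‖ ^ 2 := by
    rw [← mul_pow]
    gcongr
  have h4 : (1 - ‖a‖) ^ 2 ≤ ‖1 - (starRingEnd ℂ) a * f z‖ ^ 2 :=
    pow_le_pow_left₀ (by linarith) h2 2
  have h5 : 0 ≤ 1 - ‖z‖ ^ 2 := by nlinarith [norm_nonneg z]
  nlinarith [mul_le_mul_of_nonneg_left h4 h5]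

lemma one_div_le_poisson {a b : ℂ} (ha : ‖a‖ = 1) (hb : ‖b‖ = 1) {ε : ℝ} (hε : 0 < ε)
    (hε1 : ε < 1) (h : ‖a - b‖ ≤ ε) :
    1 / (4 * ε) ≤ (1 - ‖((1 - ε : ℝ) : ℂ) * b‖ ^ 2) / ‖a - ((1 - ε : ℝ) : ℂ) * b‖ ^ 2 := by
  have h1 : ‖((1 - ε : ℝ) : ℂ) * b‖ = 1 - ε := by
    rw [norm_mul, hb, mul_one, Complex.norm_real, Real.norm_of_nonneg (by linarith)]
  have h2 : ‖a - ((1 - ε : ℝ) : ℂ) * b‖ ≤ 2 * ε := by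
    calc ‖a - ((1 - ε : ℝ) : ℂ) * b‖ = ‖(a - b) + (ε : ℂ) * b‖ := by
          congr 1; push_cast; ring
      _ ≤ ‖a - b‖ + ‖(ε : ℂ) * b‖ := norm_add_le _ _
      _ ≤ ε + ε := by
        gcongr
        rw [norm_mul, hb, mul_one, Complex.norm_real, Real.norm_of_nonneg hε.le]
      _ = 2 * ε := by ring
  have h3 : 0 < ‖a - ((1 - ε : ℝ) : ℂ) * b‖ := by
    have := norm_sub_norm_le a (((1 - ε : ℝ) : ℂ) * b)
    rw [ha, h1] at this
    linarith
  rw [h1, div_le_div_iff₀ (by positivity) (by positivity)]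
  nlinarith [mul_self_le_mul_self h3.le h2]

lemma ENNReal.le_ofReal_div_of_mul_le {a b : ℝ} (ha : 0 < a) {m : ℝ≥0∞}
    (h : ENNReal.ofReal a * m ≤ ENNReal.ofReal b) : m ≤ ENNReal.ofReal (b / a) := by
  rw [ENNReal.ofReal_div_of_pos ha, ENNReal.le_div_iff_mul_le (Or.inl (by simpa using ha))
    (Or.inl ENNReal.ofReal_ne_top), mul_comm]
  exact h

lemma continuous_deleteCoord {n : ℕ} (j : Fin n) : Continuous (deleteCoord j) :=
  (PiLp.continuous_toLp 2 _).comp (continuous_pi fun i => by fun_prop)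

lemma deleteCoord_mem_torus {n : ℕ} (j : Fin n) {ζ : EuclideanSpace ℂ (Fin n)}
    (hζ : ζ ∈ torus (Fin n)) : deleteCoord j ζ ∈ torus {i : Fin n // i ≠ j} := fun i => hζ i.1

/-- The point of `ℂⁿ` with `j`-th coordinate `0` and the other coordinates given by `w`. -/
def insertZero {n : ℕ} (j : Fin n) (w : EuclideanSpace ℂ {i : Fin n // i ≠ j}) :
    EuclideanSpace ℂ (Fin n) :=
  WithLp.toLp 2 fun i => if h : i = j then 0 else w ⟨i, h⟩

lemma insertZero_self {n : ℕ} (j : Fin n) (w : EuclideanSpace ℂ {i : Fin n // i ≠ j}) :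
    insertZero j w j = 0 := by
  simp [insertZero]

lemma insertZero_apply {n : ℕ} (j : Fin n) (w : EuclideanSpace ℂ {i : Fin n // i ≠ j})
    (i : {i : Fin n // i ≠ j}) : insertZero j w i = w i := by
  simp [insertZero, i.2]

lemma smul_insertZero_mem_polydisc {n : ℕ} (j : Fin n) {w : EuclideanSpace ℂ {i : Fin n // i ≠ j}}
    (hw : w ∈ torus {i : Fin n // i ≠ j}) {c : ℂ} (hc : ‖c‖ < 1) :
    c • insertZero j w ∈ polydisc n := by
  intro i
  rw [PiLp.smul_apply, norm_smul]
  by_cases h : i = j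
  · subst h
    simp [insertZero_self]
  · rw [insertZero_apply j w ⟨i, h⟩, hw ⟨i, h⟩, mul_one]
    exact hc

namespace IsClarkMeasure

variable {n : ℕ} {φ : EuclideanSpace ℂ (Fin n) → ℂ} {α : ℂ}
  {μ : Measure (EuclideanSpace ℂ (Fin n))}

lemma measure_compl_torus (hμ : IsClarkMeasure n φ α μ) : μ (torus (Fin n))ᶜ = 0 := hμ.2.1

lemma ae_mem_torus (hμ : IsClarkMeasure n φ α μ) : ∀ᵐ ζ ∂μ, ζ ∈ torus (Fin n) :=
  hμ.measure_compl_torus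

lemma measure_le (hμ : IsClarkMeasure n φ α μ) {z : EuclideanSpace ℂ (Fin n)}
    (hz : z ∈ polydisc n) {A : Set (EuclideanSpace ℂ (Fin n))} (hA : MeasurableSet A) {c : ℝ}
    (hc : 0 < c)
    (h : ∀ ζ ∈ torus (Fin n), ζ ∈ A → c ≤ ∏ j, (1 - ‖z j‖ ^ 2) / ‖ζ j - z j‖ ^ 2) :
    μ A ≤ ENNReal.ofReal ((1 - ‖φ z‖ ^ 2) / ‖α - φ z‖ ^ 2 / c) := by
  refine ENNReal.le_ofReal_div_of_mul_le hc ?_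
  rw [← hμ.2.2 z hz, ← setLIntegral_const]
  refine le_trans ?_ (setLIntegral_le_lintegral A _)
  refine lintegral_mono_ae ?_
  filter_upwards [ae_restrict_mem hA, ae_restrict_of_ae hμ.ae_mem_torus] with ζ h1 h2
  exact ENNReal.ofReal_le_ofReal (h ζ h2 h1)

lemma measure_closedBall_le (hμ : IsClarkMeasure n φ α μ) {ζ₀ : EuclideanSpace ℂ (Fin n)}
    (hζ₀ : ζ₀ ∈ torus (Fin n)) {ε : ℝ} (hε : 0 < ε) (hε1 : ε < 1) :
    μ (Metric.closedBall ζ₀ ε) ≤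
      ENNReal.ofReal ((1 - ‖φ (((1 - ε : ℝ) : ℂ) • ζ₀)‖ ^ 2) /
        ‖α - φ (((1 - ε : ℝ) : ℂ) • ζ₀)‖ ^ 2 * (4 * ε) ^ n) := by
  have hz : ((1 - ε : ℝ) : ℂ) • ζ₀ ∈ polydisc n := fun k => by
    rw [norm_smul_apply_of_mem_torus hζ₀ (by linarith)]
    linarith
  refine (hμ.measure_le hz Metric.isClosed_closedBall.measurableSet
    (c := (1 / (4 * ε)) ^ n) (by positivity) fun ζ hζ hball => ?_).trans_eq ?_
  · have : (1 / (4 * ε)) ^ n = ∏ _j : Fin n, 1 / (4 * ε) := by simp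
    rw [this]
    refine Finset.prod_le_prod (fun _ _ => by positivity) fun k _ => ?_
    refine one_div_le_poisson (hζ k) (hζ₀ k) hε hε1 ?_
    rw [Metric.mem_closedBall, dist_eq_norm] at hball
    exact (PiLp.norm_apply_le (ζ - ζ₀) k).trans hball
  · rw [one_div, inv_pow, div_inv_eq_mul]

lemma map_deleteCoord_closedBall_le (hμ : IsClarkMeasure n φ α μ) (j : Fin n)
    {w : EuclideanSpace ℂ {i : Fin n // i ≠ j}} (hw : w ∈ torus {i : Fin n // i ≠ j})
    {ε : ℝ} (hε : 0 < ε) (hε1 : ε < 1) :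
    μ.map (deleteCoord j) (Metric.closedBall w ε) ≤
      ENNReal.ofReal ((1 - ‖φ (((1 - ε : ℝ) : ℂ) • insertZero j w)‖ ^ 2) /
        ‖α - φ (((1 - ε : ℝ) : ℂ) • insertZero j w)‖ ^ 2 * (4 * ε) ^ (n - 1)) := by
  rw [Measure.map_apply (continuous_deleteCoord j).measurable
    Metric.isClosed_closedBall.measurableSet]
  have hz : ((1 - ε : ℝ) : ℂ) • insertZero j w ∈ polydisc n :=
    smul_insertZero_mem_polydisc j hw (by
      rw [Complex.norm_real, Real.norm_of_nonneg (by linarith)]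
      linarith)
  refine (hμ.measure_le hz (Metric.isClosed_closedBall.preimage
    (continuous_deleteCoord j)).measurableSet
    (c := (1 / (4 * ε)) ^ (n - 1)) (by positivity) fun ζ hζ hball => ?_).trans_eq ?_
  · have : (1 / (4 * ε)) ^ (n - 1) = 1 * ∏ _i : {i : Fin n // i ≠ j}, 1 / (4 * ε) := by simp
    rw [this, Fintype.prod_eq_mul_prod_subtype_ne _ j]
    refine mul_le_mul ?_ ?_ (Finset.prod_nonneg fun _ _ => by positivity) ?_
    · simp [insertZero_self, hζ j]
    · refine Finset.prod_le_prod (fun _ _ => by positivity) fun k _ => ?_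
      rw [PiLp.smul_apply, insertZero_apply, smul_eq_mul]
      refine one_div_le_poisson (hζ k) (hw k) hε hε1 ?_
      rw [mem_preimage, Metric.mem_closedBall, dist_eq_norm] at hball
      exact (PiLp.norm_apply_le (deleteCoord j ζ - w) k).trans hball
    · simp [insertZero_self, hζ j]
  · rw [one_div, inv_pow, div_inv_eq_mul]

end IsClarkMeasure

namespace IsRationalInner

variable {n : ℕ} {p q : MvPolynomial (Fin n) ℂ} {φ : EuclideanSpace ℂ (Fin n) → ℂ} {α : ℂ}

/-- Along the slices through the origin of the polydisc, the Poisson integral of a Clark measure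
grows at most like the inverse distance to the boundary. -/
lemma exists_poisson_le (h : IsRationalInner n p q φ) (hα : ‖α‖ = 1) :
    ∃ c : ℝ, 0 < c ∧ ∀ y : EuclideanSpace ℂ (Fin n),
      (∀ w : ℂ, ‖w‖ < 1 → w • y ∈ polydisc n) → ∀ ε, 0 < ε → ε < 1 →
        (1 - ‖φ (((1 - ε : ℝ) : ℂ) • y)‖ ^ 2) / ‖α - φ (((1 - ε : ℝ) : ℂ) • y)‖ ^ 2 ≤ c / ε := by
  have ha : ‖φ 0‖ < 1 := h.abs_lt_one 0 fun j => by simp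
  have ha0 : 0 < 1 - ‖φ 0‖ := by linarith
  refine ⟨8 / (1 - ‖φ 0‖), by positivity, fun y hy ε hε hε1 => ?_⟩
  set f : ℂ → ℂ := fun w => φ (w • y) with hf
  have hd : DifferentiableOn ℂ f (Metric.ball 0 1) := by
    have h1 : DifferentiableOn ℂ (fun w => (p.line 0 y.ofLp).eval w / (q.line 0 y.ofLp).eval w)
        (Metric.ball 0 1) := by
      refine (Polynomial.differentiable _).differentiableOn.div
        (Polynomial.differentiable _).differentiableOn fun w hw => ?_
      rw [MvPolynomial.eval_line, zero_add]
      exact h.q_ne_zero (w • y) (hy w (by simpa using hw))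
    refine h1.congr fun w hw => ?_
    rw [MvPolynomial.eval_line, MvPolynomial.eval_line, zero_add]
    exact h.phi_eq _ (hy w (by simpa using hw))
  have hr : ‖((1 - ε : ℝ) : ℂ)‖ = 1 - ε := by
    rw [Complex.norm_real, Real.norm_of_nonneg (by linarith)]
  have hS := Complex.one_sub_sq_le_of_mapsTo_ball hd
    (fun w hw => h.abs_lt_one _ (hy w hw)) (z := ((1 - ε : ℝ) : ℂ)) (by rw [hr]; linarith)
  have hf0 : f 0 = φ 0 := by simp [hf]
  rw [hr, hf0] at hS
  have hlt : ‖f ((1 - ε : ℝ) : ℂ)‖ < 1 := h.abs_lt_one _ (hy _ (by rw [hr]; linarith))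
  change (1 - ‖f ((1 - ε : ℝ) : ℂ)‖ ^ 2) / ‖α - f ((1 - ε : ℝ) : ℂ)‖ ^ 2 ≤ _
  set t := ‖f ((1 - ε : ℝ) : ℂ)‖ with ht
  have ht0 : 0 ≤ t := norm_nonneg _
  have hs0 : 0 ≤ ‖φ 0‖ := norm_nonneg _
  set s := ‖φ 0‖ with hs
  have h1 : 1 - t ≤ ‖α - f ((1 - ε : ℝ) : ℂ)‖ := by
    have := norm_sub_norm_le α (f ((1 - ε : ℝ) : ℂ))
    rwa [hα] at this
  have h2 : ε * (1 - s) ≤ 4 * (1 - t) := by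
    have h3 : (1 - (1 - ε) ^ 2) * (1 - s) ≤ (1 + s) * (1 - t ^ 2) := by
      refine le_of_mul_le_mul_right ?_ ha0
      nlinarith
    have h4 : ε ≤ 1 - (1 - ε) ^ 2 := by nlinarith
    have h5 : ε * (1 - s) ≤ (1 - (1 - ε) ^ 2) * (1 - s) := by gcongr
    have h6 : (1 + s) * (1 - t ^ 2) ≤ 4 * (1 - t) := by
      have : (1 + s) * (1 + t) ≤ 4 := by nlinarith
      nlinarith
    linarith
  have ht1 : 0 < 1 - t := by linarith
  calc (1 - t ^ 2) / ‖α - f ((1 - ε : ℝ) : ℂ)‖ ^ 2 ≤ (1 - t ^ 2) / (1 - t) ^ 2 := by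
        gcongr
        nlinarith
    _ = (1 + t) / (1 - t) := by
        rw [div_eq_div_iff (by positivity) (by positivity)]
        ring
    _ ≤ 8 / (1 - s) / ε := by
        rw [div_div, div_le_div_iff₀ ht1 (by positivity)]
        nlinarith

end IsRationalInner

lemma exists_pEval_eq_add_mul_I {ι : Type*} (Q : MvPolynomial ι ℂ) :
    ∃ A B : MvPolynomial (ι × Bool) ℝ, ∀ w : EuclideanSpace ℂ ι, pEval Q w =
      MvPolynomial.eval (fun ib => if ib.2 then (w ib.1).re else (w ib.1).im) A +
      MvPolynomial.eval (fun ib => if ib.2 then (w ib.1).re else (w ib.1).im) B * Complex.I := by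
  induction Q using MvPolynomial.induction_on with
  | C a => exact ⟨MvPolynomial.C a.re, MvPolynomial.C a.im, fun w => by simp [pEval]⟩
  | add p q hp hq =>
    obtain ⟨A, B, h⟩ := hp
    obtain ⟨A', B', h'⟩ := hq
    refine ⟨A + A', B + B', fun w => ?_⟩
    have : pEval (p + q) w = pEval p w + pEval q w := map_add _ _ _
    rw [this, h, h']
    push_cast [map_add]
    ring
  | mul_X p k hp =>
    obtain ⟨A, B, h⟩ := hp
    refine ⟨A * MvPolynomial.X (k, true) - B * MvPolynomial.X (k, false),
      A * MvPolynomial.X (k, false) + B * MvPolynomial.X (k, true), fun w => ?_⟩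
    have : pEval (p * MvPolynomial.X k) w = pEval p w * w k := by simp [pEval]
    rw [this, h]
    simp only [map_sub, map_add, map_mul, MvPolynomial.eval_X]
    push_cast
    conv_lhs => rw [← Complex.re_add_im (w k)]
    ring_nf
    rw [Complex.I_sq]
    ring

lemma exists_realZeroSet_eq {ι : Type*} (Q : MvPolynomial ι ℂ) :
    ∃ s : Finset (MvPolynomial (ι × Bool) ℝ), realZeroSet s = {w | pEval Q w = 0} := by
  classical
  obtain ⟨A, B, h⟩ := exists_pEval_eq_add_mul_I Q
  refine ⟨{A, B}, ?_⟩
  ext w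
  simp [realZeroSet, h, Complex.ext_iff]

/-- The polynomial obtained by setting the `j`-th variable to zero. -/
def dropVar {n : ℕ} (j : Fin n) (P : MvPolynomial (Fin n) ℂ) :
    MvPolynomial {i : Fin n // i ≠ j} ℂ :=
  MvPolynomial.aeval (fun i => if h : i = j then 0 else MvPolynomial.X ⟨i, h⟩) P

lemma pEval_dropVar {n : ℕ} (j : Fin n) (P : MvPolynomial (Fin n) ℂ)
    (w : EuclideanSpace ℂ {i : Fin n // i ≠ j}) :
    pEval (dropVar j P) w = pEval P (insertZero j w) := by
  unfold pEval dropVar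
  induction P using MvPolynomial.induction_on with
  | C a => simp
  | add p q hp hq => simp only [map_add, hp, hq]
  | mul_X p k hp =>
    rw [map_mul, map_mul, hp, map_mul, MvPolynomial.aeval_X, MvPolynomial.eval_X]
    by_cases h : k = j <;> simp [insertZero, h]

lemma insertZero_deleteCoord {n : ℕ} (j : Fin n) (ζ : EuclideanSpace ℂ (Fin n)) :
    (insertZero j (deleteCoord j ζ)).ofLp = Function.update ζ.ofLp j 0 := by
  ext i
  by_cases h : i = j
  · subst h
    simp [insertZero]
  · simp [insertZero, deleteCoord, h]

namespace IsRationalInner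

variable {n : ℕ} {p q : MvPolynomial (Fin n) ℂ} {φ : EuclideanSpace ℂ (Fin n) → ℂ} {α : ℂ}
  {μ : Measure (EuclideanSpace ℂ (Fin n))}

lemma dropVar_ne_zero (h : IsRationalInner n p q φ) (hα : ‖α‖ = 1) (j : Fin n) :
    dropVar j (p - MvPolynomial.C α * q) ≠ 0 := by
  intro h0
  have h1 := pEval_dropVar j (p - MvPolynomial.C α * q) 0
  rw [h0] at h1
  refine h.sub_C_mul_ne_zero hα (z := insertZero j 0) (fun i => ?_) ?_
  · simp [insertZero]
  · rw [← h1]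
    simp [pEval]

lemma pEval_eq_zero_of_dropVar (h : IsRationalInner n p q φ) (hα : ‖α‖ = 1) {j : Fin n}
    {ζ : EuclideanSpace ℂ (Fin n)} (hζ : ζ ∈ torus (Fin n))
    (h0 : pEval (dropVar j (p - MvPolynomial.C α * q)) (deleteCoord j ζ) = 0) :
    pEval (p - MvPolynomial.C α * q) ζ = 0 := by
  rw [pEval_dropVar] at h0
  unfold pEval at h0
  rw [show (fun i => (insertZero j (deleteCoord j ζ)) i) = Function.update ζ.ofLp j 0 from
    insertZero_deleteCoord j ζ] at h0
  have := MvPolynomial.eval_update_eq_zero_of_norm_lt_one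
    (fun z hz => h.sub_C_mul_ne_zero hα (z := WithLp.toLp 2 z) hz) (fun i => (hζ i).le)
    (by simp) h0 (ζ j)
  rwa [Function.update_eq_self] at this

lemma measure_cylinder_eq_zero (hn : 2 ≤ n) (h : IsRationalInner n p q φ) (hα : ‖α‖ = 1)
    (hμ : IsClarkMeasure n φ α μ) (j : Fin n)
    (hnocyl : ¬ ∃ s : Finset (MvPolynomial ({i : Fin n // i ≠ j} × Bool) ℝ),
        dimH (torus {i : Fin n // i ≠ j} ∩ realZeroSet s) = (n : ℝ≥0∞) - 2 ∧
        {ζ | ζ ∈ torus (Fin n) ∧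
            deleteCoord j ζ ∈ torus {i : Fin n // i ≠ j} ∩ realZeroSet s}
          ⊆ closure (radialFiber φ α)) :
    μ {ζ | ζ ∈ torus (Fin n) ∧
      pEval (dropVar j (p - MvPolynomial.C α * q)) (deleteCoord j ζ) = 0} = 0 := by
  set Q := dropVar j (p - MvPolynomial.C α * q) with hQ
  set Z : Set (EuclideanSpace ℂ {i : Fin n // i ≠ j}) :=
    torus {i : Fin n // i ≠ j} ∩ {w | pEval Q w = 0} with hZ
  have hZc : IsClosed Z := isClosed_torus.inter (isClosed_eq (continuous_pEval Q) continuous_const)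
  have hcard : Fintype.card {i : Fin n // i ≠ j} = n - 1 := by simp
  have hdim : dimH Z ≤ (n - 2 : ℕ) := by
    have := dimH_torus_inter_zero_le (h.dropVar_ne_zero hα j)
    rwa [hcard, Nat.sub_sub] at this
  obtain ⟨s, hs⟩ := exists_realZeroSet_eq Q
  have hlt : dimH Z ≠ (n - 2 : ℕ) := by
    intro heq
    refine hnocyl ⟨s, ?_, ?_⟩
    · rw [hs, ← hZ, heq]
      push_cast
      rfl
    · rintro ζ ⟨hζ, -, h0⟩
      rw [hs] at h0
      exact h.mem_closure_radialFiber hα hζ (h.pEval_eq_zero_of_dropVar hα hζ h0)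
  have hH : μH[((n - 2 : ℕ) : ℝ)] Z = 0 := by
    by_contra hne
    have := le_dimH_of_hausdorffMeasure_ne_zero (d := ((n - 2 : ℕ) : NNReal))
      (by rwa [NNReal.coe_natCast])
    exact hlt (le_antisymm hdim (by simpa using this))
  obtain ⟨c, hc, hbd⟩ := h.exists_poisson_le hα
  have hν := measure_le_hausdorffMeasure_of_closedBall_le (ν := μ.map (deleteCoord j)) hZc
    (C := Real.toNNReal (c * 4 ^ (n - 1))) (by positivity) (d := ((n - 2 : ℕ) : ℝ))
    (by positivity) (zero_lt_one' ℝ) fun w hw ε hε hε1 => by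
      refine (hμ.map_deleteCoord_closedBall_le j hw.1 hε hε1).trans ?_
      change _ ≤ ENNReal.ofReal _ * _
      rw [← ENNReal.ofReal_mul (by positivity), Real.rpow_natCast]
      refine ENNReal.ofReal_le_ofReal ?_
      have h1 := hbd (insertZero j w)
        (fun v hv => smul_insertZero_mem_polydisc j hw.1 hv) ε hε hε1
      calc _ ≤ c / ε * (4 * ε) ^ (n - 1) := by gcongr
        _ = c * 4 ^ (n - 1) * ε ^ (n - 2) := by
          rw [show n - 1 = n - 2 + 1 by omega, mul_pow, pow_succ ε]
          field_simp
  rw [hH, mul_zero, Measure.map_apply (continuous_deleteCoord j).measurable hZc.measurableSet]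
    at hν
  exact measure_mono_null (t := deleteCoord j ⁻¹' Z)
    (fun ζ hζ => ⟨deleteCoord_mem_torus j hζ.1, hζ.2⟩) (le_antisymm hν bot_le)

lemma measure_ne_zero_eq_zero (h : IsRationalInner n p q φ)
    (hμ : IsClarkMeasure n φ α μ) :
    μ {ζ | pEval (p - MvPolynomial.C α * q) ζ ≠ 0} = 0 := by
  set P := p - MvPolynomial.C α * q with hP
  set u : EuclideanSpace ℂ (Fin n) → ℝ :=
    fun z => (‖pEval q z‖ ^ 2 - ‖pEval p z‖ ^ 2) / ‖pEval P z‖ ^ 2 with hu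
  have hu_eq : ∀ z ∈ polydisc n, (1 - ‖φ z‖ ^ 2) / ‖α - φ z‖ ^ 2 = u z := fun z hz => by
    have hq := norm_ne_zero_iff.2 (h.q_ne_zero z hz)
    have h1 : pEval P z = (φ z - α) * pEval q z := by
      rw [sub_mul, ← h.pEval_eq_mul hz]
      simp [hP, pEval]
    simp only [hu]
    rw [h1, h.pEval_eq_mul hz, norm_mul, norm_mul, norm_sub_rev α]
    rw [mul_pow, mul_pow, ← one_sub_mul, mul_div_mul_right _ _ (pow_ne_zero 2 hq)]
  have hK : ∀ m : ℕ, μ {ζ | ζ ∈ torus (Fin n) ∧ 1 / ((m : ℝ) + 1) ≤ ‖pEval P ζ‖} = 0 := by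
    intro m
    set K := {ζ | ζ ∈ torus (Fin n) ∧ 1 / ((m : ℝ) + 1) ≤ ‖pEval P ζ‖} with hKdef
    have hKcl : IsClosed {ζ : EuclideanSpace ℂ (Fin n) | 1 / ((m : ℝ) + 1) ≤ ‖pEval P ζ‖} :=
      isClosed_le continuous_const (continuous_pEval P).norm
    have hKc : IsCompact K := isCompact_torus.inter_right hKcl
    have hbound : ∀ η : ℝ, 0 < η →
        μ K ≤ ENNReal.ofReal η * (ENNReal.ofReal (4 ^ n) * μH[n] (torus (Fin n))) := by
      intro η hη
      have hev : ∀ᶠ ε : ℝ in 𝓝 0, ∀ ζ ∈ K, u (((1 - ε : ℝ) : ℂ) • ζ) < η := by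
        refine hKc.eventually_forall_of_forall_eventually fun ζ hζ => ?_
        have h0 : u (((1 - 0 : ℝ) : ℂ) • ζ) = 0 := by
          simp [hu, h.norm_pEval_eq hζ.1]
        have hne : ‖pEval P (((1 - 0 : ℝ) : ℂ) • ζ)‖ ^ 2 ≠ 0 := by
          simp only [sub_zero, Complex.ofReal_one, one_smul]
          have : 0 < ‖pEval P ζ‖ := lt_of_lt_of_le (by positivity) hζ.2
          positivity
        have hsm : Continuous fun x : ℝ × EuclideanSpace ℂ (Fin n) =>
            ((1 - x.1 : ℝ) : ℂ) • x.2 :=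
          (Complex.continuous_ofReal.comp (continuous_const.sub continuous_fst)).smul
            continuous_snd
        have hcont : ContinuousAt (fun x : ℝ × EuclideanSpace ℂ (Fin n) =>
            u (((1 - x.1 : ℝ) : ℂ) • x.2)) (0, ζ) := by
          refine ContinuousAt.div ?_ ?_ hne
          · exact (((((continuous_pEval q).comp hsm).norm).pow 2).sub
              ((((continuous_pEval p).comp hsm).norm).pow 2)).continuousAt
          · exact ((((continuous_pEval P).comp hsm).norm).pow 2).continuousAt
        exact hcont.eventually (gt_mem_nhds (h0.trans_lt hη))
      obtain ⟨ε₀, hε₀, hball⟩ := Metric.eventually_nhds_iff.1 hev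
      have hm := measure_le_hausdorffMeasure_of_closedBall_le (ν := μ) hKc.isClosed
        (C := Real.toNNReal (η * 4 ^ n)) (by positivity) (d := (n : ℝ))
        (by positivity) (lt_min hε₀ (zero_lt_one' ℝ)) fun ζ hζ ε hε hε1 => by
          refine (hμ.measure_closedBall_le hζ.1 hε (lt_of_lt_of_le hε1 (min_le_right _ _))).trans ?_
          change _ ≤ ENNReal.ofReal _ * _
          rw [← ENNReal.ofReal_mul (by positivity), Real.rpow_natCast]
          refine ENNReal.ofReal_le_ofReal ?_
          have hε1' := lt_of_lt_of_le hε1 (min_le_right _ _)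
          rw [hu_eq _ fun k => by
            rw [norm_smul_apply_of_mem_torus hζ.1 (by linarith)]; linarith]
          have h1 := hball (y := ε) (by
            rw [Real.dist_eq, sub_zero, abs_of_pos hε]
            exact lt_of_lt_of_le hε1 (min_le_left _ _)) ζ hζ
          calc _ ≤ η * (4 * ε) ^ n := by gcongr
            _ = η * 4 ^ n * ε ^ n := by rw [mul_pow]; ring
      refine hm.trans ?_
      rw [← mul_assoc, ← ENNReal.ofReal_mul hη.le]
      gcongr
      · exact le_rfl
      · exact fun ζ hζ => hζ.1
    have hfin : ENNReal.ofReal (4 ^ n) * μH[n] (torus (Fin n)) ≠ ∞ := by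
      have := hausdorffMeasure_torus_lt_top (ι := Fin n)
      rw [Fintype.card_fin] at this
      exact ENNReal.mul_ne_top ENNReal.ofReal_ne_top this.ne
    have hlim : Tendsto (fun η : ℝ => ENNReal.ofReal η *
        (ENNReal.ofReal (4 ^ n) * μH[n] (torus (Fin n)))) (𝓝[>] 0) (𝓝 0) := by
      have h1 : Tendsto (fun η : ℝ => ENNReal.ofReal η) (𝓝[>] 0) (𝓝 (ENNReal.ofReal 0)) :=
        (ENNReal.continuous_ofReal.tendsto 0).mono_left nhdsWithin_le_nhds
      have h2 := ENNReal.Tendsto.mul_const h1 (Or.inr hfin)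
      rwa [ENNReal.ofReal_zero, zero_mul] at h2
    refine le_antisymm (ge_of_tendsto hlim ?_) bot_le
    filter_upwards [self_mem_nhdsWithin] with η hη using hbound η hη
  refine measure_mono_null (t := (torus (Fin n))ᶜ ∪
    ⋃ m : ℕ, {ζ | ζ ∈ torus (Fin n) ∧ 1 / ((m : ℝ) + 1) ≤ ‖pEval P ζ‖}) ?_
    (measure_union_null hμ.measure_compl_torus (measure_iUnion_null hK))
  intro ζ hζ
  by_cases hζt : ζ ∈ torus (Fin n)
  · obtain ⟨m, hm⟩ := exists_nat_one_div_lt (norm_pos_iff.2 hζ)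
    exact Or.inr (mem_iUnion.2 ⟨m, hζt, hm.le⟩)
  · exact Or.inl hζt

end IsRationalInner

lemma isUnit_aeval_smul {n : ℕ} {S : Type*} [NormedCommRing S] [NormedAlgebra ℂ S]
    [CompleteSpace S] [NormOneClass S] {Q : MvPolynomial (Fin n) ℂ}
    (hQ : ∀ z ∈ polydisc n, pEval Q z ≠ 0) {r : ℝ} (hr0 : 0 ≤ r) (hr1 : r < 1)
    {c : Fin n → S} (hc : ∀ k, ‖c k‖ ≤ 1) :
    IsUnit (MvPolynomial.aeval (fun k => (r : ℂ) • c k) Q) := by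
  by_contra hna
  obtain ⟨χ, hχ⟩ := WeakDual.CharacterSpace.exists_apply_eq_zero hna
  let ψ : S →ₐ[ℂ] ℂ := WeakDual.CharacterSpace.toAlgHom χ
  have h1 : ψ (MvPolynomial.aeval (fun k => (r : ℂ) • c k) Q)
      = MvPolynomial.aeval (fun k => (r : ℂ) * ψ (c k)) Q := by
    rw [← AlgHom.comp_apply, MvPolynomial.comp_aeval]
    simp only [map_smul, smul_eq_mul]
  refine hQ (WithLp.toLp 2 fun k => (r : ℂ) * ψ (c k)) (fun k => ?_) ?_
  · have h2 : ‖ψ (c k)‖ ≤ 1 := (AlgHom.norm_apply_le_self ψ (c k)).trans (hc k)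
    simp only [norm_mul, Complex.norm_real, Real.norm_eq_abs, abs_of_nonneg hr0]
    nlinarith
  · rw [MvPolynomial.aeval_eq_eval] at h1
    exact h1.symm.trans hχ

lemma exists_norm_pEval_sub_inv_le {n : ℕ} {Q : MvPolynomial (Fin n) ℂ}
    (hQ : ∀ z ∈ polydisc n, pEval Q z ≠ 0) {r : ℝ} (hr0 : 0 ≤ r) (hr1 : r < 1) {ε : ℝ}
    (hε : 0 < ε) :
    ∃ R : MvPolynomial (Fin n) ℂ, ∀ ζ ∈ torus (Fin n),
      ‖pEval R ζ - (pEval Q ((r : ℂ) • ζ))⁻¹‖ < ε := by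
  have : CompactSpace (torus (Fin n)) := isCompact_iff_compactSpace.1 isCompact_torus
  have : Nonempty (torus (Fin n)) := ⟨⟨WithLp.toLp 2 fun _ => 1, fun j => by simp⟩⟩
  let c : Fin n → C(torus (Fin n), ℂ) := fun k => ⟨fun ζ => ζ.1 k, by fun_prop⟩
  have hc : ∀ k, ‖c k‖ ≤ 1 := fun k =>
    (ContinuousMap.norm_le _ zero_le_one).2 fun ζ => (ζ.2 k).le
  let S := (Algebra.adjoin ℂ (range c)).topologicalClosure
  let c' : Fin n → S := fun k => ⟨c k, subset_closure (Algebra.subset_adjoin ⟨k, rfl⟩)⟩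
  have : CompleteSpace S := (Subalgebra.isClosed_topologicalClosure _).completeSpace_coe
  let a : S := MvPolynomial.aeval (fun k => (r : ℂ) • c' k) Q
  have : NormOneClass S := ⟨(norm_one : ‖(1 : C(torus (Fin n), ℂ))‖ = 1)⟩
  have ha : IsUnit a := isUnit_aeval_smul hQ hr0 hr1 hc
  obtain ⟨b, hb⟩ := ha.exists_right_inv
  have hbmem : (b : C(torus (Fin n), ℂ)) ∈
      closure ((Algebra.adjoin ℂ (range c) : Subalgebra ℂ _) : Set C(torus (Fin n), ℂ)) := b.2
  obtain ⟨g, hg, hgb⟩ := Metric.mem_closure_iff.1 hbmem ε hε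
  have hg' : g ∈ Algebra.adjoin ℂ (range c) := hg
  rw [Algebra.adjoin_range_eq_range_aeval] at hg'
  obtain ⟨R, rfl⟩ := hg'
  have hev : ∀ (P : MvPolynomial (Fin n) ℂ) (d : Fin n → C(torus (Fin n), ℂ))
      (ζ : torus (Fin n)), MvPolynomial.aeval d P ζ = MvPolynomial.eval (fun k => d k ζ) P := by
    intro P d ζ
    change ContinuousMap.evalAlgHom ℂ ℂ ζ (MvPolynomial.aeval d P) = _
    rw [← AlgHom.comp_apply, MvPolynomial.comp_aeval]
    rfl
  refine ⟨R, fun ζ hζ => ?_⟩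
  have hbζ : pEval Q ((r : ℂ) • ζ) * (b : C(torus (Fin n), ℂ)) ⟨ζ, hζ⟩ = 1 := by
    have h1 := congrArg (fun s : S => (s : C(torus (Fin n), ℂ)) ⟨ζ, hζ⟩) hb
    have h2 : (a : C(torus (Fin n), ℂ)) = MvPolynomial.aeval (fun k => (r : ℂ) • c k) Q := by
      change S.val (MvPolynomial.aeval _ Q) = _
      rw [← AlgHom.comp_apply, MvPolynomial.comp_aeval]
      rfl
    simp only [MulMemClass.coe_mul, ContinuousMap.mul_apply, h2, hev] at h1
    exact h1
  rw [inv_eq_of_mul_eq_one_right hbζ]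
  have h3 := ContinuousMap.norm_coe_le_norm
    ((b : C(torus (Fin n), ℂ)) - MvPolynomial.aeval c R) ⟨ζ, hζ⟩
  rw [dist_eq_norm] at hgb
  rw [ContinuousMap.sub_apply, hev] at h3
  rw [norm_sub_rev]
  exact h3.trans_lt hgb

lemma exists_rename_dropVar_eq {n : ℕ} (j : Fin n) (P : MvPolynomial (Fin n) ℂ) :
    ∃ G, MvPolynomial.rename Subtype.val (dropVar j P) = P + MvPolynomial.X j * G := by
  induction P using MvPolynomial.induction_on with
  | C a => exact ⟨0, by simp [dropVar]⟩
  | add P Q hP hQ =>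
    obtain ⟨A, hA⟩ := hP
    obtain ⟨B, hB⟩ := hQ
    refine ⟨A + B, ?_⟩
    rw [dropVar] at hA hB ⊢
    rw [map_add, map_add, hA, hB]
    ring
  | mul_X P i hP =>
    obtain ⟨A, hA⟩ := hP
    rw [dropVar] at hA ⊢
    rw [map_mul, map_mul, hA, MvPolynomial.aeval_X]
    by_cases hij : i = j
    · subst hij
      exact ⟨-P, by simp [mul_comm]⟩
    · exact ⟨A * MvPolynomial.X i, by simp [hij]; ring⟩

lemma pEval_rename_dropVar {n : ℕ} (j : Fin n) (P : MvPolynomial (Fin n) ℂ)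
    (ζ : EuclideanSpace ℂ (Fin n)) :
    pEval (MvPolynomial.rename Subtype.val (dropVar j P)) ζ
      = pEval (dropVar j P) (deleteCoord j ζ) := by
  rw [pEval, MvPolynomial.eval_rename]
  rfl

lemma norm_pEval_le_of_ne_zero_on_polydisc {n : ℕ} {Q : MvPolynomial (Fin n) ℂ}
    (hQ : ∀ z ∈ polydisc n, pEval Q z ≠ 0) {r : ℝ} (hr0 : 0 ≤ r) (hr1 : r < 1)
    {ζ : EuclideanSpace ℂ (Fin n)} (hζ : ζ ∈ torus (Fin n)) :
    ‖pEval Q ζ‖ ≤ 2 ^ Q.totalDegree * ‖pEval Q ((r : ℂ) • ζ)‖ := by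
  have h := Q.norm_eval_line_le 0 ζ.ofLp (a := (r : ℂ)) (z := 1) (δ := 1 - r) (fun w hw => ?_) ?_
  · rw [zero_add, zero_add, one_smul] at h
    exact h
  · have hw1 : ‖w‖ < 1 := by
      have := norm_le_norm_add_norm_sub' w (r : ℂ)
      rw [Complex.norm_real, Real.norm_eq_abs, abs_of_nonneg hr0] at this
      linarith
    have := hQ (w • ζ) fun k => by simpa [hζ k] using hw1
    rw [zero_add]
    exact this
  · rw [← Complex.ofReal_one, ← Complex.ofReal_sub, Complex.norm_real, Real.norm_eq_abs,
      abs_of_nonneg (by linarith)]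

lemma mem_closure_polyLp_of_tendsto {n : ℕ} {μ : Measure (EuclideanSpace ℂ (Fin n))}
    [IsFiniteMeasure μ] {F : ℕ → MvPolynomial (Fin n) ℂ} {f : EuclideanSpace ℂ (Fin n) → ℂ}
    (hf : MemLp f 2 μ) {K : ℝ} (hK : ∀ m, ∀ᵐ ζ ∂μ, ‖pEval (F m) ζ‖ ≤ K)
    (hF : ∀ᵐ ζ ∂μ, Tendsto (fun m => pEval (F m) ζ) atTop (𝓝 (f ζ))) :
    hf.toLp f ∈ closure (polyLp n μ) := by
  have hm : ∀ m, AEStronglyMeasurable (pEval (F m)) μ := fun m =>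
    (continuous_pEval (F m)).aestronglyMeasurable
  have hL : ∀ m, MemLp (pEval (F m)) 2 μ := fun m => MemLp.of_bound (hm m) K (hK m)
  refine mem_closure_of_tendsto (f := fun m => (hL m).toLp (pEval (F m))) (b := atTop) ?_
    (Eventually.of_forall fun m => ⟨F m, (hL m).coeFn_toLp⟩)
  rw [Lp.tendsto_Lp_iff_tendsto_eLpNorm'' _ hL f hf]
  simp only [eLpNorm_eq_lintegral_rpow_enorm_toReal two_ne_zero ENNReal.ofNat_ne_top,
    ENNReal.toReal_ofNat, Pi.sub_apply]
  have hfK : ∀ᵐ ζ ∂μ, ‖f ζ‖ ≤ K := by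
    filter_upwards [hF, ae_all_iff.2 hK] with ζ h1 h2 using
      le_of_tendsto h1.norm (Eventually.of_forall h2)
  have h1 : Tendsto (fun m => ∫⁻ ζ, ‖pEval (F m) ζ - f ζ‖ₑ ^ (2 : ℝ) ∂μ) atTop
      (𝓝 (∫⁻ _, 0 ∂μ)) := by
    refine tendsto_lintegral_of_dominated_convergence' (fun _ => ENNReal.ofReal (K + K) ^ (2 : ℝ))
      (fun m => ((hm m).sub hf.1).enorm.pow_const _) (fun m => ?_) ?_ ?_
    · filter_upwards [hK m, hfK] with ζ h1 h2
      gcongr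
      rw [← ofReal_norm]
      exact ENNReal.ofReal_le_ofReal ((norm_sub_le _ _).trans (add_le_add h1 h2))
    · rw [lintegral_const]
      exact ENNReal.mul_ne_top (ENNReal.rpow_ne_top_of_nonneg (by norm_num)
        ENNReal.ofReal_ne_top) (measure_ne_top _ _)
    · filter_upwards [hF] with ζ h1
      have h2 : Tendsto (fun m => ‖pEval (F m) ζ - f ζ‖ₑ ^ (2 : ℝ)) atTop
          (𝓝 (‖f ζ - f ζ‖ₑ ^ (2 : ℝ))) :=
        ((ENNReal.continuous_rpow_const.comp continuous_enorm).tendsto _).comp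
          (h1.sub_const (f ζ))
      simpa using h2
  rw [lintegral_zero] at h1
  have h2 := (ENNReal.continuous_rpow_const (y := 1 / (2 : ℝ))).tendsto 0 |>.comp h1
  simpa [Function.comp_def] using h2

lemma conj_coord_mem_closure_polyLp {n : ℕ} {μ : Measure (EuclideanSpace ℂ (Fin n))}
    [IsFiniteMeasure μ] (hT : ∀ᵐ ζ ∂μ, ζ ∈ torus (Fin n)) {P : MvPolynomial (Fin n) ℂ}
    (hP : ∀ z ∈ polydisc n, pEval P z ≠ 0) (hP0 : ∀ᵐ ζ ∂μ, pEval P ζ = 0) (j : Fin n)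
    (hQ0 : ∀ᵐ ζ ∂μ, pEval (dropVar j P) (deleteCoord j ζ) ≠ 0) :
    ∃ f : Lp ℂ 2 μ, ⇑f =ᵐ[μ] (fun ζ => (starRingEnd ℂ) (ζ j)) ∧ f ∈ closure (polyLp n μ) := by
  set Q := MvPolynomial.rename Subtype.val (dropVar j P) with hQdef
  have hQ : ∀ z ∈ polydisc n, pEval Q z ≠ 0 := fun z hz => by
    rw [hQdef, pEval_rename_dropVar, pEval_dropVar]
    refine hP _ fun k => ?_
    rw [insertZero_deleteCoord, Function.update_apply]
    split_ifs
    · simp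
    · exact hz k
  obtain ⟨G, hG⟩ := exists_rename_dropVar_eq j P
  rw [← hQdef] at hG
  have hr : ∀ m : ℕ, 0 ≤ 1 - 1 / ((m : ℝ) + 1) ∧ 1 - 1 / ((m : ℝ) + 1) < 1 := fun m => by
    have h1 : 0 < 1 / ((m : ℝ) + 1) := by positivity
    have h2 : 1 / ((m : ℝ) + 1) ≤ 1 := (div_le_one (by positivity)).2 (by simp)
    constructor <;> linarith
  set r : ℕ → ℝ := fun m => 1 - 1 / ((m : ℝ) + 1) with hrdef
  choose R hR using fun m : ℕ => exists_norm_pEval_sub_inv_le hQ (hr m).1 (hr m).2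
    (ε := 1 / ((m : ℝ) + 1)) (by positivity)
  have hrlim : Tendsto r atTop (𝓝[<] 1) := by
    refine tendsto_nhdsWithin_iff.2 ⟨?_, Eventually.of_forall fun m => (hr m).2⟩
    simpa [hrdef] using tendsto_one_div_add_atTop_nhds_zero_nat.const_sub (1 : ℝ)
  obtain ⟨C, hC⟩ := (isCompact_torus (ι := Fin n)).exists_bound_of_continuousOn
    (continuous_pEval Q).continuousOn
  have hGQ : ∀ᵐ ζ ∂μ, pEval G ζ = (starRingEnd ℂ) (ζ j) * pEval Q ζ := by
    filter_upwards [hT, hP0] with ζ hζ h0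
    have h1 : pEval Q ζ = ζ j * pEval G ζ := by
      have : pEval Q ζ = pEval P ζ + ζ j * pEval G ζ := by rw [hG]; simp [pEval]
      rw [this, h0, zero_add]
    have h2 : (starRingEnd ℂ) (ζ j) * ζ j = 1 := by
      rw [mul_comm, Complex.mul_conj, Complex.normSq_eq_norm_sq, hζ j]; simp
    rw [h1, ← mul_assoc, h2, one_mul]
  have hf : MemLp (fun ζ : EuclideanSpace ℂ (Fin n) => (starRingEnd ℂ) (ζ j)) 2 μ := by
    refine MemLp.of_bound (Continuous.aestronglyMeasurable (by fun_prop)) 1 ?_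
    filter_upwards [hT] with ζ hζ
    rw [RCLike.norm_conj, hζ j]
  refine ⟨hf.toLp _, hf.coeFn_toLp, mem_closure_polyLp_of_tendsto hf (F := fun m => G * R m)
    (K := 2 ^ Q.totalDegree + C) (fun m => ?_) ?_⟩
  · filter_upwards [hT, hGQ] with ζ hζ hGζ
    have hne : pEval Q ((r m : ℂ) • ζ) ≠ 0 := hQ _ fun k => by
      rw [norm_smul_apply_of_mem_torus hζ (hr m).1]; exact (hr m).2
    have h1 := norm_pEval_le_of_ne_zero_on_polydisc hQ (hr m).1 (hr m).2 hζ
    have h2 : ‖pEval (R m) ζ‖ ≤ ‖pEval Q ((r m : ℂ) • ζ)‖⁻¹ + 1 := by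
      have h3 := (hR m ζ hζ).le.trans ((div_le_one (by positivity)).2 (by simp))
      rw [← norm_inv]
      exact (norm_le_norm_add_norm_sub' _ _).trans (by gcongr)
    calc ‖pEval (G * R m) ζ‖ = ‖pEval Q ζ‖ * ‖pEval (R m) ζ‖ := by
          rw [pEval, map_mul, norm_mul]
          change ‖pEval G ζ‖ * _ = _
          rw [hGζ, norm_mul, RCLike.norm_conj, hζ j, one_mul]
          rfl
      _ ≤ ‖pEval Q ζ‖ * (‖pEval Q ((r m : ℂ) • ζ)‖⁻¹ + 1) := by gcongr
      _ ≤ 2 ^ Q.totalDegree + C := by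
          rw [mul_add, mul_one, ← div_eq_mul_inv]
          exact add_le_add ((div_le_iff₀ (norm_pos_iff.2 hne)).2 h1) (hC ζ hζ)
  · filter_upwards [hT, hGQ, hQ0] with ζ hζ hGζ hne
    rw [← pEval_rename_dropVar, ← hQdef] at hne
    have h1 : Tendsto (fun m => (pEval Q ((r m : ℂ) • ζ))⁻¹) atTop (𝓝 (pEval Q ζ)⁻¹) :=
      ((tendsto_pEval_radial Q ζ).comp hrlim).inv₀ hne
    have h2 : Tendsto (fun m => pEval (R m) ζ - (pEval Q ((r m : ℂ) • ζ))⁻¹) atTop (𝓝 0) :=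
      squeeze_zero_norm (fun m => (hR m ζ hζ).le) tendsto_one_div_add_atTop_nhds_zero_nat
    have h3 := (h2.add h1).const_mul (pEval G ζ)
    have h4 : (starRingEnd ℂ) (ζ j) = pEval G ζ * (0 + (pEval Q ζ)⁻¹) := by
      rw [hGζ, zero_add, mul_assoc, mul_inv_cancel₀ hne, mul_one]
    rw [h4]
    refine h3.congr fun m => ?_
    rw [sub_add_cancel, pEval, pEval, pEval, map_mul]

/-- If the closure of `φ₁⁻¹(α)` contains no set of the form `pr_j⁻¹(V)` with `V ⊆ 𝕋^{n-1}`
real algebraic of Hausdorff dimension `n - 2`, then each conjugate coordinate function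
`ζ ↦ conj ζ_j` belongs to `H²(μ_α)`. -/
theorem conj_coord_mem_H2 {n : ℕ} (hn : 2 ≤ n)
    (φ : EuclideanSpace ℂ (Fin n) → ℂ)
    (hφ : ∃ p q : MvPolynomial (Fin n) ℂ, IsRationalInner n p q φ)
    (α : ℂ) (hα : ‖α‖ = 1)
    (μ : Measure (EuclideanSpace ℂ (Fin n))) (hμ : IsClarkMeasure n φ α μ)
    (hnocyl : ¬ ∃ (j : Fin n) (s : Finset (MvPolynomial ({i : Fin n // i ≠ j} × Bool) ℝ)),
        dimH (torus {i : Fin n // i ≠ j} ∩ realZeroSet s) = (n : ℝ≥0∞) - 2 ∧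
        {ζ | ζ ∈ torus (Fin n) ∧
            deleteCoord j ζ ∈ torus {i : Fin n // i ≠ j} ∩ realZeroSet s}
          ⊆ closure (radialFiber φ α)) :
    ∀ j : Fin n, ∃ f : Lp ℂ 2 μ,
      ⇑f =ᵐ[μ] (fun ζ => (starRingEnd ℂ) (ζ j)) ∧ f ∈ closure (polyLp n μ) := by
  intro j
  obtain ⟨p, q, h⟩ := hφ
  have := hμ.1
  refine conj_coord_mem_closure_polyLp hμ.ae_mem_torus
    (fun z hz => h.sub_C_mul_ne_zero hα hz) (ae_iff.2 (h.measure_ne_zero_eq_zero hμ)) j ?_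
  filter_upwards [hμ.ae_mem_torus, measure_eq_zero_iff_ae_notMem.1
    (h.measure_cylinder_eq_zero hn hα hμ j fun ⟨s, hs⟩ => hnocyl ⟨j, s, hs⟩)] with ζ hζ h0 h1
  exact h0 ⟨hζ, h1⟩

end
end

section
/- Let φ be a rational inner function on the polydisc 𝔻ⁿ, let α ∈ 𝕋, let μ_α be a Clark measure of φ at α, and set φ₁⁻¹(α) := {ζ ∈ 𝕋ⁿ : lim_{ρ→1⁻} φ(ρζ) = α}. Assume that for every j ∈ {1,…,n} there exist polynomials p_j, q_j ∈ ℂ[z₁,…,zₙ] such that q_j has no zeros on 𝔻ⁿ, q_j(ζ) ≠ 0 for ℋ^{n−1}-almost every ζ ∈ φ₁⁻¹(α), and q_j(ζ) = ζ_j · p_j(ζ) for every ζ ∈ φ₁⁻¹(α). Then H²(μ_α) = L²(μ_α). -/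
open MeasureTheory Filter Set
open scoped ENNReal

noncomputable section

instance : IsProbabilityMeasure (volume : Measure UnitAddCircle) := ⟨UnitAddCircle.measure_univ⟩

/-- The point `exp (2πit)` of the unit circle in `ℂ`. -/
def circlePt (t : UnitAddCircle) : ℂ := Circle.coeHom (AddCircle.toCircle t)

@[simp]
theorem norm_circlePt (t : UnitAddCircle) : ‖circlePt t‖ = 1 := Circle.norm_coe _

theorem circlePt_add (s t : UnitAddCircle) : circlePt (s + t) = circlePt s * circlePt t := by
  simp [circlePt, AddCircle.toCircle_add]

theorem circlePt_mk (t : ℝ) :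
    circlePt (t : UnitAddCircle) = Complex.exp (2 * Real.pi * t * Complex.I) := by
  rw [circlePt, AddCircle.toCircle_apply_mk]
  exact (Circle.coe_exp _).trans (by simp)

@[fun_prop]
theorem continuous_circlePt : Continuous circlePt :=
  continuous_induced_dom.comp AddCircle.continuous_toCircle

theorem exists_circlePt {z : ℂ} (hz : ‖z‖ = 1) : ∃ t, circlePt t = z := by
  refine ⟨((z.arg / (2 * Real.pi) : ℝ) : UnitAddCircle), ?_⟩
  have h := Complex.norm_mul_exp_arg_mul_I z
  rw [hz, Complex.ofReal_one, one_mul] at h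
  rw [circlePt_mk, ← h]
  congr 1
  have : (Real.pi : ℂ) ≠ 0 := by exact_mod_cast Real.pi_ne_zero
  push_cast
  field_simp
  simp [h]

theorem integral_circlePt_eq_circleAverage (f : ℂ → ℂ) :
    ∫ t : UnitAddCircle, f (circlePt t) = Real.circleAverage f 0 1 := by
  rw [Real.circleAverage_def, ← UnitAddCircle.intervalIntegral_preimage 0]
  have h := intervalIntegral.integral_comp_mul_left (a := 0) (b := 0 + 1)
    (fun θ => f (circleMap 0 1 θ)) (c := 2 * Real.pi) (by positivity)
  simp only [mul_zero, zero_add, mul_one] at h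
  rw [← h]
  simp only [zero_add]
  congr 1
  ext t
  rw [circlePt_mk, circleMap]
  simp

theorem lintegral_re_circlePt {f : ℂ → ℂ} (hf : DiffContOnCl ℂ f (Metric.ball 0 1))
    (h0 : ∀ z, ‖z‖ = 1 → 0 ≤ (f z).re) :
    ∫⁻ t : UnitAddCircle, ENNReal.ofReal (f (circlePt t)).re = ENNReal.ofReal (f 0).re := by
  have hc : Continuous fun t : UnitAddCircle => f (circlePt t) := by
    refine hf.continuousOn_ball.comp_continuous
      continuous_circlePt ?_
    intro t
    simp
  have hi : Integrable fun t : UnitAddCircle => f (circlePt t) :=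
    hc.integrable_of_hasCompactSupport (HasCompactSupport.of_compactSpace _)
  have hre : Integrable fun t : UnitAddCircle => (f (circlePt t)).re := hi.re
  rw [← ofReal_integral_eq_lintegral_ofReal hre (Eventually.of_forall fun t => h0 _ (by simp))]
  have h1 : ∫ t : UnitAddCircle, f (circlePt t) = f 0 := by
    rw [integral_circlePt_eq_circleAverage]
    exact DiffContOnCl.circleAverage (by simpa using hf)
  rw [← h1]
  congr 1
  exact integral_re hi

theorem lintegral_poisson_circlePt {w : ℂ} (hw : ‖w‖ = 1) {ρ : ℝ} (h0 : 0 ≤ ρ) (h1 : ρ < 1) :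
    ∫⁻ t : UnitAddCircle, ENNReal.ofReal ((1 - ρ ^ 2) / ‖w - ρ * circlePt t‖ ^ 2) = 1 := by
  have hne : ∀ z : ℂ, ‖z‖ ≤ 1 → w - ρ * z ≠ 0 := by
    intro z hz h
    have h2 : ‖w‖ = ρ * ‖z‖ := by
      rw [sub_eq_zero.1 h, norm_mul, Complex.norm_real, Real.norm_of_nonneg h0]
    nlinarith
  have key : ∀ z : ℂ, ‖z‖ = 1 →
      ((w + ρ * z) / (w - ρ * z)).re = (1 - ρ ^ 2) / ‖w - ρ * z‖ ^ 2 := by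
    intro z hz
    have hn : ‖w - ρ * z‖ ^ 2 ≠ 0 := by simpa using hne z hz.le
    rw [← Complex.normSq_eq_norm_sq] at hn ⊢
    have hw2 : w.re ^ 2 + w.im ^ 2 = 1 := by
      have := Complex.normSq_eq_norm_sq w
      rw [Complex.normSq_apply, hw] at this; linarith
    have hz2 : z.re ^ 2 + z.im ^ 2 = 1 := by
      have := Complex.normSq_eq_norm_sq z
      rw [Complex.normSq_apply, hz] at this; linarith
    rw [Complex.div_re, ← add_div]
    congr 1
    simp
    linear_combination hw2 - ρ ^ 2 * hz2
  have hd : DiffContOnCl ℂ (fun z : ℂ => (w + ρ * z) / (w - ρ * z)) (Metric.ball 0 1) := by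
    apply DifferentiableOn.diffContOnCl
    rw [closure_ball _ one_ne_zero]
    intro z hz
    refine DifferentiableAt.differentiableWithinAt (DifferentiableAt.div (by fun_prop) (by fun_prop) (hne z (by simpa using hz)))
  have h := lintegral_re_circlePt hd (fun z hz => by
    rw [key z hz]
    have : 0 ≤ 1 - ρ ^ 2 := by nlinarith
    positivity)
  have hw0 : w ≠ 0 := by intro h; simp [h] at hw
  simp only [mul_zero, add_zero, sub_zero, div_self hw0, Complex.one_re, ENNReal.ofReal_one] at h
  rw [← h]
  refine lintegral_congr fun t => ?_
  rw [key _ (by simp)]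

theorem tendsto_lintegral_poisson_near {w : ℂ} (hw : ‖w‖ = 1) {δ : ℝ} (hδ : 0 < δ)
    {ρ : ℕ → ℝ} (h0 : ∀ k, 0 ≤ ρ k) (h1 : ∀ k, ρ k < 1) (hρ : Tendsto ρ atTop (nhds 1)) :
    Tendsto (fun k => ∫⁻ t : UnitAddCircle, {t : UnitAddCircle | ‖w - circlePt t‖ < δ}.indicator
      (fun t => ENNReal.ofReal ((1 - ρ k ^ 2) / ‖w - ρ k * circlePt t‖ ^ 2)) t)
      atTop (nhds 1) := by
  have hct : Continuous fun t : UnitAddCircle => circlePt t :=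
    continuous_circlePt
  have hms : MeasurableSet {t : UnitAddCircle | ‖w - circlePt t‖ < δ} :=
    (isOpen_lt (by fun_prop) continuous_const).measurableSet
  have hfar : ∀ᶠ k in atTop, ENNReal.ofReal (1 - 4 * (1 - ρ k ^ 2) / δ ^ 2) ≤
      ∫⁻ t : UnitAddCircle, {t : UnitAddCircle | ‖w - circlePt t‖ < δ}.indicator
      (fun t => ENNReal.ofReal ((1 - ρ k ^ 2) / ‖w - ρ k * circlePt t‖ ^ 2)) t := by
    filter_upwards [hρ.eventually (lt_mem_nhds (show 1 - δ / 2 < 1 by linarith))] with k hk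
    have hpos : 0 ≤ 1 - ρ k ^ 2 := by nlinarith [h0 k, h1 k]
    rw [lintegral_indicator hms]
    have htot := lintegral_poisson_circlePt hw (h0 k) (h1 k)
    rw [← lintegral_add_compl _ hms] at htot
    have hcompl : ∫⁻ t in {t : UnitAddCircle | ‖w - circlePt t‖ < δ}ᶜ,
        ENNReal.ofReal ((1 - ρ k ^ 2) / ‖w - ρ k * circlePt t‖ ^ 2) ≤
        ENNReal.ofReal (4 * (1 - ρ k ^ 2) / δ ^ 2) := by
      calc _ ≤ ∫⁻ t in {t : UnitAddCircle | ‖w - circlePt t‖ < δ}ᶜ,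
          ENNReal.ofReal (4 * (1 - ρ k ^ 2) / δ ^ 2) := by
            refine setLIntegral_mono' hms.compl fun t ht => ?_
            apply ENNReal.ofReal_le_ofReal
            have ht' : δ ≤ ‖w - circlePt t‖ := by simpa using ht
            have h3 : δ / 2 ≤ ‖w - ρ k * circlePt t‖ := by
              have h4 : ‖w - circlePt t‖ ≤ ‖w - ρ k * circlePt t‖ + ‖(ρ k - 1) * circlePt t‖ := by
                refine le_trans (le_of_eq ?_) (norm_add_le _ _)
                congr 1; ring
              have h5 : ‖((ρ k : ℂ) - 1) * circlePt t‖ = 1 - ρ k := by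
                rw [norm_mul, norm_circlePt, mul_one, ← Complex.ofReal_one, ← Complex.ofReal_sub,
                  Complex.norm_real, Real.norm_of_nonpos (by linarith [h1 k])]
                ring
              linarith
            rw [show 4 * (1 - ρ k ^ 2) / δ ^ 2 = (1 - ρ k ^ 2) / (δ / 2) ^ 2 by field_simp; ring]
            gcongr
        _ ≤ ENNReal.ofReal (4 * (1 - ρ k ^ 2) / δ ^ 2) := by
            rw [setLIntegral_const]
            exact mul_le_of_le_one_right' prob_le_one
    have h4 : 0 ≤ 4 * (1 - ρ k ^ 2) / δ ^ 2 := by positivity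
    rw [ENNReal.ofReal_sub _ h4, ENNReal.ofReal_one, ← htot]
    exact tsub_le_iff_right.2 (by gcongr)
  have hlim : Tendsto (fun k => ENNReal.ofReal (1 - 4 * (1 - ρ k ^ 2) / δ ^ 2)) atTop (nhds 1) := by
    have : Tendsto (fun k => 1 - 4 * (1 - ρ k ^ 2) / δ ^ 2) atTop
        (nhds (1 - 4 * (1 - 1 ^ 2) / δ ^ 2)) :=
      tendsto_const_nhds.sub (((tendsto_const_nhds.sub (hρ.pow 2)).const_mul 4).div_const _)
    simpa using ENNReal.tendsto_ofReal this
  refine tendsto_of_tendsto_of_tendsto_of_le_of_le' hlim tendsto_const_nhds hfar ?_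
  refine Eventually.of_forall fun k => ?_
  rw [← lintegral_poisson_circlePt hw (h0 k) (h1 k)]
  exact lintegral_mono fun t => indicator_le_self _ _ _

/-- The point of the unit torus with arguments `2πx_j`. -/
def torusPt {n : ℕ} (x : Fin n → UnitAddCircle) : EuclideanSpace ℂ (Fin n) :=
  WithLp.toLp 2 fun j => circlePt (x j)

@[simp]
theorem torusPt_apply {n : ℕ} (x : Fin n → UnitAddCircle) (j : Fin n) :
    torusPt x j = circlePt (x j) := rfl

theorem torusPt_mem {n : ℕ} (x : Fin n → UnitAddCircle) : torusPt x ∈ torus (Fin n) :=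
  fun j => by simp

@[fun_prop]
theorem continuous_torusPt {n : ℕ} : Continuous (torusPt (n := n)) := by
  unfold torusPt
  fun_prop

theorem torusPt_add_const {n : ℕ} (x : Fin n → UnitAddCircle) (t : UnitAddCircle) :
    torusPt (x + fun _ => t) = circlePt t • torusPt x := by
  ext j
  simp [circlePt_add, mul_comm]

theorem exists_torusPt {n : ℕ} {ζ : EuclideanSpace ℂ (Fin n)} (hζ : ζ ∈ torus (Fin n)) :
    ∃ x, torusPt x = ζ := by
  choose x hx using fun j => exists_circlePt (hζ j)
  exact ⟨x, by ext j; simp [hx]⟩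

theorem smul_mem_polydisc {n : ℕ} {ζ : EuclideanSpace ℂ (Fin n)} (hζ : ζ ∈ torus (Fin n))
    {c : ℂ} (hc : ‖c‖ < 1) : c • ζ ∈ polydisc n := by
  intro j
  simpa [hζ j] using hc

theorem isCompact_torus_s12 {n : ℕ} : IsCompact (torus (Fin n)) := by
  have : torus (Fin n) = range (torusPt (n := n)) := by
    ext ζ
    exact ⟨fun h => exists_torusPt h, by rintro ⟨x, rfl⟩; exact torusPt_mem x⟩
  rw [this]
  exact isCompact_range continuous_torusPt

theorem lintegral_prod_pi {n : ℕ} (f : Fin n → UnitAddCircle → ℝ≥0∞)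
    (hf : ∀ j, Measurable (f j)) :
    ∫⁻ x : Fin n → UnitAddCircle, ∏ j, f j (x j) = ∏ j, ∫⁻ t, f j t := by
  rw [volume_pi, ProbabilityTheory.lintegral_prod_eq_prod_lintegral_of_indepFun Finset.univ
    (fun j (x : Fin n → UnitAddCircle) => f j (x j))
    (ProbabilityTheory.iIndepFun_pi fun j => (hf j).aemeasurable)
    (fun j => (hf j).comp (measurable_pi_apply j))]
  refine Finset.prod_congr rfl fun j _ => ?_
  exact (measurePreserving_eval (fun _ : Fin n => (volume : Measure UnitAddCircle)) j).lintegral_comp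
    (hf j)

theorem one_le_liminf_lintegral_poisson {n : ℕ} {ζ : EuclideanSpace ℂ (Fin n)}
    (hζ : ζ ∈ torus (Fin n)) {V : Set (EuclideanSpace ℂ (Fin n))} (hV : IsOpen V) (hζV : ζ ∈ V)
    {ρ : ℕ → ℝ} (h0 : ∀ k, 0 ≤ ρ k) (h1 : ∀ k, ρ k < 1) (hρ : Tendsto ρ atTop (nhds 1)) :
    1 ≤ liminf (fun k => ∫⁻ x : Fin n → UnitAddCircle, (torusPt ⁻¹' V).indicator (fun x =>
      ENNReal.ofReal (∏ j, (1 - ‖((ρ k : ℂ) • torusPt x) j‖ ^ 2) /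
        ‖ζ j - ((ρ k : ℂ) • torusPt x) j‖ ^ 2)) x) atTop := by
  have hcont : Continuous (WithLp.toLp 2 : (Fin n → ℂ) → EuclideanSpace ℂ (Fin n)) := by fun_prop
  obtain ⟨δ, hδ, hball⟩ := Metric.isOpen_iff.1 (hV.preimage hcont) (WithLp.ofLp ζ) hζV
  set f : ℕ → Fin n → UnitAddCircle → ℝ≥0∞ := fun k j =>
    {t : UnitAddCircle | ‖ζ j - circlePt t‖ < δ}.indicator
      (fun t => ENNReal.ofReal ((1 - ρ k ^ 2) / ‖ζ j - ρ k * circlePt t‖ ^ 2)) with hf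
  have hfm : ∀ k j, Measurable (f k j) := by
    intro k j
    refine Measurable.indicator ?_ (isOpen_lt (by fun_prop) continuous_const).measurableSet
    have := continuous_circlePt.measurable
    fun_prop
  have hlim : Tendsto (fun k => ∏ j, ∫⁻ t, f k j t) atTop (nhds 1) := by
    have : Tendsto (fun k => ∏ j, ∫⁻ t, f k j t) atTop (nhds (∏ j : Fin n, 1)) :=
      ENNReal.tendsto_finsetProd_of_ne_top _
        (fun j _ => tendsto_lintegral_poisson_near (hζ j) hδ h0 h1 hρ) (by simp)
    simpa using this
  rw [← hlim.liminf_eq]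
  refine liminf_le_liminf (Eventually.of_forall fun k => ?_)
  rw [← lintegral_prod_pi _ (hfm k)]
  refine lintegral_mono fun x => ?_
  by_cases hx : ∀ j, ‖ζ j - circlePt (x j)‖ < δ
  · have hxV : x ∈ torusPt ⁻¹' V := by
      have : (fun j => circlePt (x j)) ∈ Metric.ball (WithLp.ofLp ζ) δ := by
        rw [Metric.mem_ball, dist_comm, dist_pi_lt_iff hδ]
        intro j
        rw [dist_eq_norm]
        exact hx j
      exact hball this
    rw [indicator_of_mem hxV, ENNReal.ofReal_prod_of_nonneg]
    · refine Finset.prod_le_prod' fun j _ => ?_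
      refine (indicator_le_self _ _ _).trans (le_of_eq ?_)
      simp
    · intro j _
      have := h0 k
      have := h1 k
      simp only [PiLp.smul_apply, torusPt_apply, smul_eq_mul, norm_mul, Complex.norm_real,
        norm_circlePt, mul_one, Real.norm_eq_abs, sq_abs]
      have : 0 ≤ 1 - ρ k ^ 2 := by nlinarith
      positivity
  · push Not at hx
    obtain ⟨j, hj⟩ := hx
    have : ∏ j, f k j (x j) = 0 := by
      refine Finset.prod_eq_zero (Finset.mem_univ j) (indicator_of_notMem ?_ _)
      simpa using hj
    rw [this]
    exact zero_le

theorem IsClarkMeasure.measure_le_liminf {n : ℕ} {φ : EuclideanSpace ℂ (Fin n) → ℂ} {α : ℂ}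
    {μ : Measure (EuclideanSpace ℂ (Fin n))} (hμ : IsClarkMeasure n φ α μ)
    {V : Set (EuclideanSpace ℂ (Fin n))} (hV : IsOpen V)
    {ρ : ℕ → ℝ} (h0 : ∀ k, 0 ≤ ρ k) (h1 : ∀ k, ρ k < 1) (hρ : Tendsto ρ atTop (nhds 1)) :
    μ V ≤ liminf (fun k => ∫⁻ x : Fin n → UnitAddCircle, (torusPt ⁻¹' V).indicator (fun x =>
      ENNReal.ofReal ((1 - ‖φ ((ρ k : ℂ) • torusPt x)‖ ^ 2) /
        ‖α - φ ((ρ k : ℂ) • torusPt x)‖ ^ 2)) x) atTop := by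
  obtain ⟨hfin, htor, hP⟩ := hμ
  have hVm : MeasurableSet (torusPt (n := n) ⁻¹' V) := (hV.preimage continuous_torusPt).measurableSet
  set g : ℕ → EuclideanSpace ℂ (Fin n) → (Fin n → UnitAddCircle) → ℝ≥0∞ := fun k ζ =>
    (torusPt ⁻¹' V).indicator (fun x =>
      ENNReal.ofReal (∏ j, (1 - ‖((ρ k : ℂ) • torusPt x) j‖ ^ 2) /
        ‖ζ j - ((ρ k : ℂ) • torusPt x) j‖ ^ 2)) with hg
  have hgm : ∀ k, Measurable (Function.uncurry (g k)) := by
    intro k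
    have he : Function.uncurry (g k) = (Prod.snd ⁻¹' (torusPt ⁻¹' V)).indicator
      (fun p : EuclideanSpace ℂ (Fin n) × (Fin n → UnitAddCircle) =>
      ENNReal.ofReal (∏ j, (1 - ‖((ρ k : ℂ) • torusPt p.2) j‖ ^ 2) /
        ‖p.1 j - ((ρ k : ℂ) • torusPt p.2) j‖ ^ 2)) := by
      ext ⟨ζ, x⟩
      rfl
    rw [he]
    refine Measurable.indicator ?_ (measurable_snd hVm)
    refine ENNReal.measurable_ofReal.comp (Finset.measurable_fun_prod _ fun j _ => ?_)
    refine Measurable.div ?_ ?_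
    · refine Continuous.measurable ?_
      fun_prop
    · refine Continuous.measurable ?_
      fun_prop
  calc μ V = ∫⁻ ζ, V.indicator 1 ζ ∂μ := (lintegral_indicator_one hV.measurableSet).symm
    _ ≤ ∫⁻ ζ, liminf (fun k => ∫⁻ x, g k ζ x) atTop ∂μ := by
        refine lintegral_mono_ae ?_
        filter_upwards [mem_ae_iff.2 htor] with ζ hζ
        by_cases hζV : ζ ∈ V
        · rw [indicator_of_mem hζV]
          exact one_le_liminf_lintegral_poisson hζ hV hζV h0 h1 hρ
        · rw [indicator_of_notMem hζV]
          exact zero_le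
    _ ≤ liminf (fun k => ∫⁻ ζ, (∫⁻ x, g k ζ x) ∂μ) atTop :=
        lintegral_liminf_le fun k => (hgm k).lintegral_prod_right'
    _ = _ := by
        congr 1
        ext k
        rw [lintegral_lintegral_swap (hgm k).aemeasurable]
        refine lintegral_congr fun x => ?_
        by_cases hx : x ∈ torusPt ⁻¹' V
        · simp only [hg, indicator_of_mem hx]
          refine hP _ (smul_mem_polydisc (torusPt_mem x) ?_)
          rw [Complex.norm_real, Real.norm_of_nonneg (h0 k)]
          exact h1 k
        · simp [hg, indicator_of_notMem hx]

/-- The slice `λ ↦ p(λζ)` of a polynomial, as a polynomial in one variable. -/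
def slice {n : ℕ} (p : MvPolynomial (Fin n) ℂ) (ζ : EuclideanSpace ℂ (Fin n)) : Polynomial ℂ :=
  MvPolynomial.aeval (fun i => Polynomial.C (ζ i) * Polynomial.X) p

theorem eval_slice {n : ℕ} (p : MvPolynomial (Fin n) ℂ) (ζ : EuclideanSpace ℂ (Fin n)) (c : ℂ) :
    (slice p ζ).eval c = pEval p (c • ζ) := by
  have h := MvPolynomial.eval₂_comp_left (Polynomial.evalRingHom c)
    (algebraMap ℂ (Polynomial ℂ)) (fun i => Polynomial.C (ζ i) * Polynomial.X) p
  rw [slice, MvPolynomial.aeval_def, ← Polynomial.coe_evalRingHom, h, pEval, MvPolynomial.eval]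
  simp only [MvPolynomial.coe_eval₂Hom]
  congr 1
  · exact RingHom.ext fun a => Polynomial.eval_C
  · funext i
    have : (Polynomial.C (ζ i) * Polynomial.X).eval c = c * ζ i := by
      rw [Polynomial.eval_mul, Polynomial.eval_C, Polynomial.eval_X, mul_comm]
    exact this

theorem continuous_pEval_s12 {n : ℕ} (p : MvPolynomial (Fin n) ℂ) : Continuous (pEval p) := by
  unfold pEval
  exact (MvPolynomial.continuous_eval p).comp (by fun_prop)

theorem IsRationalInner.exists_slice {n : ℕ} {p q : MvPolynomial (Fin n) ℂ}
    {φ : EuclideanSpace ℂ (Fin n) → ℂ} (h : IsRationalInner n p q φ)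
    {ζ : EuclideanSpace ℂ (Fin n)} (hζ : ζ ∈ torus (Fin n)) :
    ∃ P Q : Polynomial ℂ, (∀ c : ℂ, ‖c‖ ≤ 1 → Q.eval c ≠ 0) ∧
      (∀ c : ℂ, ‖c‖ < 1 → φ (c • ζ) = P.eval c / Q.eval c) := by
  have hq0 : ∀ c : ℂ, ‖c‖ < 1 → (slice q ζ).eval c ≠ 0 := by
    intro c hc
    rw [eval_slice]
    exact h.q_ne_zero _ (smul_mem_polydisc hζ hc)
  have hq : slice q ζ ≠ 0 := by
    intro h0
    exact hq0 0 (by simp) (by simp [h0])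
  set g := EuclideanDomain.gcd (slice p ζ) (slice q ζ) with hg
  obtain ⟨P, hP⟩ := EuclideanDomain.gcd_dvd_left (slice p ζ) (slice q ζ)
  obtain ⟨Q, hQ⟩ := EuclideanDomain.gcd_dvd_right (slice p ζ) (slice q ζ)
  rw [← hg] at hP hQ
  have hg0 : g ≠ 0 := by
    rintro h0
    rw [h0, zero_mul] at hQ
    exact hq hQ
  have hcop : ∃ a b : Polynomial ℂ, a * P + b * Q = 1 := by
    have hb := EuclideanDomain.gcd_eq_gcd_ab (slice p ζ) (slice q ζ)
    refine ⟨EuclideanDomain.gcdA (slice p ζ) (slice q ζ),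
      EuclideanDomain.gcdB (slice p ζ) (slice q ζ), mul_left_cancel₀ hg0 ?_⟩
    rw [← hg] at hb
    generalize EuclideanDomain.gcdA (slice p ζ) (slice q ζ) = a at *
    generalize EuclideanDomain.gcdB (slice p ζ) (slice q ζ) = b at *
    rw [hP, hQ] at hb
    linear_combination -hb
  have hQ0 : ∀ c : ℂ, ‖c‖ < 1 → Q.eval c ≠ 0 := by
    intro c hc h0
    apply hq0 c hc
    rw [hQ, Polynomial.eval_mul, h0, mul_zero]
  have hφ : ∀ c : ℂ, ‖c‖ < 1 → φ (c • ζ) = P.eval c / Q.eval c := by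
    intro c hc
    have h1 := hq0 c hc
    rw [h.phi_eq _ (smul_mem_polydisc hζ hc), ← eval_slice, ← eval_slice]
    rw [hQ, Polynomial.eval_mul] at h1
    rw [hP, hQ, Polynomial.eval_mul, Polynomial.eval_mul, mul_div_mul_left _ _ (left_ne_zero_of_mul h1)]
  have hle : ∀ c ∈ Metric.closedBall (0 : ℂ) 1, ‖P.eval c‖ ≤ ‖Q.eval c‖ := by
    rw [← closure_ball _ one_ne_zero]
    intro c hc
    refine closure_minimal ?_ (isClosed_le P.continuous.norm Q.continuous.norm) hc
    intro c hc
    rw [mem_ball_zero_iff] at hc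
    have h1 := h.abs_lt_one _ (smul_mem_polydisc hζ hc)
    rw [hφ c hc, norm_div, div_lt_one (norm_pos_iff.2 (hQ0 c hc))] at h1
    exact h1.le
  refine ⟨P, Q, ?_, hφ⟩
  intro c hc h0
  obtain ⟨a, b, hab⟩ := hcop
  have h1 := hle c (by simpa using hc)
  rw [h0, norm_zero] at h1
  have h2 := congrArg (Polynomial.eval c) hab
  simp [h0, norm_le_zero_iff.1 h1] at h2

theorem hasRadialLimit_iff_of_slice {n : ℕ} {φ : EuclideanSpace ℂ (Fin n) → ℂ}
    {ζ : EuclideanSpace ℂ (Fin n)} {P Q : Polynomial ℂ}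
    (hQ : ∀ c : ℂ, ‖c‖ ≤ 1 → Q.eval c ≠ 0)
    (hφ : ∀ c : ℂ, ‖c‖ < 1 → φ (c • ζ) = P.eval c / Q.eval c)
    {w : ℂ} (hw : ‖w‖ = 1) (β : ℂ) :
    HasRadialLimit φ (w • ζ) β ↔ P.eval w / Q.eval w = β := by
  have h : HasRadialLimit φ (w • ζ) (P.eval w / Q.eval w) := by
    have hc : ContinuousAt (fun ρ : ℝ => P.eval (ρ * w) / Q.eval (ρ * w)) 1 := by
      refine ContinuousAt.div ?_ ?_ ?_
      · exact (P.continuous.comp (by fun_prop)).continuousAt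
      · exact (Q.continuous.comp (by fun_prop)).continuousAt
      · simpa using hQ w hw.le
    have ht := hc.tendsto.mono_left (nhdsWithin_le_nhds (s := Iio 1))
    simp only [Complex.ofReal_one, one_mul] at ht
    refine ht.congr' ?_
    have : Ioo (-1 : ℝ) 1 ∈ nhdsWithin 1 (Iio 1) := Ioo_mem_nhdsLT (by norm_num)
    filter_upwards [this] with ρ hρ
    rw [smul_smul, hφ]
    rw [norm_mul, hw, mul_one, Complex.norm_real]
    exact abs_lt.2 hρ
  exact ⟨fun h' => tendsto_nhds_unique h h', fun h' => h' ▸ h⟩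

theorem measurableSet_radialFiber {n : ℕ} {p q : MvPolynomial (Fin n) ℂ}
    {φ : EuclideanSpace ℂ (Fin n) → ℂ} (h : IsRationalInner n p q φ) (α : ℂ) :
    MeasurableSet (radialFiber φ α) := by
  set ρ : ℕ → ℝ := fun k => 1 - 1 / ((k : ℝ) + 1) with hρ
  have hlim : Tendsto ρ atTop (nhdsWithin 1 (Iio 1)) := by
    refine tendsto_nhdsWithin_iff.2 ⟨?_, Eventually.of_forall fun k => ?_⟩
    · have := (tendsto_const_nhds (x := (1 : ℝ))).sub
        (tendsto_one_div_add_atTop_nhds_zero_nat (𝕜 := ℝ))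
      rw [sub_zero] at this
      exact this
    · have : (0 : ℝ) < 1 / ((k : ℝ) + 1) := by positivity
      simp only [hρ, mem_Iio]
      linarith
  have hbd : ∀ k, ‖(ρ k : ℂ)‖ < 1 := by
    intro k
    have h1 : (0 : ℝ) < 1 / ((k : ℝ) + 1) := by positivity
    have h2 : 1 / ((k : ℝ) + 1) ≤ 1 := by
      rw [div_le_one (by positivity)]
      linarith [Nat.cast_nonneg (α := ℝ) k]
    rw [Complex.norm_real]
    exact abs_lt.2 ⟨by simp only [hρ]; linarith, by simp only [hρ]; linarith⟩
  have heq : radialFiber φ α = torus (Fin n) ∩ {ζ | Tendsto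
      (fun k => pEval p ((ρ k : ℂ) • ζ) / pEval q ((ρ k : ℂ) • ζ)) atTop (nhds α)} := by
    ext ζ
    refine and_congr_right fun hζ => ?_
    have hcongr : ∀ k, φ ((ρ k : ℂ) • ζ) = pEval p ((ρ k : ℂ) • ζ) / pEval q ((ρ k : ℂ) • ζ) :=
      fun k => h.phi_eq _ (smul_mem_polydisc hζ (hbd k))
    simp only [Set.mem_ofPred_eq, ← hcongr]
    refine ⟨fun h' => h'.comp hlim, fun h' => ?_⟩
    obtain ⟨P, Q, hQ, hφ⟩ := h.exists_slice hζ
    have hr := (hasRadialLimit_iff_of_slice hQ hφ (w := 1) (by simp) _).2 rfl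
    rw [one_smul] at hr
    have := tendsto_nhds_unique (hr.comp hlim) h'
    rwa [this] at hr
  rw [heq]
  refine isCompact_torus_s12.isClosed.measurableSet.inter (measurableSet_tendsto _ fun k => ?_)
  exact (((continuous_pEval_s12 p).comp (by fun_prop)).measurable).div
    (((continuous_pEval_s12 q).comp (by fun_prop)).measurable)

theorem norm_le_norm_circlePt_sub (x y : UnitAddCircle) :
    ‖x - y‖ ≤ ‖circlePt x - circlePt y‖ := by
  have key : ∀ z : UnitAddCircle, ‖z‖ ≤ ‖circlePt z - 1‖ := by
    intro z
    obtain ⟨t, rfl⟩ := QuotientAddGroup.mk_surjective z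
    change ‖(t : UnitAddCircle)‖ ≤ ‖circlePt (t : UnitAddCircle) - 1‖
    have hs : ((t - round t : ℝ) : UnitAddCircle) = (t : UnitAddCircle) := by
      rw [AddCircle.coe_sub, sub_eq_self, AddCircle.coe_eq_zero_iff]
      exact ⟨round t, by simp⟩
    have ht := abs_sub_round t
    rw [UnitAddCircle.norm_eq, ← hs, circlePt_mk]
    generalize t - round t = u at ht
    have h1 : Complex.exp (2 * Real.pi * u * Complex.I) - 1
        = Complex.exp (Complex.I * ((2 * Real.pi * u : ℝ) : ℂ)) - 1 := by
      push_cast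
      ring_nf
    rw [h1, Complex.norm_exp_I_mul_ofReal_sub_one, norm_mul, Real.norm_eq_abs, Real.norm_eq_abs,
      show 2 * Real.pi * u / 2 = Real.pi * u by ring]
    have h2 : |Real.sin (Real.pi * u)| = Real.sin (Real.pi * |u|) := by
      rcases abs_cases u with ⟨h, h'⟩ | ⟨h, h'⟩
      · rw [h, abs_of_nonneg]
        exact Real.sin_nonneg_of_nonneg_of_le_pi (by positivity) (by nlinarith [Real.pi_pos])
      · rw [h, mul_neg, Real.sin_neg, abs_of_nonpos]
        exact Real.sin_nonpos_of_nonpos_of_neg_pi_le (by nlinarith [Real.pi_pos])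
          (by nlinarith [Real.pi_pos])
    have h3 := Real.mul_le_sin (x := Real.pi * |u|) (by positivity) (by nlinarith [Real.pi_pos])
    rw [← mul_assoc, div_mul_cancel₀ _ Real.pi_ne_zero] at h3
    rw [h2, abs_of_pos (by norm_num : (0 : ℝ) < 2)]
    linarith [abs_nonneg u]
  have h := circlePt_add y (x - y)
  rw [add_sub_cancel] at h
  rw [h, ← mul_sub_one, norm_mul, norm_circlePt, one_mul]
  exact key _

theorem norm_apply_sub_le_toReal_ediam {n : ℕ} {s : Set (EuclideanSpace ℂ (Fin n))}
    (hs : Metric.ediam s ≤ 1) {x y : Fin n → UnitAddCircle} (hx : torusPt x ∈ s)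
    (hy : torusPt y ∈ s) (j : Fin n) : ‖x j - y j‖ ≤ (Metric.ediam s).toReal := by
  have h1 := PiLp.norm_apply_le (torusPt x - torusPt y) j
  have h2 : edist (torusPt x) (torusPt y) ≤ Metric.ediam s := Metric.edist_le_ediam_of_mem hx hy
  rw [edist_dist, dist_eq_norm] at h2
  have h3 := (ENNReal.ofReal_le_iff_le_toReal (ne_top_of_le_ne_top ENNReal.one_ne_top hs)).1 h2
  exact (norm_le_norm_circlePt_sub _ _).trans (h1.trans h3)

theorem volume_closedBall_le {m : ℕ} (a : Fin m → UnitAddCircle) {r : ℝ} (hr : 0 ≤ r) :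
    volume (Metric.closedBall a r) ≤ ENNReal.ofReal (2 * r) ^ m := by
  rw [volume_pi, Measure.pi_closedBall _ _ hr]
  refine (Finset.prod_le_pow_card _ _ (ENNReal.ofReal (2 * r)) fun j _ => ?_).trans (by simp)
  rw [AddCircle.volume_closedBall]
  exact ENNReal.ofReal_le_ofReal (min_le_right _ _)

theorem outerMeasure_eq_zero_of_hausdorffMeasure {X : Type*} [EMetricSpace X] [MeasurableSpace X]
    [BorelSpace X] (ν : OuterMeasure X) {C : ℝ≥0∞} (hC : C ≠ ∞) {d : ℝ}
    (h : ∀ s : Set X, Metric.ediam s ≤ 1 → ν s ≤ C * Metric.ediam s ^ d) {s : Set X}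
    (hs : μH[d] s = 0) : ν s = 0 := by
  have hle := OuterMeasure.le_mkMetric (fun r => r ^ d) (C⁻¹ • ν) 1 one_pos (by
    intro s hs
    change C⁻¹ * ν s ≤ _
    rw [mul_comm, ← div_eq_mul_inv]
    exact ENNReal.div_le_of_le_mul' (h s hs)) s
  rw [← Measure.mkMetric_toOuterMeasure] at hle
  have h0 : C⁻¹ * ν s ≤ 0 := hle.trans hs.le
  simpa [hC] using h0

theorem ae_torusPt_notMem {n : ℕ} {s : Set (EuclideanSpace ℂ (Fin n))} (hs : μH[(n : ℝ)] s = 0) :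
    ∀ᵐ x : Fin n → UnitAddCircle, torusPt x ∉ s := by
  refine outerMeasure_eq_zero_of_hausdorffMeasure (OuterMeasure.map (torusPt (n := n))
    (volume : Measure (Fin n → UnitAddCircle)).toOuterMeasure) (C := 2 ^ n) (by simp)
    (fun s hs => ?_) hs |> fun h => ?_
  · rw [ae_iff]
    simp only [not_not]
    exact h
  · change volume (torusPt ⁻¹' s) ≤ _
    rcases (torusPt ⁻¹' s).eq_empty_or_nonempty with h | ⟨a, ha⟩
    · simp [h]
    have hfin := ne_top_of_le_ne_top ENNReal.one_ne_top hs
    calc volume (torusPt ⁻¹' s) ≤ volume (Metric.closedBall a (Metric.ediam s).toReal) := by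
          refine measure_mono fun x hx => ?_
          rw [mem_closedBall_iff_norm, pi_norm_le_iff_of_nonneg ENNReal.toReal_nonneg]
          exact fun j => norm_apply_sub_le_toReal_ediam hs hx ha j
      _ ≤ _ := volume_closedBall_le _ ENNReal.toReal_nonneg
      _ = _ := by
          rw [ENNReal.ofReal_mul (by norm_num), ENNReal.ofReal_toReal hfin, ENNReal.rpow_natCast,
            mul_pow]
          simp

/-- The outer measure `s ↦ |{x | the diagonal orbit of x meets s}|`. -/
def orbitOuterMeasure (n : ℕ) : OuterMeasure (EuclideanSpace ℂ (Fin n)) where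
  measureOf s := volume {x : Fin n → UnitAddCircle | ∃ t, torusPt (x + fun _ => t) ∈ s}
  empty := by simp
  mono h := measure_mono (by rintro x ⟨t, ht⟩; exact ⟨t, h ht⟩)
  iUnion_nat s _ := by
    refine (measure_mono ?_).trans (measure_iUnion_le _)
    rintro x ⟨t, ht⟩
    obtain ⟨i, hi⟩ := mem_iUnion.1 ht
    exact mem_iUnion.2 ⟨i, t, hi⟩

theorem ae_forall_circlePt_smul_torusPt_notMem {m : ℕ} {s : Set (EuclideanSpace ℂ (Fin (m + 1)))}
    (hs : μH[(m : ℝ)] s = 0) :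
    ∀ᵐ x : Fin (m + 1) → UnitAddCircle, ∀ t, circlePt t • torusPt x ∉ s := by
  refine outerMeasure_eq_zero_of_hausdorffMeasure (orbitOuterMeasure (m + 1)) (C := 4 ^ m)
    (by simp) (fun s hs => ?_) hs |> fun h => ?_
  · rw [ae_iff]
    have h' : volume {x : Fin (m + 1) → UnitAddCircle | ∃ t, torusPt (x + fun _ => t) ∈ s} = 0 := h
    simpa [torusPt_add_const] using h'
  · change volume {x : Fin (m + 1) → UnitAddCircle | ∃ t, torusPt (x + fun _ => t) ∈ s} ≤ _
    rcases (torusPt ⁻¹' s).eq_empty_or_nonempty with h | ⟨a, ha⟩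
    · have : {x : Fin (m + 1) → UnitAddCircle | ∃ t, torusPt (x + fun _ => t) ∈ s} = ∅ := by
        rw [eq_empty_iff_forall_notMem]
        rintro x ⟨t, ht⟩
        exact eq_empty_iff_forall_notMem.1 h _ ht
      simp [this]
    have hfin := ne_top_of_le_ne_top ENNReal.one_ne_top hs
    set r := (Metric.ediam s).toReal with hr
    have hr0 : 0 ≤ r := ENNReal.toReal_nonneg
    set T : Set (UnitAddCircle × (Fin m → UnitAddCircle)) :=
      {z | dist z.2 (fun j => z.1 + (a j.succ - a 0)) ≤ 2 * r} with hT
    have hTm : MeasurableSet T :=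
      (isClosed_le (by fun_prop) (by fun_prop)).measurableSet
    have hmp := volume_preserving_piFinSuccAbove (fun _ : Fin (m + 1) => UnitAddCircle) 0
    calc volume {x : Fin (m + 1) → UnitAddCircle | ∃ t, torusPt (x + fun _ => t) ∈ s}
        ≤ volume ((MeasurableEquiv.piFinSuccAbove (fun _ : Fin (m + 1) => UnitAddCircle) 0) ⁻¹' T)
          := by
          refine measure_mono ?_
          rintro x ⟨t, ht⟩
          change dist (fun j : Fin m => x (Fin.succAbove 0 j)) (fun j => x 0 + (a j.succ - a 0)) ≤ _
          rw [dist_pi_le_iff (by positivity)]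
          intro j
          have h1 := norm_apply_sub_le_toReal_ediam hs ht ha j.succ
          have h2 := norm_apply_sub_le_toReal_ediam hs ht ha 0
          simp only [Pi.add_apply] at h1 h2
          rw [dist_eq_norm, Fin.succAbove_zero]
          have h3 : x j.succ - (x 0 + (a j.succ - a 0)) =
            (x j.succ + t - a j.succ) - (x 0 + t - a 0) := by abel
          rw [h3]
          exact (norm_sub_le _ _).trans (by linarith)
      _ = volume T := hmp.measure_preimage hTm.nullMeasurableSet
      _ = ∫⁻ u : UnitAddCircle,
            volume (Metric.closedBall (fun j : Fin m => u + (a j.succ - a 0)) (2 * r)) := by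
          rw [Measure.volume_eq_prod, Measure.prod_apply hTm]
          rfl
      _ ≤ ∫⁻ _u : UnitAddCircle, ENNReal.ofReal (2 * (2 * r)) ^ m :=
          lintegral_mono fun u => volume_closedBall_le _ (by positivity)
      _ = _ := by
          rw [lintegral_const, measure_univ, mul_one, ← mul_assoc, ENNReal.ofReal_mul (by norm_num),
            ENNReal.ofReal_toReal hfin, ENNReal.rpow_natCast, mul_pow]
          norm_num

theorem measurePreserving_add_diagonal (n : ℕ) :
    MeasurePreserving (fun z : (Fin n → UnitAddCircle) × UnitAddCircle => z.1 + fun _ => z.2)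
      (volume.prod volume) volume := by
  have hm : Measurable
      (fun z : (Fin n → UnitAddCircle) × UnitAddCircle => z.1 + fun _ => z.2) := by fun_prop
  refine ⟨hm, Measure.ext fun s hs => ?_⟩
  rw [Measure.map_apply hm hs, Measure.prod_apply_symm (hm hs)]
  have h : ∀ t : UnitAddCircle, volume ((fun x : Fin n → UnitAddCircle => (x, t)) ⁻¹'
      ((fun z : (Fin n → UnitAddCircle) × UnitAddCircle => z.1 + fun _ => z.2) ⁻¹' s)) =
      volume s := fun t =>
    (measurePreserving_add_right volume fun _ : Fin n => t).measure_preimage hs.nullMeasurableSet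
  simp [h]

theorem IsRationalInner.ae_norm_slice_eq {n : ℕ} {p q : MvPolynomial (Fin n) ℂ}
    {φ : EuclideanSpace ℂ (Fin n) → ℂ} (h : IsRationalInner n p q φ) :
    ∀ᵐ x : Fin n → UnitAddCircle, ∀ P Q : Polynomial ℂ, (∀ c : ℂ, ‖c‖ ≤ 1 → Q.eval c ≠ 0) →
      (∀ c : ℂ, ‖c‖ < 1 → φ (c • torusPt x) = P.eval c / Q.eval c) →
      ∀ t, ‖P.eval (circlePt t)‖ = ‖Q.eval (circlePt t)‖ := by
  obtain ⟨E, -, hE, hφ⟩ := h.inner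
  have h1 := (measurePreserving_add_diagonal n).quasiMeasurePreserving.ae (ae_torusPt_notMem hE)
  filter_upwards [Measure.ae_ae_of_ae_prod h1] with x hx P Q hQ hPQ
  have h2 : (fun t => ‖P.eval (circlePt t)‖) =ᵐ[volume] fun t => ‖Q.eval (circlePt t)‖ := by
    filter_upwards [hx] with t ht
    obtain ⟨β, hβ, hr⟩ := hφ _ ⟨torusPt_mem _, ht⟩
    rw [torusPt_add_const, hasRadialLimit_iff_of_slice hQ hPQ (norm_circlePt t),
      div_eq_iff (hQ _ (norm_circlePt t).le)] at hr
    rw [hr, norm_mul, hβ, one_mul]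
  exact congrFun ((Continuous.ae_eq_iff_eq volume
    (P.continuous.comp continuous_circlePt).norm (Q.continuous.comp continuous_circlePt).norm).1 h2)

theorem re_add_div_sub {α z : ℂ} (hα : ‖α‖ = 1) :
    ((α + z) / (α - z)).re = (1 - ‖z‖ ^ 2) / ‖α - z‖ ^ 2 := by
  have h : α.re * α.re + α.im * α.im = 1 := by
    rw [← Complex.normSq_apply, Complex.normSq_eq_norm_sq, hα, one_pow]
  rw [Complex.div_re, ← add_div, ← Complex.normSq_eq_norm_sq, ← Complex.normSq_eq_norm_sq,
    Complex.normSq_apply z]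
  congr 1
  simp only [Complex.add_re, Complex.add_im, Complex.sub_re, Complex.sub_im]
  linear_combination h

/-- The Poisson integral of a Clark measure on the torus of radius `ρ`. -/
def clarkDensity {n : ℕ} (φ : EuclideanSpace ℂ (Fin n) → ℂ) (α : ℂ) (ρ : ℝ)
    (x : Fin n → UnitAddCircle) : ℝ≥0∞ :=
  ENNReal.ofReal ((1 - ‖φ ((ρ : ℂ) • torusPt x)‖ ^ 2) / ‖α - φ ((ρ : ℂ) • torusPt x)‖ ^ 2)

theorem IsRationalInner.measurable_clarkDensity {n : ℕ} {p q : MvPolynomial (Fin n) ℂ}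
    {φ : EuclideanSpace ℂ (Fin n) → ℂ} (h : IsRationalInner n p q φ) (α : ℂ) {ρ : ℝ}
    (h0 : 0 ≤ ρ) (h1 : ρ < 1) : Measurable (clarkDensity φ α ρ) := by
  have hφ : (fun x : Fin n → UnitAddCircle => φ ((ρ : ℂ) • torusPt x)) =
      fun x => pEval p ((ρ : ℂ) • torusPt x) / pEval q ((ρ : ℂ) • torusPt x) := by
    funext x
    refine h.phi_eq _ (smul_mem_polydisc (torusPt_mem x) ?_)
    rwa [Complex.norm_real, Real.norm_of_nonneg h0]
  have hm : Measurable fun x : Fin n → UnitAddCircle => φ ((ρ : ℂ) • torusPt x) := by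
    rw [hφ]
    exact (((continuous_pEval_s12 p).comp (by fun_prop)).measurable).div
      (((continuous_pEval_s12 q).comp (by fun_prop)).measurable)
  exact ((measurable_const.sub (hm.norm.pow_const 2)).div
    ((measurable_const.sub hm).norm.pow_const 2)).ennreal_ofReal

theorem IsRationalInner.lintegral_clarkDensity {n : ℕ} {p q : MvPolynomial (Fin n) ℂ}
    {φ : EuclideanSpace ℂ (Fin n) → ℂ} (h : IsRationalInner n p q φ) {α : ℂ} (hα : ‖α‖ = 1)
    {ρ : ℝ} (h0 : 0 ≤ ρ) (h1 : ρ < 1) (x : Fin n → UnitAddCircle) :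
    ∫⁻ t : UnitAddCircle, clarkDensity φ α ρ (x + fun _ => t) =
      ENNReal.ofReal ((1 - ‖φ 0‖ ^ 2) / ‖α - φ 0‖ ^ 2) := by
  obtain ⟨P, Q, hQ, hφ⟩ := h.exists_slice (torusPt_mem x)
  have hρ : ∀ c : ℂ, ‖c‖ ≤ 1 → ‖(ρ : ℂ) * c‖ < 1 := by
    intro c hc
    rw [norm_mul, Complex.norm_real, Real.norm_of_nonneg h0]
    nlinarith [norm_nonneg c]
  have hlt : ∀ c : ℂ, ‖c‖ ≤ 1 → ‖P.eval (ρ * c) / Q.eval (ρ * c)‖ < 1 := by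
    intro c hc
    rw [← hφ _ (hρ c hc)]
    exact h.abs_lt_one _ (smul_mem_polydisc (torusPt_mem x) (hρ c hc))
  have key := lintegral_re_circlePt
    (f := fun c => (α + P.eval (ρ * c) / Q.eval (ρ * c)) / (α - P.eval (ρ * c) / Q.eval (ρ * c)))
    (DifferentiableOn.diffContOnCl (by
      rw [closure_ball _ one_ne_zero]
      intro c hc
      rw [mem_closedBall_zero_iff] at hc
      have hd : DifferentiableAt ℂ (fun c : ℂ => P.eval (ρ * c) / Q.eval (ρ * c)) c := by
        refine DifferentiableAt.div ?_ ?_ (hQ _ (hρ c hc).le)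
        · exact (P.differentiable.comp (by fun_prop)).differentiableAt
        · exact (Q.differentiable.comp (by fun_prop)).differentiableAt
      refine ((hd.const_add α).div (hd.const_sub α) fun h0 => ?_).differentiableWithinAt
      have := hlt c hc
      rw [← sub_eq_zero.1 h0, hα] at this
      exact lt_irrefl _ this)) (by
    intro c hc
    rw [re_add_div_sub hα]
    have := hlt c hc.le
    refine div_nonneg ?_ (by positivity)
    nlinarith [norm_nonneg (P.eval (ρ * c) / Q.eval (ρ * c))])
  have h00 : φ 0 = P.eval ((ρ : ℂ) * 0) / Q.eval ((ρ : ℂ) * 0) := by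
    rw [← hφ _ (hρ 0 (by simp)), mul_zero, zero_smul]
  rw [h00, ← re_add_div_sub hα, ← key]
  refine lintegral_congr fun t => ?_
  rw [re_add_div_sub hα, ← hφ _ (hρ _ (norm_circlePt t).le), clarkDensity, torusPt_add_const,
    smul_smul]

theorem IsRationalInner.exists_tendsto_lintegral_clarkDensity {n : ℕ}
    {p q : MvPolynomial (Fin n) ℂ} {φ : EuclideanSpace ℂ (Fin n) → ℂ}
    (h : IsRationalInner n p q φ) {α : ℂ} {x : Fin n → UnitAddCircle} {P Q : Polynomial ℂ}
    (hα : ‖α‖ = 1)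
    (hQ : ∀ c : ℂ, ‖c‖ ≤ 1 → Q.eval c ≠ 0)
    (hφ : ∀ c : ℂ, ‖c‖ < 1 → φ (c • torusPt x) = P.eval c / Q.eval c)
    (hPQ : ∀ t, ‖P.eval (circlePt t)‖ = ‖Q.eval (circlePt t)‖)
    {K : Set (EuclideanSpace ℂ (Fin n))} (hK : IsCompact K)
    (hxK : ∀ t, circlePt t • torusPt x ∈ K → P.eval (circlePt t) ≠ α * Q.eval (circlePt t)) 
    {ρ : ℕ → ℝ} (h0 : ∀ k, 0 ≤ ρ k) (h1 : ∀ k, ρ k < 1) (hρ : Tendsto ρ atTop (nhds 1)) :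
    ∃ δ > 0, Tendsto (fun k => ∫⁻ t : UnitAddCircle,
      (torusPt ⁻¹' Metric.thickening δ K).indicator (clarkDensity φ α (ρ k)) (x + fun _ => t))
      atTop (nhds 0) := by
  have hcs : Continuous fun t : UnitAddCircle => circlePt t • torusPt x := by fun_prop
  have hZ : IsClosed ((fun t : UnitAddCircle => circlePt t • torusPt x) ''
      {t | P.eval (circlePt t) = α * Q.eval (circlePt t)}) := by
    refine ((IsClosed.isCompact ?_).image hcs).isClosed
    exact isClosed_eq (P.continuous.comp continuous_circlePt)
      (continuous_const.mul (Q.continuous.comp continuous_circlePt))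
  obtain ⟨δ, hδ, hδK⟩ := hK.exists_cthickening_subset_open hZ.isOpen_compl (by
    rintro _ hζ ⟨t, ht, rfl⟩
    exact hxK t hζ ht)
  refine ⟨δ, hδ, ?_⟩
  set C : Set UnitAddCircle := {t | circlePt t • torusPt x ∈ Metric.cthickening δ K} with hC
  have hCc : IsCompact C := (Metric.isClosed_cthickening.preimage hcs).isCompact
  set G : ℝ × UnitAddCircle → ℝ := fun z =>
    (1 - ‖P.eval (z.1 * circlePt z.2) / Q.eval (z.1 * circlePt z.2)‖ ^ 2) /
      ‖α - P.eval (z.1 * circlePt z.2) / Q.eval (z.1 * circlePt z.2)‖ ^ 2 with hG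
  have hcP : Continuous fun z : ℝ × UnitAddCircle => P.eval (z.1 * circlePt z.2) :=
    P.continuous.comp (by fun_prop)
  have hcQ : Continuous fun z : ℝ × UnitAddCircle => Q.eval (z.1 * circlePt z.2) :=
    Q.continuous.comp (by fun_prop)
  have hn : ∀ r ∈ Icc (0 : ℝ) 1, ∀ t, ‖(r : ℂ) * circlePt t‖ = r := by
    intro r hr t
    rw [norm_mul, norm_circlePt, mul_one, Complex.norm_real, Real.norm_of_nonneg hr.1]
  have hGc : ContinuousOn G (Icc 0 1 ×ˢ C) := by
    have hdiv : ContinuousOn (fun z : ℝ × UnitAddCircle =>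
        P.eval (z.1 * circlePt z.2) / Q.eval (z.1 * circlePt z.2)) (Icc 0 1 ×ˢ C) :=
      hcP.continuousOn.div hcQ.continuousOn fun z hz => hQ _ ((hn _ hz.1 _).trans_le hz.1.2)
    refine (continuousOn_const.sub (hdiv.norm.pow 2)).div ((continuousOn_const.sub hdiv).norm.pow 2)
      ?_
    rintro ⟨r, t⟩ ⟨hr, ht⟩
    refine pow_ne_zero 2 (norm_ne_zero_iff.2 (sub_ne_zero.2 ?_))
    intro heq
    rcases hr.2.lt_or_eq with hr1 | rfl
    · have hlt : ‖(r : ℂ) * circlePt t‖ < 1 := (hn r hr t).trans_lt hr1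
      have := h.abs_lt_one _ (smul_mem_polydisc (torusPt_mem x) hlt)
      rw [hφ _ hlt, ← heq, hα] at this
      exact lt_irrefl _ this
    · simp only [Complex.ofReal_one, one_mul] at heq
      rw [eq_div_iff (hQ _ (norm_circlePt t).le)] at heq
      exact hδK ht ⟨t, heq.symm, rfl⟩
  obtain ⟨M, hM⟩ := (isCompact_Icc.prod hCc).exists_bound_of_continuousOn hGc
  have hval : ∀ k t, clarkDensity φ α (ρ k) (x + fun _ => t) = ENNReal.ofReal (G (ρ k, t)) := by
    intro k t
    rw [clarkDensity, torusPt_add_const, smul_smul, hφ]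
    exact (hn _ ⟨h0 k, (h1 k).le⟩ t).trans_lt (h1 k)
  have hlim : ∀ t ∈ C, Tendsto (fun k => ENNReal.ofReal (G (ρ k, t))) atTop (nhds 0) := by
    intro t ht
    have hG1 : G (1, t) = 0 := by
      simp [hG, hPQ, hQ _ (norm_circlePt t).le]
    have h2 : Tendsto (fun k => (ρ k, t)) atTop (nhdsWithin (1, t) (Icc 0 1 ×ˢ C)) :=
      tendsto_nhdsWithin_iff.2 ⟨hρ.prodMk_nhds tendsto_const_nhds,
        Eventually.of_forall fun k => ⟨⟨h0 k, (h1 k).le⟩, ht⟩⟩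
    have h3 := (hGc (1, t) ⟨⟨zero_le_one, le_rfl⟩, ht⟩).tendsto.comp h2
    rw [hG1] at h3
    have h4 := (ENNReal.continuous_ofReal.tendsto 0).comp h3
    rw [ENNReal.ofReal_zero] at h4
    exact h4
  have hmem : ∀ t, (x + fun _ => t) ∈ torusPt ⁻¹' Metric.thickening δ K → t ∈ C := by
    intro t ht
    refine Metric.thickening_subset_cthickening _ _ ?_
    rw [← torusPt_add_const]
    exact ht
  have hdom := tendsto_lintegral_of_dominated_convergence (μ := (volume : Measure UnitAddCircle))
    (F := fun k t => (torusPt ⁻¹' Metric.thickening δ K).indicator (clarkDensity φ α (ρ k))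
      (x + fun _ => t)) (f := fun _ => 0) (fun _ => ENNReal.ofReal M) (by
    intro k
    refine ((h.measurable_clarkDensity α (h0 k) (h1 k)).indicator ?_).comp (by fun_prop)
    exact (Metric.isOpen_thickening.preimage continuous_torusPt).measurableSet) (by
    refine fun k => Eventually.of_forall fun t => ?_
    by_cases ht : (x + fun _ => t) ∈ torusPt ⁻¹' Metric.thickening δ K
    · simp only [indicator_of_mem ht, hval]
      exact ENNReal.ofReal_le_ofReal ((le_abs_self _).trans
        (hM (ρ k, t) ⟨⟨h0 k, (h1 k).le⟩, hmem t ht⟩))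
    · simp [indicator_of_notMem ht]) (by simp) (by
    refine Eventually.of_forall fun t => ?_
    by_cases ht : (x + fun _ => t) ∈ torusPt ⁻¹' Metric.thickening δ K
    · simp only [indicator_of_mem ht, hval]
      exact hlim t (hmem t ht)
    · simp [indicator_of_notMem ht])
  simpa using hdom

theorem IsClarkMeasure.measure_eq_zero_of_isCompact {n : ℕ} {p q : MvPolynomial (Fin n) ℂ}
    {φ : EuclideanSpace ℂ (Fin n) → ℂ} (h : IsRationalInner n p q φ) {α : ℂ} (hα : ‖α‖ = 1)
    {μ : Measure (EuclideanSpace ℂ (Fin n))} (hμ : IsClarkMeasure n φ α μ)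
    {K : Set (EuclideanSpace ℂ (Fin n))} (hK : IsCompact K)
    (hae : ∀ᵐ x : Fin n → UnitAddCircle, ∀ t,
      circlePt t • torusPt x ∉ K ∩ radialFiber φ α) : μ K = 0 := by
  obtain ⟨ρ, h0, h1, hρ⟩ : ∃ ρ : ℕ → ℝ, (∀ k, 0 ≤ ρ k) ∧ (∀ k, ρ k < 1) ∧
      Tendsto ρ atTop (nhds 1) := by
    obtain ⟨ρ, -, hρ, hlim⟩ := exists_seq_strictMono_tendsto' (zero_lt_one (α := ℝ))
    exact ⟨ρ, fun k => (hρ k).1.le, fun k => (hρ k).2, hlim⟩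
  set V : ℕ → Set (EuclideanSpace ℂ (Fin n)) :=
    fun m => Metric.thickening (1 / ((m : ℝ) + 1)) K with hV
  set I : ℕ → ℕ → (Fin n → UnitAddCircle) → ℝ≥0∞ := fun m k x => ∫⁻ t : UnitAddCircle,
    (torusPt ⁻¹' V m).indicator (clarkDensity φ α (ρ k)) (x + fun _ => t) with hI
  have hFm : ∀ m k, Measurable ((torusPt ⁻¹' V m).indicator (clarkDensity φ α (ρ k))) :=
    fun m k => (h.measurable_clarkDensity α (h0 k) (h1 k)).indicator
      (Metric.isOpen_thickening.preimage continuous_torusPt).measurableSet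
  have hIm : ∀ m k, Measurable (I m k) := fun m k =>
    ((hFm m k).comp (measurePreserving_add_diagonal n).measurable).lintegral_prod_right'
  set c := ENNReal.ofReal ((1 - ‖φ 0‖ ^ 2) / ‖α - φ 0‖ ^ 2) with hc
  have hIc : ∀ m k x, I m k x ≤ c := by
    intro m k x
    rw [hc, ← h.lintegral_clarkDensity hα (h0 k) (h1 k) x]
    exact lintegral_mono fun t => indicator_le_self _ _ _
  have hle : ∀ m, μ K ≤ ∫⁻ x, limsup (fun k => I m k x) atTop := by
    intro m
    calc μ K ≤ μ (V m) := measure_mono (Metric.self_subset_thickening (by positivity) _)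
      _ ≤ liminf (fun k => ∫⁻ x, (torusPt ⁻¹' V m).indicator (clarkDensity φ α (ρ k)) x) atTop :=
        hμ.measure_le_liminf Metric.isOpen_thickening h0 h1 hρ
      _ = liminf (fun k => ∫⁻ x, I m k x) atTop := by
        congr 1
        funext k
        rw [← (measurePreserving_add_diagonal n).lintegral_comp (hFm m k)]
        exact lintegral_prod _
          ((hFm m k).comp (measurePreserving_add_diagonal n).measurable).aemeasurable
      _ ≤ limsup (fun k => ∫⁻ x, I m k x) atTop := liminf_le_limsup
      _ ≤ _ := limsup_lintegral_le (fun _ => c) (fun k => hIm m k)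
        (fun k => Eventually.of_forall fun x => hIc m k x) (by simp [hc])
  have hlim : Tendsto (fun m => ∫⁻ x, limsup (fun k => I m k x) atTop) atTop
      (nhds (∫⁻ _x : Fin n → UnitAddCircle, 0)) := by
    refine tendsto_lintegral_of_dominated_convergence (fun _ => c)
      (fun m => Measurable.limsup fun k => hIm m k)
      (fun m => Eventually.of_forall fun x => ?_) (by simp [hc]) ?_
    · exact limsup_le_of_le (by isBoundedDefault) (Eventually.of_forall fun k => hIc m k x)
    · filter_upwards [hae, h.ae_norm_slice_eq] with x hx hx'
      obtain ⟨P, Q, hQ, hPQ⟩ := h.exists_slice (torusPt_mem x)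
      obtain ⟨δ, hδ, hlim⟩ := h.exists_tendsto_lintegral_clarkDensity hα hQ hPQ (hx' P Q hQ hPQ)
        hK (fun t ht heq => hx t ⟨ht, by rw [← torusPt_add_const]; exact torusPt_mem _, by
          rw [hasRadialLimit_iff_of_slice hQ hPQ (norm_circlePt t),
            div_eq_iff (hQ _ (norm_circlePt t).le)]
          exact heq⟩) h0 h1 hρ
      refine tendsto_const_nhds.congr' ?_
      have hev := (tendsto_one_div_add_atTop_nhds_zero_nat (𝕜 := ℝ)).eventually (gt_mem_nhds hδ)
      filter_upwards [hev] with m hm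
      have hz : Tendsto (fun k => I m k x) atTop (nhds 0) := by
        refine tendsto_of_tendsto_of_tendsto_of_le_of_le tendsto_const_nhds hlim
          (fun k => zero_le) fun k => lintegral_mono fun t => ?_
        refine indicator_le_indicator_of_subset (preimage_mono ?_) (fun _ => zero_le) _
        exact Metric.thickening_mono hm.le K
      exact hz.limsup_eq.symm
  have := ge_of_tendsto' hlim hle
  simpa using this

theorem IsClarkMeasure.ae_mem_of_hausdorffMeasure {m : ℕ} {p q : MvPolynomial (Fin (m + 1)) ℂ}
    {φ : EuclideanSpace ℂ (Fin (m + 1)) → ℂ} (h : IsRationalInner (m + 1) p q φ) {α : ℂ}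
    (hα : ‖α‖ = 1) {μ : Measure (EuclideanSpace ℂ (Fin (m + 1)))}
    (hμ : IsClarkMeasure (m + 1) φ α μ) {A : Set (EuclideanSpace ℂ (Fin (m + 1)))}
    (hA : MeasurableSet A) (hnull : μH[(m : ℝ)] {ζ | ζ ∈ radialFiber φ α ∧ ζ ∉ A} = 0) :
    ∀ᵐ ζ ∂μ, ζ ∈ radialFiber φ α ∧ ζ ∈ A := by
  have := hμ.1
  have hm : MeasurableSet (radialFiber φ α ∩ A)ᶜ := ((measurableSet_radialFiber h α).inter hA).compl
  change μ (radialFiber φ α ∩ A)ᶜ = 0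
  rw [hm.measure_eq_iSup_isCompact]
  simp only [ENNReal.iSup_eq_zero]
  intro K hKs hK
  refine hμ.measure_eq_zero_of_isCompact h hα hK ?_
  filter_upwards [ae_forall_circlePt_smul_torusPt_notMem hnull] with x hx t ht
  exact hx t ⟨ht.2, fun hA => hKs ht.1 ⟨ht.2, hA⟩⟩

section Multiplier

variable {X : Type*} [TopologicalSpace X] [CompactSpace X] [MeasurableSpace X] [BorelSpace X]

theorem tendsto_toLp_of_ae {μ : Measure X} [IsFiniteMeasure μ] {g : ℕ → C(X, ℂ)} {g₀ : C(X, ℂ)}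
    {M : ℝ} (hM : ∀ k, ∀ᵐ x ∂μ, ‖g k x‖ ≤ M)
    (hlim : ∀ᵐ x ∂μ, Tendsto (fun k => g k x) atTop (nhds (g₀ x))) :
    Tendsto (fun k => ContinuousMap.toLp 2 μ ℂ (g k)) atTop (nhds (ContinuousMap.toLp 2 μ ℂ g₀)) := by
  rw [Lp.tendsto_Lp_iff_tendsto_eLpNorm']
  have h1 : ∀ k, eLpNorm (⇑(ContinuousMap.toLp 2 μ ℂ (g k)) - ⇑(ContinuousMap.toLp 2 μ ℂ g₀)) 2 μ =
      (∫⁻ x, ‖g k x - g₀ x‖ₑ ^ (2 : ℝ) ∂μ) ^ (1 / 2 : ℝ) := by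
    intro k
    rw [eLpNorm_congr_ae ((ContinuousMap.coeFn_toLp μ (g k)).sub (ContinuousMap.coeFn_toLp μ g₀)),
      eLpNorm_eq_lintegral_rpow_enorm_toReal (by norm_num) (by norm_num)]
    simp
  simp only [h1]
  have h2 : Tendsto (fun k => ∫⁻ x, ‖g k x - g₀ x‖ₑ ^ (2 : ℝ) ∂μ) atTop (nhds (∫⁻ _x, 0 ∂μ)) := by
    refine tendsto_lintegral_of_dominated_convergence
      (fun _ => ENNReal.ofReal (M + ‖g₀‖) ^ (2 : ℝ)) (fun k => ?_) (fun k => ?_) ?_ ?_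
    · exact (((g k).continuous.sub g₀.continuous).measurable.enorm).pow_const _
    · filter_upwards [hM k] with x hx
      refine ENNReal.rpow_le_rpow ?_ (by norm_num)
      rw [← ofReal_norm]
      exact ENNReal.ofReal_le_ofReal
        ((norm_sub_le _ _).trans (add_le_add hx (g₀.norm_coe_le_norm x)))
    · rw [lintegral_const]
      exact ENNReal.mul_ne_top (ENNReal.rpow_ne_top_of_nonneg (by norm_num) ENNReal.ofReal_ne_top)
        (measure_ne_top _ _)
    · filter_upwards [hlim] with x hx
      have h3 : Tendsto (fun k => ‖g k x - g₀ x‖ₑ) atTop (nhds 0) := by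
        simpa using (hx.sub_const (g₀ x)).enorm
      have h4 := (ENNReal.continuous_rpow_const (y := 2)).tendsto 0 |>.comp h3
      rw [ENNReal.zero_rpow_of_pos (by norm_num)] at h4
      exact h4
  have h5 := (ENNReal.continuous_rpow_const (y := 1 / 2)).tendsto _ |>.comp h2
  rw [lintegral_zero, ENNReal.zero_rpow_of_pos (by norm_num)] at h5
  exact h5

/-- The continuous functions in the `L²(μ)`-closure of a subalgebra of `C(X, ℂ)`. -/
def l2Closure (μ : Measure X) [IsFiniteMeasure μ] (A : Subalgebra ℂ C(X, ℂ)) :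
    Submodule ℂ C(X, ℂ) :=
  ((A.toSubmodule.map (ContinuousMap.toLp 2 μ ℂ).toLinearMap).topologicalClosure).comap
    (ContinuousMap.toLp 2 μ ℂ).toLinearMap

theorem mem_l2Closure {μ : Measure X} [IsFiniteMeasure μ] {A : Subalgebra ℂ C(X, ℂ)}
    {f : C(X, ℂ)} : f ∈ l2Closure μ A ↔
      ContinuousMap.toLp 2 μ ℂ f ∈ closure (ContinuousMap.toLp 2 μ ℂ '' (A : Set C(X, ℂ))) :=
  Iff.rfl

/-- The continuous functions multiplying `l2Closure μ A` into itself. -/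
def multiplierAlgebra (μ : Measure X) [IsFiniteMeasure μ] (A : Subalgebra ℂ C(X, ℂ)) :
    Subalgebra ℂ C(X, ℂ) where
  carrier := {b | ∀ f ∈ l2Closure μ A, b * f ∈ l2Closure μ A}
  mul_mem' {a b} ha hb f hf := by
    rw [mul_assoc]
    exact ha _ (hb f hf)
  add_mem' {a b} ha hb f hf := by
    rw [add_mul]
    exact add_mem (ha f hf) (hb f hf)
  algebraMap_mem' c f hf := by
    rw [← Algebra.smul_def]
    exact Submodule.smul_mem _ c hf

theorem isClosed_multiplierAlgebra (μ : Measure X) [IsFiniteMeasure μ]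
    (A : Subalgebra ℂ C(X, ℂ)) : IsClosed (multiplierAlgebra μ A : Set C(X, ℂ)) := by
  have h : (multiplierAlgebra μ A : Set C(X, ℂ)) =
      ⋂ f ∈ l2Closure μ A, {b | b * f ∈ l2Closure μ A} := by
    ext b
    simp only [mem_iInter]
    rfl
  rw [h]
  refine isClosed_biInter fun f _ => ?_
  have h2 : IsClosed (l2Closure μ A : Set C(X, ℂ)) :=
    isClosed_closure.preimage (ContinuousMap.toLp 2 μ ℂ).continuous
  exact h2.preimage (by fun_prop)

theorem le_multiplierAlgebra (μ : Measure X) [IsFiniteMeasure μ] (A : Subalgebra ℂ C(X, ℂ)) :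
    A ≤ multiplierAlgebra μ A := by
  intro b hb f hf
  rw [mem_l2Closure, Metric.mem_closure_iff] at hf ⊢
  intro ε hε
  obtain ⟨_, ⟨a, ha, rfl⟩, hd⟩ := hf (ε / (‖b‖ + 1)) (by positivity)
  refine ⟨_, ⟨b * a, A.mul_mem hb ha, rfl⟩, ?_⟩
  rw [dist_eq_norm, ← map_sub] at hd ⊢
  have hle : ‖ContinuousMap.toLp 2 μ ℂ (b * f - b * a)‖ ≤
      ‖b‖ * ‖ContinuousMap.toLp 2 μ ℂ (f - a)‖ := by
    refine Lp.norm_le_mul_norm_of_ae_le_mul ?_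
    filter_upwards [ContinuousMap.coeFn_toLp (p := 2) (𝕜 := ℂ) μ (b * f - b * a),
      ContinuousMap.coeFn_toLp (p := 2) (𝕜 := ℂ) μ (f - a)] with x h1 h2
    rw [h1, h2, ← mul_sub, ContinuousMap.mul_apply, norm_mul]
    exact mul_le_mul_of_nonneg_right (b.norm_coe_le_norm x) (norm_nonneg _)
  refine hle.trans_lt ?_
  rw [lt_div_iff₀ (by positivity)] at hd
  nlinarith [norm_nonneg (ContinuousMap.toLp 2 μ ℂ (f - a)), norm_nonneg b]

theorem mem_multiplierAlgebra_of_tendsto_ae {μ : Measure X} [IsFiniteMeasure μ]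
    {A : Subalgebra ℂ C(X, ℂ)} {b : ℕ → C(X, ℂ)} {b₀ : C(X, ℂ)}
    (hb : ∀ k, b k ∈ multiplierAlgebra μ A) {M : ℝ} (hM : ∀ k, ∀ᵐ x ∂μ, ‖b k x‖ ≤ M)
    (hlim : ∀ᵐ x ∂μ, Tendsto (fun k => b k x) atTop (nhds (b₀ x))) :
    b₀ ∈ multiplierAlgebra μ A := by
  intro f hf
  rw [mem_l2Closure]
  refine isClosed_closure.mem_of_tendsto (tendsto_toLp_of_ae (g := fun k => b k * f)
    (M := M * ‖f‖) (fun k => ?_) ?_) (Eventually.of_forall fun k => hb k f hf)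
  · filter_upwards [hM k] with x hx
    rw [ContinuousMap.mul_apply, norm_mul]
    exact mul_le_mul hx (f.norm_coe_le_norm x) (norm_nonneg _) ((norm_nonneg _).trans hx)
  · filter_upwards [hlim] with x hx
    exact hx.mul_const _

theorem dense_toLp_of_star_subset_multiplierAlgebra [T2Space X] {μ : Measure X} [IsFiniteMeasure μ]
    [μ.WeaklyRegular] {A : Subalgebra ℂ C(X, ℂ)} {s : Set C(X, ℂ)} (hs : s ⊆ A)
    (hstar : star s ⊆ multiplierAlgebra μ A)
    (hsep : ((fun f : C(X, ℂ) => (f : X → ℂ)) '' s).SeparatesPoints) :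
    Dense (ContinuousMap.toLp 2 μ ℂ '' (A : Set C(X, ℂ))) := by
  have hle : (StarAlgebra.adjoin ℂ s).toSubalgebra ≤ multiplierAlgebra μ A := by
    rw [StarAlgebra.adjoin_toSubalgebra, Algebra.adjoin_le_iff]
    exact union_subset (hs.trans (le_multiplierAlgebra μ A)) hstar
  have htop := ContinuousMap.starSubalgebra_topologicalClosure_eq_top_of_separatesPoints
    (StarAlgebra.adjoin ℂ s) fun x y hxy => (hsep hxy).imp fun f hf =>
      ⟨image_mono (StarAlgebra.subset_adjoin ℂ s) hf.1, hf.2⟩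
  have hall : ∀ f, f ∈ l2Closure μ A := by
    intro f
    have hf : f ∈ closure ((StarAlgebra.adjoin ℂ s : StarSubalgebra ℂ C(X, ℂ)) : Set C(X, ℂ)) := by
      rw [← StarSubalgebra.topologicalClosure_coe, htop]
      trivial
    have h1 : f ∈ multiplierAlgebra μ A :=
      closure_minimal (fun x hx => hle hx) (isClosed_multiplierAlgebra μ A) hf
    have h2 := h1 1 (subset_closure ⟨1, A.one_mem, rfl⟩)
    rwa [mul_one] at h2
  have hd := ContinuousMap.toLp_denseRange ℂ μ ℂ (p := 2) (by norm_num)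
  refine dense_iff_closure_eq.2 (eq_univ_of_univ_subset ?_)
  rw [← hd.closure_range]
  exact closure_minimal (by rintro _ ⟨f, rfl⟩; exact hall f) isClosed_closure

end Multiplier

theorem inverse_mem_of_isClosed {X : Type*} [TopologicalSpace X] [CompactSpace X]
    {𝓜 : Subalgebra ℂ C(X, ℂ)} (h𝓜 : IsClosed (𝓜 : Set C(X, ℂ))) {F : ℝ → C(X, ℂ)}
    (hF : Continuous F) {r : ℝ} (hr : 0 ≤ r)
    (hmem : ∀ t, F t ∈ 𝓜) (hunit : ∀ t ∈ Icc 0 r, IsUnit (F t)) {c : ℂ} (hc : c ≠ 0)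
    (h0 : F 0 = algebraMap ℂ _ c) : ∃ g ∈ 𝓜, g * F r = 1 := by
  have : CompleteSpace 𝓜 := h𝓜.completeSpace_coe
  set G : Icc (0 : ℝ) r → 𝓜 := fun t => ⟨F t, hmem t⟩ with hG
  have hGc : Continuous G := (hF.comp continuous_subtype_val).subtype_mk _
  have : Nonempty (Icc (0 : ℝ) r) := ⟨⟨0, le_rfl, hr⟩⟩
  have : PreconnectedSpace (Icc (0 : ℝ) r) := Subtype.preconnectedSpace isPreconnected_Icc
  have hopen : IsOpen (G ⁻¹' {u | IsUnit u}) := Units.isOpen.preimage hGc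
  have hclosed : IsClosed (G ⁻¹' {u | IsUnit u}) := by
    refine isClosed_of_closure_subset fun t ht => ?_
    have hne : (nhdsWithin t (G ⁻¹' {u | IsUnit u})).NeBot := mem_closure_iff_nhdsWithin_neBot.1 ht
    refine @Subalgebra.isUnit_of_isUnit_val_of_eventually ℂ _ _ _ _ _ _ _ _ _ 𝓜 h𝓜
      (map G (nhdsWithin t (G ⁻¹' {u | IsUnit u}))) (G t) (hunit t t.2)
      ((hGc.tendsto t).mono_left nhdsWithin_le_nhds) ?_ inferInstance
    exact eventually_map.2 self_mem_nhdsWithin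
  have huniv := IsClopen.eq_univ ⟨hclosed, hopen⟩ ⟨⟨0, le_rfl, hr⟩, by
    have : G ⟨0, le_rfl, hr⟩ = algebraMap ℂ 𝓜 c := Subtype.ext h0
    simp only [mem_preimage, this]
    exact (isUnit_iff_ne_zero.2 hc).map _⟩
  have hu : IsUnit (G ⟨r, hr, le_rfl⟩) := (huniv ▸ mem_univ _ : _ ∈ G ⁻¹' {u | IsUnit u})
  obtain ⟨g, hg⟩ := hu.exists_left_inv
  exact ⟨g, g.2, congrArg Subtype.val hg⟩

theorem norm_eval_one_le_two_pow_mul {S : Polynomial ℂ} (hS : ∀ c : ℂ, ‖c‖ < 1 → S.eval c ≠ 0)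
    {ρ : ℝ} (h0 : 0 ≤ ρ) (h1 : ρ < 1) :
    ‖S.eval 1‖ ≤ 2 ^ S.natDegree * ‖S.eval (ρ : ℂ)‖ := by
  have key : ∀ m : Multiset ℂ, (∀ a ∈ m, 1 ≤ ‖a‖) →
      ‖(m.map fun a => 1 - a).prod‖ ≤ 2 ^ m.card * ‖(m.map fun a => (ρ : ℂ) - a).prod‖ := by
    intro m
    induction m using Multiset.induction_on with
    | empty => simp
    | cons a m ih =>
      intro h
      have ha : ‖1 - a‖ ≤ 2 * ‖(ρ : ℂ) - a‖ := by
        have h2 := norm_add_le (1 - (ρ : ℂ)) (ρ - a)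
        have h3 : ‖1 - (ρ : ℂ)‖ = 1 - ρ := by
          rw [← Complex.ofReal_one, ← Complex.ofReal_sub, Complex.norm_real,
            Real.norm_of_nonneg (by linarith)]
        have h4 := norm_sub_norm_le a (ρ : ℂ)
        rw [Complex.norm_real, Real.norm_of_nonneg h0, norm_sub_rev] at h4
        rw [sub_add_sub_cancel] at h2
        linarith [h a (Multiset.mem_cons_self a m)]
      have hm := ih fun b hb => h b (Multiset.mem_cons_of_mem hb)
      rw [Multiset.map_cons, Multiset.map_cons, Multiset.prod_cons, Multiset.prod_cons, norm_mul,
        norm_mul, Multiset.card_cons, pow_succ]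
      calc _ ≤ (2 * ‖(ρ : ℂ) - a‖) * (2 ^ m.card * ‖(m.map fun a => (ρ : ℂ) - a).prod‖) :=
            mul_le_mul ha hm (norm_nonneg _) (by positivity)
        _ = _ := by ring
  have hs : S.Splits := IsAlgClosed.splits S
  have hk := key S.roots fun a ha => by
    by_contra! hlt
    exact hS a hlt (Polynomial.isRoot_of_mem_roots ha)
  rw [hs.eval_eq_prod_roots, hs.eval_eq_prod_roots, norm_mul, norm_mul]
  calc _ ≤ ‖S.leadingCoeff‖ * (2 ^ S.roots.card * ‖(S.roots.map fun a => (ρ : ℂ) - a).prod‖) :=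
        mul_le_mul_of_nonneg_left hk (norm_nonneg _)
    _ ≤ ‖S.leadingCoeff‖ * (2 ^ S.natDegree * ‖(S.roots.map fun a => (ρ : ℂ) - a).prod‖) := by
        gcongr
        · norm_num
        · exact S.card_roots'
    _ = _ := by ring

theorem norm_pEval_le_two_pow_mul {n : ℕ} {q : MvPolynomial (Fin n) ℂ}
    (hq : ∀ z ∈ polydisc n, pEval q z ≠ 0) {ζ : EuclideanSpace ℂ (Fin n)}
    (hζ : ζ ∈ torus (Fin n)) {ρ : ℝ} (h0 : 0 ≤ ρ) (h1 : ρ < 1) :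
    ‖pEval q ζ‖ ≤ 2 ^ q.totalDegree * ‖pEval q ((ρ : ℂ) • ζ)‖ := by
  have h := norm_eval_one_le_two_pow_mul (S := slice q ζ) (fun c hc => by
    rw [eval_slice]
    exact hq _ (smul_mem_polydisc hζ hc)) h0 h1
  rw [eval_slice, eval_slice, one_smul] at h
  refine h.trans (mul_le_mul_of_nonneg_right (pow_le_pow_right₀ one_le_two ?_) (norm_nonneg _))
  have hd := MvPolynomial.aeval_natDegree_le (n := 1) q le_rfl
    (fun i => Polynomial.C (ζ i) * Polynomial.X) fun i =>
      (Polynomial.natDegree_C_mul_le _ _).trans Polynomial.natDegree_X_le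
  rwa [mul_one] at hd

instance (n : ℕ) : CompactSpace (torus (Fin n)) := isCompact_iff_compactSpace.1 isCompact_torus_s12

/-- The `j`-th coordinate function on the torus. -/
def torusCoord {n : ℕ} (j : Fin n) : C(torus (Fin n), ℂ) := ⟨fun ζ => ζ.1 j, by fun_prop⟩

/-- The algebra of holomorphic polynomials on the torus. -/
def torusPolynomials (n : ℕ) : Subalgebra ℂ C(torus (Fin n), ℂ) :=
  (MvPolynomial.aeval (torusCoord (n := n))).range

theorem aeval_continuousMap_apply {X σ : Type*} [TopologicalSpace X] (f : σ → C(X, ℂ))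
    (p : MvPolynomial σ ℂ) (x : X) :
    MvPolynomial.aeval f p x = MvPolynomial.eval (fun i => f i x) p := by
  induction p using MvPolynomial.induction_on with
  | C a => simp
  | add p q hp hq => simp [hp, hq]
  | mul_X p i hp => simp [hp]

theorem mem_torusPolynomials {n : ℕ} {f : C(torus (Fin n), ℂ)} :
    f ∈ torusPolynomials n ↔ ∃ p : MvPolynomial (Fin n) ℂ, ∀ ζ, f ζ = pEval p ζ := by
  refine exists_congr fun p => ?_
  rw [ContinuousMap.ext_iff]
  refine forall_congr' fun ζ => ?_
  rw [eq_comm]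
  exact Eq.congr_right (aeval_continuousMap_apply _ p ζ)

/-- The dilate `ζ ↦ q(tζ)` of a polynomial, as a function on the torus. -/
def dilate {n : ℕ} (q : MvPolynomial (Fin n) ℂ) (t : ℝ) : C(torus (Fin n), ℂ) :=
  ⟨fun ζ => pEval q ((t : ℂ) • ζ.1), (continuous_pEval_s12 q).comp (by fun_prop)⟩

theorem dilate_mem {n : ℕ} (q : MvPolynomial (Fin n) ℂ) (t : ℝ) :
    dilate q t ∈ torusPolynomials n := by
  refine mem_torusPolynomials.2
    ⟨MvPolynomial.bind₁ (fun i => MvPolynomial.C (t : ℂ) * MvPolynomial.X i) q, fun ζ => ?_⟩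
  rw [pEval, ← MvPolynomial.coe_aeval_eq_eval, RingHom.coe_coe, MvPolynomial.aeval_bind₁]
  simp [dilate, pEval]

theorem star_torusCoord_mem_multiplierAlgebra {n : ℕ} {μ : Measure (torus (Fin n))}
    [IsFiniteMeasure μ] {j : Fin n} {p q : MvPolynomial (Fin n) ℂ}
    (hq : ∀ z ∈ polydisc n, pEval q z ≠ 0)
    (hae : ∀ᵐ ζ : torus (Fin n) ∂μ, pEval q ζ ≠ 0 ∧ pEval q ζ = ζ.1 j * pEval p ζ) :
    star (torusCoord j) ∈ multiplierAlgebra μ (torusPolynomials n) := by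
  obtain ⟨ρ, h0, h1, hρ⟩ : ∃ ρ : ℕ → ℝ, (∀ k, 0 ≤ ρ k) ∧ (∀ k, ρ k < 1) ∧
      Tendsto ρ atTop (nhds 1) := by
    obtain ⟨ρ, -, hρ, hlim⟩ := exists_seq_strictMono_tendsto' (zero_lt_one (α := ℝ))
    exact ⟨ρ, fun k => (hρ k).1.le, fun k => (hρ k).2, hlim⟩
  have hle := le_multiplierAlgebra μ (torusPolynomials n)
  have hF : Continuous (dilate q) := by
    refine ContinuousMap.continuous_of_continuous_uncurry _ ?_
    exact (continuous_pEval_s12 q).comp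
      (f := fun z : ℝ × torus (Fin n) => ((z.1 : ℝ) : ℂ) • z.2.1) (by fun_prop)
  have hne : ∀ t ∈ Ico (0 : ℝ) 1, ∀ ζ : torus (Fin n), pEval q ((t : ℂ) • ζ.1) ≠ 0 := by
    intro t ht ζ
    refine hq _ (smul_mem_polydisc ζ.2 ?_)
    rw [Complex.norm_real, Real.norm_of_nonneg ht.1]
    exact ht.2
  have hinv : ∀ k, ∃ g ∈ multiplierAlgebra μ (torusPolynomials n), g * dilate q (ρ k) = 1 := by
    intro k
    refine inverse_mem_of_isClosed (isClosed_multiplierAlgebra μ _) hF (h0 k)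
      (fun t => hle (dilate_mem q t)) (fun t ht => ?_) (c := pEval q 0) (hq 0 fun i => by simp) ?_
    · exact ContinuousMap.isUnit_iff_forall_ne_zero _ |>.2 (hne t ⟨ht.1, ht.2.trans_lt (h1 k)⟩)
    · ext ζ
      simp [dilate]
  choose g hg hgq using hinv
  have hgv : ∀ k ζ, g k ζ = (pEval q ((ρ k : ℂ) • ζ.1))⁻¹ := fun k ζ =>
    eq_inv_of_mul_eq_one_left (DFunLike.congr_fun (hgq k) ζ)
  have hpv : ∀ ζ : torus (Fin n), dilate p 1 ζ = pEval p ζ := fun ζ => by simp [dilate]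
  have hnorm : ∀ ζ : torus (Fin n), pEval q ζ = ζ.1 j * pEval p ζ →
      ‖pEval q ζ‖ = ‖pEval p ζ‖ := fun ζ h => by rw [h, norm_mul, ζ.2 j, one_mul]
  refine mem_multiplierAlgebra_of_tendsto_ae (b := fun k => dilate p 1 * g k)
    (fun k => mul_mem (hle (dilate_mem p 1)) (hg k)) (M := 2 ^ q.totalDegree) (fun k => ?_) ?_
  · filter_upwards [hae] with ζ hζ
    have h2 := norm_pEval_le_two_pow_mul hq ζ.2 (h0 k) (h1 k)
    rw [ContinuousMap.mul_apply, hpv, hgv, ← div_eq_mul_inv, norm_div,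
      div_le_iff₀ (norm_pos_iff.2 (hne _ ⟨h0 k, h1 k⟩ ζ)), ← hnorm ζ hζ.2]
    exact h2
  · filter_upwards [hae] with ζ hζ
    have h2 : star (torusCoord j) ζ = pEval p ζ * (pEval q ζ)⁻¹ := by
      have h3 : star (ζ.1 j) * ζ.1 j = 1 := by
        rw [Complex.star_def, mul_comm, Complex.mul_conj, Complex.normSq_eq_norm_sq, ζ.2 j]
        simp
      rw [eq_mul_inv_iff_mul_eq₀ hζ.1, hζ.2]
      change star (ζ.1 j) * _ = _
      rw [← mul_assoc, h3, one_mul]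
    have h4 : Tendsto (fun k => pEval q ((ρ k : ℂ) • ζ.1)) atTop (nhds (pEval q ζ)) := by
      have hc : Continuous fun t : ℝ => pEval q ((t : ℂ) • ζ.1) :=
        (continuous_pEval_s12 q).comp (by fun_prop)
      have := (hc.tendsto 1).comp hρ
      rw [Complex.ofReal_one, one_smul] at this
      exact this
    rw [h2]
    refine (tendsto_const_nhds.mul (h4.inv₀ hζ.1)).congr fun k => ?_
    rw [ContinuousMap.mul_apply, hpv, hgv]

theorem closure_polyLp_eq_univ {n : ℕ} {μ : Measure (EuclideanSpace ℂ (Fin n))} [IsFiniteMeasure μ]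
    (hμ : μ (torus (Fin n))ᶜ = 0)
    (h : ∀ j : Fin n, ∃ p q : MvPolynomial (Fin n) ℂ, (∀ z ∈ polydisc n, pEval q z ≠ 0) ∧
      ∀ᵐ ζ ∂μ, pEval q ζ ≠ 0 ∧ pEval q ζ = ζ j * pEval p ζ) :
    closure (polyLp n μ) = Set.univ := by
  have hT : MeasurableSet (torus (Fin n)) := isCompact_torus_s12.isClosed.measurableSet
  set ν : Measure (torus (Fin n)) := μ.comap Subtype.val with hν
  have hmp : MeasurePreserving (Subtype.val : torus (Fin n) → EuclideanSpace ℂ (Fin n)) ν μ := by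
    refine ⟨measurable_subtype_coe, ?_⟩
    rw [hν, map_comap_subtype_coe hT, Measure.restrict_eq_self_of_ae_mem]
    exact hμ
  have : IsFiniteMeasure ν := ⟨by
    rw [← preimage_univ (f := (Subtype.val : torus (Fin n) → EuclideanSpace ℂ (Fin n))),
      hmp.measure_preimage nullMeasurableSet_univ]
    exact measure_lt_top _ _⟩
  have hd : Dense (ContinuousMap.toLp 2 ν ℂ '' (torusPolynomials n : Set C(torus (Fin n), ℂ))) := by
    refine dense_toLp_of_star_subset_multiplierAlgebra (s := range torusCoord) ?_ ?_ ?_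
    · rintro _ ⟨j, rfl⟩
      exact ⟨MvPolynomial.X j, MvPolynomial.aeval_X _ _⟩
    · intro f hf
      obtain ⟨j, hj⟩ := hf
      obtain ⟨p, q, hq, hae⟩ := h j
      rw [← star_star f, ← hj]
      exact star_torusCoord_mem_multiplierAlgebra hq (hmp.quasiMeasurePreserving.ae hae)
    · intro x y hxy
      obtain ⟨j, hj⟩ : ∃ j, x.1 j ≠ y.1 j := by
        by_contra! hall
        exact hxy (Subtype.ext (PiLp.ext hall))
      exact ⟨_, ⟨_, ⟨j, rfl⟩, rfl⟩, hj⟩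
  refine eq_univ_of_forall fun f => ?_
  rw [EMetric.mem_closure_iff]
  intro ε hε
  have hfm := (Lp.memLp f).comp_measurePreserving hmp
  obtain ⟨_, ⟨a, ha, rfl⟩, hlt⟩ := EMetric.mem_closure_iff.1 (hd (hfm.toLp _)) ε hε
  obtain ⟨p, hp⟩ := mem_torusPolynomials.1 ha
  have hpm : MemLp (pEval p) 2 μ := by
    have hc := (continuous_pEval_s12 p).aestronglyMeasurable (μ := μ)
    obtain ⟨M, hM⟩ := isCompact_torus_s12.exists_bound_of_continuousOn
      (continuous_pEval_s12 p).continuousOn (s := torus (Fin n))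
    exact MemLp.of_bound hc M (measure_mono_null (fun ζ hζ hζT => hζ (hM ζ hζT)) hμ)
  refine ⟨hpm.toLp _, ⟨p, hpm.coeFn_toLp⟩, ?_⟩
  rw [Lp.edist_def] at hlt ⊢
  refine lt_of_eq_of_lt ?_ hlt
  rw [← eLpNorm_comp_measurePreserving ((Lp.aestronglyMeasurable _).sub
    (Lp.aestronglyMeasurable _)) hmp]
  refine eLpNorm_congr_ae ?_
  filter_upwards [hfm.coeFn_toLp, ContinuousMap.coeFn_toLp (p := 2) (𝕜 := ℂ) ν a,
    hmp.quasiMeasurePreserving.ae hpm.coeFn_toLp] with ζ h1 h2 h3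
  simp only [Function.comp_apply, Pi.sub_apply, h1, h2, h3, hp]

/-- Sufficient condition for `H²(μ_α) = L²(μ_α)`: if for each `j` the conjugate coordinate
`conj ζ_j` coincides on `φ₁⁻¹(α)` with a rational function `p_j/q_j` whose denominator is
zero-free on `𝔻ⁿ` and `ℋ^{n-1}`-a.e. nonzero on `φ₁⁻¹(α)`, then `H²(μ_α) = L²(μ_α)`. -/
theorem H2_eq_L2_of_rational_conjugates {n : ℕ}
    (φ : EuclideanSpace ℂ (Fin n) → ℂ)
    (hφ : ∃ p q : MvPolynomial (Fin n) ℂ, IsRationalInner n p q φ)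
    (α : ℂ) (hα : ‖α‖ = 1)
    (μ : Measure (EuclideanSpace ℂ (Fin n))) (hμ : IsClarkMeasure n φ α μ)
    (h : ∀ j : Fin n, ∃ pj qj : MvPolynomial (Fin n) ℂ,
      (∀ z ∈ polydisc n, pEval qj z ≠ 0) ∧
      μH[(n : ℝ) - 1] {ζ | ζ ∈ radialFiber φ α ∧ pEval qj ζ = 0} = 0 ∧
      ∀ ζ ∈ radialFiber φ α, pEval qj ζ = ζ j * pEval pj ζ) :
    closure (polyLp n μ) = Set.univ := by
  obtain ⟨p, q, hpq⟩ := hφ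
  have := hμ.1
  refine closure_polyLp_eq_univ hμ.2.1 fun j => ?_
  obtain ⟨pj, qj, hq, hnull, hfib⟩ := h j
  refine ⟨pj, qj, hq, ?_⟩
  cases n with
  | zero => exact j.elim0
  | succ m =>
    rw [show ((m + 1 : ℕ) : ℝ) - 1 = m by push_cast; ring] at hnull
    filter_upwards [hμ.ae_mem_of_hausdorffMeasure hpq hα (A := {ζ | pEval qj ζ ≠ 0})
      (isOpen_ne_fun (continuous_pEval_s12 qj) continuous_const).measurableSet
      (by simpa using hnull)] with ζ hζ
    exact ⟨hζ.2, hfib ζ hζ.1⟩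

end
end
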